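/- Let f ∈ L_p(𝕋^d) with 1 < p < ∞ and α > 0, and set τ = max(2,p) and θ = min(2,p). Then for every n ∈ ℕ, (Σ_{k=n+1}^∞ 2^{-kατ}‖(−Δ)^{α/2}P_{2^k}(f)‖_{L_p(𝕋^d)}^τ)^{1/τ} ≤ C·ω_α(f, 2^{-n})_{L_p(𝕋^d)} and ω_α(f, 2^{-n})_{L_p(𝕋^d)} ≤ C·(Σ_{k=n+1}^∞ 2^{-kαθ}‖(−Δ)^{α/2}P_{2^k}(f)‖_{L_p(𝕋^d)}^θ)^{1/θ}, with C independent of f and n. -/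

import Mathlib

open scoped ENNReal
open MeasureTheory

/-- Lebesgue measure on the fundamental cube `[0,2π]^d` of the torus `𝕋^d`. -/
noncomputable def torusMeasure (d : ℕ) : Measure (Fin d → ℝ) :=
  volume.restrict (Set.univ.pi fun _ => Set.Icc 0 (2 * Real.pi))

/-- Euclidean norm of a vector in `ℝ^d` (presented as `Fin d → ℝ`). -/
noncomputable def euclNorm {d : ℕ} (x : Fin d → ℝ) : ℝ :=
  Real.sqrt (∑ i, x i ^ 2)

/-- `f` is `2π`-periodic in each variable. -/
def Periodic2Pi {d : ℕ} (f : (Fin d → ℝ) → ℂ) : Prop :=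
  ∀ (x : Fin d → ℝ) (i : Fin d), f (x + (2 * Real.pi) • (Pi.single i 1 : Fin d → ℝ)) = f x

/-- The character `e^{i⟨k,x⟩}`. -/
noncomputable def expChar {d : ℕ} (k : Fin d → ℤ) (x : Fin d → ℝ) : ℂ :=
  Complex.exp (Complex.I * ((∑ i, (k i : ℝ) * x i : ℝ) : ℂ))

/-- Trigonometric polynomials of (spherical) degree at most `n`:
`𝒯_n = span{e^{i⟨k,x⟩} : |k| ≤ n}`. -/
def TrigPoly (d : ℕ) (n : ℝ) : Set ((Fin d → ℝ) → ℂ) :=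
  {T | ∃ (s : Finset (Fin d → ℤ)) (c : (Fin d → ℤ) → ℂ),
    (∀ k ∈ s, euclNorm (fun i => (k i : ℝ)) ≤ n) ∧
    ∀ x, T x = ∑ k ∈ s, c k * expChar k x}

/-- Forward difference `Δ_h f = f(·+h) − f(·)`. -/
def cDiff {d : ℕ} (h : Fin d → ℝ) (f : (Fin d → ℝ) → ℂ) : (Fin d → ℝ) → ℂ :=
  fun x => f (x + h) - f x

/-- Modulus of smoothness `ω_r(f,δ)_p = sup_{|h|≤δ} ‖Δ_h^r f‖_{L_p(𝕋^d)}`. -/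
noncomputable def modSmooth (d : ℕ) (r : ℕ) (p : ℝ≥0∞) (f : (Fin d → ℝ) → ℂ) (δ : ℝ) :
    ℝ≥0∞ :=
  ⨆ h : {h : Fin d → ℝ // euclNorm h ≤ δ}, eLpNorm ((cDiff h.1)^[r] f) p (torusMeasure d)

/-- Partial derivative in the `i`-th coordinate direction. -/
noncomputable def pderivCoord {d : ℕ} (i : Fin d) (f : (Fin d → ℝ) → ℂ) :
    (Fin d → ℝ) → ℂ :=
  fun x => deriv (fun t : ℝ => f (x + t • (Pi.single i 1 : Fin d → ℝ))) 0

/-- Iterated partial derivative `D^ν` for the multi-index `ν`. -/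
noncomputable def mderiv {d : ℕ} (ν : Fin d → ℕ) (f : (Fin d → ℝ) → ℂ) :
    (Fin d → ℝ) → ℂ :=
  (List.ofFn fun i : Fin d => (pderivCoord i)^[ν i]).foldr (· ∘ ·) id f

/-- Homogeneous Sobolev seminorm `‖T‖_{Ẇ_p^r(𝕋^d)} = ∑_{|ν|₁=r} ‖D^ν T‖_{L_p(𝕋^d)}`. -/
noncomputable def sobolevSemi (d : ℕ) (r : ℕ) (p : ℝ≥0∞) (T : (Fin d → ℝ) → ℂ) : ℝ≥0∞ :=
  ∑ ν ∈ (Finset.univ : Finset (Fin d → Fin (r + 1))).filter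
      (fun ν => ∑ i, (ν i : ℕ) = r),
    eLpNorm (mderiv (fun i => (ν i : ℕ)) T) p (torusMeasure d)

/-- Fourier coefficient `\hat f(k) = (2π)^{-d} ∫_{𝕋^d} f(x) e^{-i⟨k,x⟩} dx`. -/
noncomputable def torusFourierCoeff (d : ℕ) (f : (Fin d → ℝ) → ℂ) (k : Fin d → ℤ) : ℂ :=
  (1 / (2 * Real.pi) ^ d : ℝ) •
    ∫ x, f x * Complex.exp (-(Complex.I * ((∑ i, (k i : ℝ) * x i : ℝ) : ℂ)))
      ∂(torusMeasure d)

/-- The fractional Laplacian `(−Δ)^{α/2}` acting through Fourier coefficients: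
`(−Δ)^{α/2} T = ∑_k |k|^α \hat T(k) e^{i⟨k,x⟩}`. -/
noncomputable def fracLaplacian (d : ℕ) (α : ℝ) (f : (Fin d → ℝ) → ℂ) :
    (Fin d → ℝ) → ℂ :=
  fun x => ∑' k : Fin d → ℤ,
    ((euclNorm (fun i => (k i : ℝ)) ^ α : ℝ) : ℂ) * torusFourierCoeff d f k * expChar k x

/-- Generalized binomial coefficient `binom(α,ν) = α(α−1)⋯(α−ν+1)/ν!`. -/
noncomputable def gBinom (α : ℝ) : ℕ → ℝ
  | 0 => 1
  | n + 1 => gBinom α n * (α - n) / (n + 1)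

/-- Fractional difference `Δ_h^α f(x) = ∑_{ν=0}^∞ (−1)^ν binom(α,ν) f(x + (α−ν)h)`. -/
noncomputable def fracDiff {d : ℕ} (α : ℝ) (h : Fin d → ℝ) (f : (Fin d → ℝ) → ℂ) :
    (Fin d → ℝ) → ℂ :=
  fun x => ∑' ν : ℕ, ((-1 : ℝ) ^ ν * gBinom α ν) • f (x + (α - ν) • h)

/-- Fractional modulus of smoothness `ω_α(f,δ)_p = sup_{|h|≤δ} ‖Δ_h^α f‖_{L_p(𝕋^d)}`. -/
noncomputable def fracModSmooth (d : ℕ) (α : ℝ) (p : ℝ≥0∞) (f : (Fin d → ℝ) → ℂ)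
    (δ : ℝ) : ℝ≥0∞ :=
  ⨆ h : {h : Fin d → ℝ // euclNorm h ≤ δ}, eLpNorm (fracDiff α h.1 f) p (torusMeasure d)

namespace FracSmooth

section Multiplier

variable {ι X : Type*} [NormedAddCommGroup X] [NormedSpace ℂ X]

/-- The finite combination `∑_{k ∈ s} c k • e k`. -/
def comb (e : ι → X) (s : Finset ι) (c : ι → ℂ) : X := ∑ k ∈ s, c k • e k

/-- `m` acts on the coefficients of combinations over `s` with norm at most `A`. -/
def IsMult (e : ι → X) (s : Finset ι) (m : ι → ℂ) (A : ℝ) : Prop :=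
  ∀ c : ι → ℂ, ‖comb e s (fun k => m k * c k)‖ ≤ A * ‖comb e s c‖

variable {e : ι → X} {s : Finset ι} {m m₁ m₂ : ι → ℂ} {A A₁ A₂ : ℝ}

lemma comb_congr {c c' : ι → ℂ} (h : ∀ k ∈ s, c k = c' k) : comb e s c = comb e s c' :=
  Finset.sum_congr rfl fun k hk => by rw [h k hk]

lemma comb_add (c c' : ι → ℂ) : comb e s (fun k => c k + c' k) = comb e s c + comb e s c' := by
  simp [comb, add_smul, Finset.sum_add_distrib]

lemma comb_sub (c c' : ι → ℂ) : comb e s (fun k => c k - c' k) = comb e s c - comb e s c' := by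
  simp [comb, sub_smul, Finset.sum_sub_distrib]

lemma comb_smul (a : ℂ) (c : ι → ℂ) : comb e s (fun k => a * c k) = a • comb e s c := by
  simp [comb, Finset.smul_sum, smul_smul]

lemma comb_sum {J : Type*} (t : Finset J) (c : J → ι → ℂ) :
    comb e s (fun k => ∑ j ∈ t, c j k) = ∑ j ∈ t, comb e s (c j) := by
  simp only [comb, Finset.sum_smul]
  exact Finset.sum_comm

lemma comb_subset [DecidableEq ι] {t : Finset ι} (hst : s ⊆ t) (c : ι → ℂ) :
    comb e s c = comb e t (fun k => if k ∈ s then c k else 0) := by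
  simp only [comb, ite_smul, zero_smul]
  rw [← Finset.sum_filter, Finset.filter_mem_eq_inter, Finset.inter_eq_right.2 hst]

lemma IsMult.mono (h : IsMult e s m A₁) (hA : A₁ ≤ A₂) : IsMult e s m A₂ := fun c =>
  (h c).trans (mul_le_mul_of_nonneg_right hA (norm_nonneg _))

lemma IsMult.congr (h : IsMult e s m₁ A) (hm : ∀ k ∈ s, m₂ k = m₁ k) : IsMult e s m₂ A := fun c =>
  (congrArg norm (comb_congr fun k hk => by rw [hm k hk])).trans_le (h c)

lemma isMult_const (a : ℂ) : IsMult e s (fun _ => a) ‖a‖ := fun c => by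
  rw [comb_smul, norm_smul]

lemma isMult_one : IsMult e s (fun _ => 1) 1 := by simpa using isMult_const (e := e) (s := s) 1

lemma IsMult.add (h₁ : IsMult e s m₁ A₁) (h₂ : IsMult e s m₂ A₂) :
    IsMult e s (fun k => m₁ k + m₂ k) (A₁ + A₂) := fun c => by
  simp only [add_mul, comb_add]
  exact (norm_add_le _ _).trans (add_le_add (h₁ c) (h₂ c))

lemma IsMult.sub (h₁ : IsMult e s m₁ A₁) (h₂ : IsMult e s m₂ A₂) :
    IsMult e s (fun k => m₁ k - m₂ k) (A₁ + A₂) := fun c => by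
  simp only [sub_mul, add_mul, comb_sub]
  exact (norm_sub_le _ _).trans (add_le_add (h₁ c) (h₂ c))

lemma IsMult.mul (h₁ : IsMult e s m₁ A₁) (h₂ : IsMult e s m₂ A₂) (hA : 0 ≤ A₁) :
    IsMult e s (fun k => m₁ k * m₂ k) (A₁ * A₂) := fun c => by
  simp only [mul_assoc]
  exact (h₁ fun k => m₂ k * c k).trans (mul_le_mul_of_nonneg_left (h₂ c) hA)

lemma IsMult.const_mul (h : IsMult e s m A) (a : ℂ) :
    IsMult e s (fun k => a * m k) (‖a‖ * A) :=
  (isMult_const a).mul h (norm_nonneg _)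

lemma IsMult.pow (h : IsMult e s m A) (hA : 0 ≤ A) (n : ℕ) :
    IsMult e s (fun k => m k ^ n) (A ^ n) := by
  induction n with
  | zero => simpa using isMult_one
  | succ n ih => simpa only [pow_succ] using ih.mul h (pow_nonneg hA n)

lemma IsMult.sum {J : Type*} (t : Finset J) {M : J → ι → ℂ} {A : J → ℝ}
    (h : ∀ j ∈ t, IsMult e s (M j) (A j)) :
    IsMult e s (fun k => ∑ j ∈ t, M j k) (∑ j ∈ t, A j) := fun c => by
  simp only [Finset.sum_mul]
  rw [comb_sum]
  exact norm_sum_le_of_le _ fun j hj => h j hj c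

/-- Minkowski's integral inequality for averages of multipliers. -/
lemma norm_comb_integral_le [CompleteSpace X] {Y : Type*} [MeasurableSpace Y] {ν : Measure Y}
    {M : Y → ι → ℂ} {B : Y → ℝ} {c : ι → ℂ}
    (hM : ∀ k ∈ s, Integrable (fun y => M y k) ν) (hm : ∀ k ∈ s, m k = ∫ y, M y k ∂ν)
    (hB : Integrable B ν) (h : ∀ᵐ y ∂ν, ‖comb e s (fun k => M y k * c k)‖ ≤ B y) :
    ‖comb e s (fun k => m k * c k)‖ ≤ ∫ y, B y ∂ν := by
  have key : comb e s (fun k => m k * c k) = ∫ y, comb e s (fun k => M y k * c k) ∂ν := by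
    simp only [comb]
    rw [integral_finsetSum _ fun k hk => ((hM k hk).mul_const (c k)).smul_const (e k)]
    refine Finset.sum_congr rfl fun k hk => ?_
    rw [integral_smul_const, integral_mul_const, hm k hk]
  rw [key]
  exact norm_integral_le_of_norm_le hB h

lemma IsMult.integral [CompleteSpace X] {Y : Type*} [MeasurableSpace Y] {ν : Measure Y}
    {M : Y → ι → ℂ} {A : Y → ℝ} (hM : ∀ k ∈ s, Integrable (fun y => M y k) ν)
    (hm : ∀ k ∈ s, m k = ∫ y, M y k ∂ν) (hA : Integrable A ν)
    (h : ∀ᵐ y ∂ν, IsMult e s (M y) (A y)) : IsMult e s m (∫ y, A y ∂ν) := fun c => by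
  rw [← integral_mul_const]
  exact norm_comb_integral_le hM hm (hA.mul_const _) (h.mono fun y hy => hy c)

/-- A nonincreasing function of `w` is an average of indicators of sublevel sets of `w`. -/
lemma isMult_of_antitone [CompleteSpace X] {w : ι → ℝ} {K B : ℝ} {μ : ι → ℝ} (hB : 0 ≤ B)
    (hw : ∀ a : ℝ, IsMult e s (fun k => if w k ≤ a then 1 else 0) K)
    (hμ0 : ∀ k ∈ s, 0 ≤ μ k) (hμB : ∀ k ∈ s, μ k ≤ B)
    (hμ : ∀ k ∈ s, ∀ l ∈ s, w k ≤ w l → μ l ≤ μ k) :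
    IsMult e s (fun k => (μ k : ℂ)) (B * K) := by
  have hI : ∀ k, (fun t : ℝ => if t < μ k then (1 : ℂ) else 0) =
      (Set.Iio (μ k)).indicator fun _ => (1 : ℂ) := fun k => by
    ext t; simp [Set.indicator_apply]
  have := IsMult.integral (e := e) (s := s) (m := fun k => (μ k : ℂ))
    (ν := volume.restrict (Set.Ioc 0 B)) (M := fun t k => if t < μ k then 1 else 0)
    (A := fun _ => K) ?_ ?_ (integrable_const K) ?_
  · simpa [hB] using this
  · intro k _
    rw [hI]
    exact (integrable_const _).indicator measurableSet_Iio
  · intro k hk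
    rw [hI, integral_indicator measurableSet_Iio, integral_const,
      Measure.restrict_restrict measurableSet_Iio]
    have : Set.Iio (μ k) ∩ Set.Ioc 0 B = Set.Ioo 0 (μ k) := by
      ext t
      simp only [Set.mem_inter_iff, Set.mem_Iio, Set.mem_Ioc, Set.mem_Ioo]
      have := hμB k hk
      constructor
      · rintro ⟨h1, h2, h3⟩; exact ⟨h2, h1⟩
      · rintro ⟨h1, h2⟩; exact ⟨h2, h1, by linarith⟩
    rw [this]
    simp [Measure.real, hμ0 k hk]
  · refine Filter.Eventually.of_forall fun t => ?_
    by_cases hne : (s.filter fun k => t < μ k).Nonempty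
    · obtain ⟨l, hl, hmax⟩ := Finset.exists_max_image _ w hne
      rw [Finset.mem_filter] at hl
      refine (hw (w l)).congr fun k hk => if_congr ⟨fun h => ?_, fun h => ?_⟩ rfl rfl
      · exact hmax k (Finset.mem_filter.2 ⟨hk, h⟩)
      · exact hl.2.trans_le (hμ k hk l hl.1 h)
    · obtain ⟨a, ha⟩ : ∃ a : ℝ, ∀ k ∈ s, a < w k := by
        by_cases hs : s.Nonempty
        · obtain ⟨l, _, hl⟩ := Finset.exists_min_image s w hs
          exact ⟨w l - 1, fun k hk => by linarith [hl k hk]⟩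
        · exact ⟨0, fun k hk => (hs ⟨k, hk⟩).elim⟩
      refine (hw a).congr fun k hk => ?_
      rw [if_neg (ha k hk).not_ge, if_neg]
      exact fun h => hne ⟨k, Finset.mem_filter.2 ⟨hk, h⟩⟩

lemma isMult_of_monotone [CompleteSpace X] {w : ι → ℝ} {K B : ℝ} {μ : ι → ℝ} (hB : 0 ≤ B)
    (hw : ∀ a : ℝ, IsMult e s (fun k => if w k ≤ a then 1 else 0) K)
    (hμ0 : ∀ k ∈ s, 0 ≤ μ k) (hμB : ∀ k ∈ s, μ k ≤ B)
    (hμ : ∀ k ∈ s, ∀ l ∈ s, w k ≤ w l → μ k ≤ μ l) :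
    IsMult e s (fun k => (μ k : ℂ)) (B + B * K) := by
  have h1 := isMult_of_antitone (μ := fun k => B - μ k) hB hw
    (fun k hk => by linarith [hμB k hk]) (fun k hk => by linarith [hμ0 k hk])
    (fun k hk l hl h => by linarith [hμ k hk l hl h])
  have h2 := (isMult_const (e := e) (s := s) (B : ℂ)).sub h1
  rw [Complex.norm_real, Real.norm_of_nonneg hB] at h2
  exact h2.congr fun k _ => by push_cast; ring

end Multiplier

section Torus

variable {d : ℕ}

instance : IsFiniteMeasure (torusMeasure d) :=
  ⟨by
    rw [torusMeasure, Measure.restrict_apply_univ]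
    exact (isCompact_univ_pi fun _ => isCompact_Icc).measure_lt_top⟩

lemma torusMeasure_univ : torusMeasure d Set.univ = ENNReal.ofReal ((2 * Real.pi) ^ d) := by
  rw [torusMeasure, Measure.restrict_apply_univ, volume_pi_pi]
  simp [ENNReal.ofReal_pow Real.two_pi_pos.le]

/-- The basis `2π e_i` of the period lattice. -/
noncomputable def periodBasis (d : ℕ) : Module.Basis (Fin d) ℝ (Fin d → ℝ) :=
  (Pi.basisFun ℝ (Fin d)).isUnitSMul (w := fun _ => 2 * Real.pi)
    (fun _ => (isUnit_iff_ne_zero.2 Real.two_pi_pos.ne'))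

lemma periodBasis_apply (i : Fin d) :
    periodBasis d i = (2 * Real.pi) • (Pi.single i 1 : Fin d → ℝ) := by
  simp [periodBasis, Module.Basis.isUnitSMul_apply]

lemma fundamentalDomain_periodBasis :
    ZSpan.fundamentalDomain (periodBasis d) = Set.univ.pi fun _ => Set.Ico 0 (2 * Real.pi) := by
  ext x
  have h : ∀ i, (periodBasis d).repr x i = (2 * Real.pi)⁻¹ * x i := fun i => by
    simp [periodBasis, Module.Basis.repr_isUnitSMul, Units.smul_def]
  simp only [ZSpan.mem_fundamentalDomain, h, Set.mem_pi, Set.mem_univ, true_imp_iff, Set.mem_Ico]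
  refine forall_congr' fun i => ?_
  have := Real.two_pi_pos
  rw [inv_mul_lt_iff₀ this, mul_one]
  refine and_congr_left fun _ => ?_
  rw [mul_nonneg_iff_of_pos_left (by positivity)]

lemma torusMeasure_eq_restrict :
    torusMeasure d = volume.restrict (ZSpan.fundamentalDomain (periodBasis d)) := by
  rw [fundamentalDomain_periodBasis, torusMeasure, Set.pi_univ_Icc]
  exact Measure.restrict_congr_set (Measure.univ_pi_Ico_ae_eq_Icc (μ := fun _ : Fin d => volume)).symm

lemma periodic_add_mem {f : (Fin d → ℝ) → ℂ} (hf : Periodic2Pi f) {g : Fin d → ℝ}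
    (hg : g ∈ Submodule.span ℤ (Set.range (periodBasis d))) : ∀ x, f (x + g) = f x := by
  induction hg using Submodule.span_induction with
  | mem g hg =>
    obtain ⟨i, rfl⟩ := hg
    intro x
    rw [periodBasis_apply, hf]
  | zero => simp
  | add a b _ _ ha hb => intro x; rw [← add_assoc, hb, ha]
  | smul n a _ ha =>
    intro x
    induction n using Int.induction_on with
    | zero => simp
    | succ n ih => rw [add_smul, one_smul, ← add_assoc, ha, ih]
    | pred n ih =>
      rw [sub_smul, one_smul, ← ih, ← ha (x + (_ - a))]
      congr 1; abel

section Shift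
open scoped Pointwise

instance : Countable (Submodule.span ℤ (Set.range (periodBasis d))).toAddSubgroup :=
  inferInstanceAs (Countable (Submodule.span ℤ (Set.range (periodBasis d))))

lemma isAddFundamentalDomain_vadd (h : Fin d → ℝ) :
    IsAddFundamentalDomain (Submodule.span ℤ (Set.range (periodBasis d))).toAddSubgroup
      (h +ᵥ ZSpan.fundamentalDomain (periodBasis d)) volume :=
  (ZSpan.isAddFundamentalDomain' (periodBasis d) volume).vadd_of_comm h

lemma measurePreserving_shift (h : Fin d → ℝ) :
    MeasurePreserving (fun x => x + h) (torusMeasure d)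
      (volume.restrict (h +ᵥ ZSpan.fundamentalDomain (periodBasis d))) := by
  rw [torusMeasure_eq_restrict]
  have h1 := (measurePreserving_add_right (volume : Measure (Fin d → ℝ)) h).restrict_preimage_emb
    (measurableEmbedding_addRight h) (h +ᵥ ZSpan.fundamentalDomain (periodBasis d))
  have e : (fun x => x + h) ⁻¹' (h +ᵥ ZSpan.fundamentalDomain (periodBasis d)) =
      ZSpan.fundamentalDomain (periodBasis d) := by
    ext x
    rw [Set.mem_preimage, add_comm x h, ← vadd_eq_add, Set.vadd_mem_vadd_set_iff]
  rwa [e] at h1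

lemma aestronglyMeasurable_shift {f : (Fin d → ℝ) → ℂ} (hf : Periodic2Pi f)
    (hm : AEStronglyMeasurable f (torusMeasure d)) (h : Fin d → ℝ) :
    AEStronglyMeasurable (fun x => f (x + h)) (torusMeasure d) := by
  refine AEStronglyMeasurable.comp_measurePreserving ?_ (measurePreserving_shift h)
  rw [torusMeasure_eq_restrict] at hm
  refine ((isAddFundamentalDomain_vadd h).aestronglyMeasurable_on_iff
    (ZSpan.isAddFundamentalDomain' (periodBasis d) volume) fun g x => ?_).2 hm
  exact (congrArg f (add_comm _ _)).trans (periodic_add_mem hf g.2 x)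

lemma lintegral_shift {f : (Fin d → ℝ) → ℂ} (hf : Periodic2Pi f) (h : Fin d → ℝ)
    (F : ℂ → ℝ≥0∞) :
    ∫⁻ x, F (f (x + h)) ∂torusMeasure d = ∫⁻ x, F (f x) ∂torusMeasure d := by
  have h1 := (measurePreserving_shift h).lintegral_comp_emb (measurableEmbedding_addRight h)
    (fun x => F (f x))
  rw [h1, torusMeasure_eq_restrict]
  refine (isAddFundamentalDomain_vadd h).setLIntegral_eq
    (ZSpan.isAddFundamentalDomain' (periodBasis d) volume) _ fun g x => ?_
  exact congrArg F ((congrArg f (add_comm _ _)).trans (periodic_add_mem hf g.2 x))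

lemma integral_shift {E : Type*} [NormedAddCommGroup E] [NormedSpace ℝ E]
    {f : (Fin d → ℝ) → ℂ} (hf : Periodic2Pi f) (h : Fin d → ℝ) (F : ℂ → E) :
    ∫ x, F (f (x + h)) ∂torusMeasure d = ∫ x, F (f x) ∂torusMeasure d := by
  have h1 := (measurePreserving_shift h).integral_comp (measurableEmbedding_addRight h)
    (fun x => F (f x))
  rw [h1, torusMeasure_eq_restrict]
  refine (isAddFundamentalDomain_vadd h).setIntegral_eq
    (ZSpan.isAddFundamentalDomain' (periodBasis d) volume) fun g x => ?_
  exact congrArg F ((congrArg f (add_comm _ _)).trans (periodic_add_mem hf g.2 x))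

lemma eLpNorm_shift {f : (Fin d → ℝ) → ℂ} (hf : Periodic2Pi f) (h : Fin d → ℝ) {p : ℝ}
    (hp : 0 < p) : eLpNorm (fun x => f (x + h)) (ENNReal.ofReal p) (torusMeasure d) =
      eLpNorm f (ENNReal.ofReal p) (torusMeasure d) := by
  have h0 : ENNReal.ofReal p ≠ 0 := (ENNReal.ofReal_pos.2 hp).ne'
  rw [eLpNorm_eq_lintegral_rpow_enorm_toReal h0 ENNReal.ofReal_ne_top,
    eLpNorm_eq_lintegral_rpow_enorm_toReal h0 ENNReal.ofReal_ne_top,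
    lintegral_shift hf h fun z => ‖z‖ₑ ^ (ENNReal.ofReal p).toReal]

end Shift

section Characters

/-- The pairing `⟨k, y⟩`. -/
def dot (k : Fin d → ℤ) (y : Fin d → ℝ) : ℝ := ∑ i, (k i : ℝ) * y i

lemma expChar_eq (k : Fin d → ℤ) (x : Fin d → ℝ) :
    expChar k x = Complex.exp (Complex.I * (dot k x : ℂ)) := rfl

lemma dot_add_right (k : Fin d → ℤ) (x y : Fin d → ℝ) : dot k (x + y) = dot k x + dot k y := by
  simp [dot, mul_add, Finset.sum_add_distrib]

lemma dot_add_left (k l : Fin d → ℤ) (x : Fin d → ℝ) : dot (k + l) x = dot k x + dot l x := by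
  simp [dot, add_mul, Finset.sum_add_distrib]

lemma dot_smul_right (k : Fin d → ℤ) (t : ℝ) (x : Fin d → ℝ) : dot k (t • x) = t * dot k x := by
  simp only [dot, Pi.smul_apply, smul_eq_mul, Finset.mul_sum]
  exact Finset.sum_congr rfl fun i _ => by ring

lemma dot_neg_right (k : Fin d → ℤ) (x : Fin d → ℝ) : dot k (-x) = -dot k x := by
  simp [dot]

lemma dot_sub_left (k l : Fin d → ℤ) (x : Fin d → ℝ) : dot (k - l) x = dot k x - dot l x := by
  simp [dot, sub_mul, Finset.sum_sub_distrib]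

lemma continuous_dot (k : Fin d → ℤ) : Continuous (dot k) := by
  unfold dot; fun_prop

lemma continuous_expChar (k : Fin d → ℤ) : Continuous (expChar k) := by
  simp only [funext (expChar_eq k)]
  have := continuous_dot k
  fun_prop

lemma norm_expChar (k : Fin d → ℤ) (x : Fin d → ℝ) : ‖expChar k x‖ = 1 := by
  rw [expChar_eq, mul_comm, Complex.norm_exp_ofReal_mul_I]

lemma expChar_shift (k : Fin d → ℤ) (x h : Fin d → ℝ) :
    expChar k (x + h) = Complex.exp (Complex.I * (dot k h : ℂ)) * expChar k x := by
  rw [expChar_eq, expChar_eq, dot_add_right, ← Complex.exp_add]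
  push_cast; congr 1; ring

lemma expChar_add (k l : Fin d → ℤ) (x : Fin d → ℝ) :
    expChar (k + l) x = expChar k x * expChar l x := by
  rw [expChar_eq, expChar_eq, expChar_eq, dot_add_left, ← Complex.exp_add]
  push_cast; congr 1; ring

lemma periodic_expChar (k : Fin d → ℤ) : Periodic2Pi (expChar k) := fun x i => by
  rw [expChar_shift, dot_smul_right]
  have : dot k (Pi.single i 1) = k i := by simp [dot, Pi.single_apply]
  rw [this]
  have h2 := Complex.exp_int_mul_two_pi_mul_I (k i)
  have : Complex.I * ((2 * Real.pi * (k i : ℝ) : ℝ) : ℂ) = (k i : ℂ) * (2 * Real.pi * Complex.I) := by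
    push_cast; ring
  rw [this, h2, one_mul]

lemma integral_expChar (k : Fin d → ℤ) :
    ∫ x, expChar k x ∂torusMeasure d = if k = 0 then ((2 * Real.pi : ℝ) : ℂ) ^ d else 0 := by
  split_ifs with hk
  · subst hk
    have : ∀ x, expChar (0 : Fin d → ℤ) x = 1 := fun x => by simp [expChar_eq, dot]
    simp only [this, integral_const, Measure.real, torusMeasure_univ]
    rw [ENNReal.toReal_ofReal (by positivity)]
    simp
  · obtain ⟨i, hi⟩ : ∃ i, k i ≠ 0 := by
      by_contra! h
      exact hk (funext h)
    set h : Fin d → ℝ := (Real.pi / k i) • Pi.single i 1 with hh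
    have h1 := integral_shift (periodic_expChar k) h id
    have h2 : dot k h = Real.pi := by
      rw [hh, dot_smul_right]
      have : dot k (Pi.single i 1) = k i := by simp [dot, Pi.single_apply]
      rw [this]
      field_simp
    simp only [id, expChar_shift, h2, integral_const_mul] at h1
    rw [mul_comm Complex.I, Complex.exp_pi_mul_I] at h1
    linear_combination (-1 / 2 : ℂ) * h1

end Characters

end Torus

section HardyStein

variable {d : ℕ}

lemma exists_bound_on_box {g : (Fin d → ℝ) × ℝ → ℝ} (hg : Continuous g) (σ : ℝ) :
    ∃ B, ∀ᵐ x ∂torusMeasure d, ∀ τ ∈ Metric.ball σ 1, ‖g (x, τ)‖ ≤ B := by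
  have hK : IsCompact ((Set.univ.pi fun _ : Fin d => Set.Icc 0 (2 * Real.pi)) ×ˢ
      Metric.closedBall σ 1) :=
    (isCompact_univ_pi fun _ => isCompact_Icc).prod (isCompact_closedBall σ 1)
  obtain ⟨B, hB⟩ := hK.exists_bound_of_continuousOn hg.continuousOn
  refine ⟨B, ?_⟩
  rw [torusMeasure]
  filter_upwards [ae_restrict_mem (MeasurableSet.univ_pi fun _ => measurableSet_Icc)] with x hx τ hτ
  exact hB _ ⟨hx, Metric.ball_subset_closedBall hτ⟩

lemma integrable_of_continuous {E : Type*} [NormedAddCommGroup E] [SecondCountableTopology E]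
    {g : (Fin d → ℝ) → E} (hg : Continuous g) : Integrable g (torusMeasure d) :=
  hg.continuousOn.integrableOn_compact (isCompact_univ_pi fun _ => isCompact_Icc)

lemma hasDerivAt_integral_torus {g g' : (Fin d → ℝ) → ℝ → ℝ}
    (hg : Continuous (Function.uncurry g)) (hg' : Continuous (Function.uncurry g'))
    (h : ∀ x σ, HasDerivAt (g x) (g' x σ) σ) (σ : ℝ) :
    HasDerivAt (fun σ => ∫ x, g x σ ∂torusMeasure d) (∫ x, g' x σ ∂torusMeasure d) σ := by
  obtain ⟨B, hB⟩ := exists_bound_on_box hg' σ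
  have c1 : ∀ τ, Continuous fun x => g x τ := fun τ => hg.comp (by fun_prop : Continuous fun x => (x, τ))
  have c2 : ∀ τ, Continuous fun x => g' x τ := fun τ => hg'.comp (by fun_prop : Continuous fun x => (x, τ))
  exact (hasDerivAt_integral_of_dominated_loc_of_deriv_le (F := fun σ x => g x σ)
    (F' := fun σ x => g' x σ) (bound := fun _ => B) (Metric.ball_mem_nhds σ one_pos)
    (Filter.Eventually.of_forall fun τ => (c1 τ).aestronglyMeasurable)
    (integrable_of_continuous (c1 σ)) (c2 σ).aestronglyMeasurable hB (integrable_const B)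
    (Filter.Eventually.of_forall fun x τ _ => h x τ)).2

lemma ConvexOn.le_of_tendsto_atTop {I : ℝ → ℝ} (hI : ConvexOn ℝ (Set.Ici 0) I) {L : ℝ}
    (hL : Filter.Tendsto I Filter.atTop (nhds L)) : L ≤ I 0 := by
  have key : ∀ σ, 0 ≤ σ → I σ ≤ I 0 := fun σ hσ => by
    have h1 : Filter.Tendsto (fun S : ℝ => (1 - σ / S) * I 0 + (σ / S) * I S) Filter.atTop
        (nhds ((1 - 0) * I 0 + 0 * L)) := by
      have : Filter.Tendsto (fun S : ℝ => σ / S) Filter.atTop (nhds 0) :=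
        tendsto_const_nhds.div_atTop Filter.tendsto_id
      exact ((tendsto_const_nhds.sub this).mul_const _).add (this.mul hL)
    simp only [sub_zero, one_mul, zero_mul, add_zero] at h1
    refine ge_of_tendsto h1 ?_
    filter_upwards [Filter.eventually_ge_atTop (max σ 1)] with S hS
    have hS1 : 1 ≤ S := (le_max_right _ _).trans hS
    have hS0 : 0 < S := by linarith
    have hσS : σ / S ≤ 1 := (div_le_one hS0).2 ((le_max_left _ _).trans hS)
    have := hI.2 (Set.mem_Ici.2 le_rfl) (Set.mem_Ici.2 hS0.le) (sub_nonneg.2 hσS)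
      (by positivity : 0 ≤ σ / S) (by ring)
    simpa [div_mul_cancel₀ _ hS0.ne'] using this
  refine le_of_tendsto hL ?_
  filter_upwards [Filter.eventually_ge_atTop 0] with σ hσ using key σ hσ

variable {ι : Type*} (s : Finset ι) (a : ι → ℝ) (w : ι → (Fin d → ℝ) → ℂ)

/-- The `j`-th complex derivative in `z`, at `z = iσ`, of `∑ₖ w k x * exp (i a k z)`. -/
noncomputable def expSum (j : ℕ) (x : Fin d → ℝ) (σ : ℝ) : ℂ :=
  ∑ k ∈ s, (Complex.I * a k) ^ j * Complex.exp (-(a k * σ : ℝ)) * w k x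

variable {s a w}

lemma continuous_expSum (hc : ∀ k, Continuous (w k)) (j : ℕ) :
    Continuous (Function.uncurry (expSum s a w j)) := by
  unfold expSum Function.uncurry
  refine continuous_finsetSum _ fun k _ => ?_
  have := hc k
  fun_prop

lemma hasDerivAt_expSum (j : ℕ) (x : Fin d → ℝ) (σ : ℝ) :
    HasDerivAt (expSum s a w j x) (Complex.I * expSum s a w (j + 1) x σ) σ := by
  unfold expSum
  rw [Finset.mul_sum]
  refine HasDerivAt.fun_sum fun k _ => ?_
  have h1 : HasDerivAt (fun σ : ℝ => ((-(a k * σ : ℝ) : ℂ))) (-(a k : ℂ)) σ := by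
    have := ((hasDerivAt_id σ).const_mul (-a k)).ofReal_comp
    simpa using this
  refine ((h1.cexp.const_mul ((Complex.I * a k) ^ j)).mul_const (w k x)).congr_deriv ?_
  rw [pow_succ]
  linear_combination -(Complex.I * a k) ^ j * a k * Complex.exp (-(a k * σ : ℝ)) * w k x *
    Complex.I_mul_I

variable {y : Fin d → ℝ}

lemma hasDerivAt_expSum_shift (hw : ∀ k x (t : ℝ), w k (x + t • y) = Complex.exp (Complex.I * (a k * t : ℝ)) * w k x)
    (j : ℕ) (x : Fin d → ℝ) (σ t : ℝ) :
    HasDerivAt (fun t : ℝ => expSum s a w j (x + t • y) σ)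
      (expSum s a w (j + 1) (x + t • y) σ) t := by
  unfold expSum
  refine HasDerivAt.fun_sum fun k _ => ?_
  simp only [hw]
  have h1 : HasDerivAt (fun t : ℝ => (Complex.I * (a k * t : ℝ) : ℂ)) (Complex.I * a k) t := by
    have := (((hasDerivAt_id t).const_mul (a k)).ofReal_comp).const_mul Complex.I
    simpa using this
  refine ((h1.cexp.mul_const (w k x)).const_mul
    ((Complex.I * a k) ^ j * Complex.exp (-(a k * σ : ℝ)))).congr_deriv ?_
  rw [pow_succ]; ring

lemma hasDerivAt_fderiv_apply {Φ : ℂ → ℝ} (hΦ : ContDiff ℝ 2 Φ) {f g : ℝ → ℂ} {f' g' : ℂ} {t : ℝ}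
    (hf : HasDerivAt f f' t) (hg : HasDerivAt g g' t) :
    HasDerivAt (fun t => fderiv ℝ Φ (f t) (g t))
      (fderiv ℝ (fderiv ℝ Φ) (f t) f' (g t) + fderiv ℝ Φ (f t) g') t := by
  have hΦ' : ContDiff ℝ 1 (fderiv ℝ Φ) := hΦ.fderiv_right (by norm_num)
  have d2 : HasFDerivAt (fderiv ℝ Φ) (fderiv ℝ (fderiv ℝ Φ) (f t)) (f t) :=
    (hΦ'.differentiable (by norm_num) _).hasFDerivAt
  exact (d2.comp_hasDerivAt t hf).clm_apply hg

/-- Hardy–Stein: integrals of subharmonic functions of `expSum` over the torus are convex in `σ`. -/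
lemma convexOn_integral_expSum {Φ : ℂ → ℝ} (hΦ : ContDiff ℝ 2 Φ)
    (hΔ : ∀ z w : ℂ, 0 ≤ fderiv ℝ (fderiv ℝ Φ) z w w +
      fderiv ℝ (fderiv ℝ Φ) z (Complex.I * w) (Complex.I * w))
    (hc : ∀ k, Continuous (w k)) (hper : ∀ k, Periodic2Pi (w k))
    (hw : ∀ k x (t : ℝ), w k (x + t • y) = Complex.exp (Complex.I * (a k * t : ℝ)) * w k x) :
    ConvexOn ℝ (Set.Ici 0) fun σ => ∫ x, Φ (expSum s a w 0 x σ) ∂torusMeasure d := by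
  have d1 : ∀ z, HasFDerivAt Φ (fderiv ℝ Φ z) z := fun z =>
    (hΦ.differentiable (by norm_num) z).hasFDerivAt
  have hΦ' : ContDiff ℝ 1 (fderiv ℝ Φ) := hΦ.fderiv_right (by norm_num)
  have d2 : ∀ z, HasFDerivAt (fderiv ℝ Φ) (fderiv ℝ (fderiv ℝ Φ) z) z := fun z =>
    (hΦ'.differentiable (by norm_num) z).hasFDerivAt
  have k1 : Continuous (fderiv ℝ Φ) := hΦ'.continuous
  have k2 : Continuous (fderiv ℝ (fderiv ℝ Φ)) := hΦ'.continuous_fderiv (by norm_num)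
  obtain ⟨F, hF⟩ : ∃ F, F = expSum s a w := ⟨_, rfl⟩
  have cF : ∀ j, Continuous (Function.uncurry (F j)) := hF ▸ continuous_expSum hc
  have v0 : ∀ x σ, HasDerivAt (F 0 x) (Complex.I * F 1 x σ) σ := hF ▸ hasDerivAt_expSum 0
  have v1 : ∀ x σ, HasDerivAt (F 1 x) (Complex.I * F 2 x σ) σ := hF ▸ hasDerivAt_expSum 1
  have h0 : ∀ x σ t, HasDerivAt (fun t : ℝ => F 0 (x + t • y) σ) (F 1 (x + t • y) σ) t :=
    hF ▸ hasDerivAt_expSum_shift hw 0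
  have h1 : ∀ x σ t, HasDerivAt (fun t : ℝ => F 1 (x + t • y) σ) (F 2 (x + t • y) σ) t :=
    hF ▸ hasDerivAt_expSum_shift hw 1
  rw [← hF]
  have cF' : ∀ j, Continuous fun q : (Fin d → ℝ) × ℝ => F j q.1 q.2 := cF
  have k0 : Continuous Φ := hΦ.continuous
  have m1 : ∀ {T : Type} [TopologicalSpace T] {f g : T → ℂ}, Continuous f → Continuous g →
      Continuous fun q => fderiv ℝ Φ (f q) (g q) := fun hf hg => (k1.comp hf).clm_apply hg
  have m2 : ∀ {T : Type} [TopologicalSpace T] {f g h : T → ℂ}, Continuous f → Continuous g →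
      Continuous h → Continuous fun q => fderiv ℝ (fderiv ℝ Φ) (f q) (g q) (h q) :=
    fun hf hg hh => ((k2.comp hf).clm_apply hg).clm_apply hh
  have cI : ∀ {T : Type} [TopologicalSpace T] {f : T → ℂ}, Continuous f →
      Continuous fun q => Complex.I * f q := fun hf => continuous_const.mul hf
  have D1 := hasDerivAt_integral_torus (g := fun x σ => Φ (F 0 x σ))
    (g' := fun x σ => fderiv ℝ Φ (F 0 x σ) (Complex.I * F 1 x σ))
    (k0.comp (cF 0)) (m1 (cF' 0) (cI (cF' 1)))
    (fun x σ => (d1 _).comp_hasDerivAt σ (v0 x σ))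
  have D2 := hasDerivAt_integral_torus
    (g := fun x σ => fderiv ℝ Φ (F 0 x σ) (Complex.I * F 1 x σ))
    (g' := fun x σ => fderiv ℝ (fderiv ℝ Φ) (F 0 x σ) (Complex.I * F 1 x σ) (Complex.I * F 1 x σ)
      + fderiv ℝ Φ (F 0 x σ) (Complex.I * (Complex.I * F 2 x σ)))
    (m1 (cF' 0) (cI (cF' 1)))
    ((m2 (cF' 0) (cI (cF' 1)) (cI (cF' 1))).add (m1 (cF' 0) (cI (cI (cF' 2)))))
    (fun x σ => hasDerivAt_fderiv_apply hΦ (v0 x σ)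
      ((v1 x σ).const_mul Complex.I))
  have D3 : ∀ σ, ∫ x, (fderiv ℝ (fderiv ℝ Φ) (F 0 x σ) (F 1 x σ) (F 1 x σ)
      + fderiv ℝ Φ (F 0 x σ) (F 2 x σ)) ∂torusMeasure d = 0 := fun σ => by
    have cs : ∀ j, Continuous fun q : (Fin d → ℝ) × ℝ => F j (q.1 + q.2 • y) σ := fun j =>
      (cF' j).comp (by fun_prop :
        Continuous fun q : (Fin d → ℝ) × ℝ => (q.1 + q.2 • y, σ))
    have := hasDerivAt_integral_torus
      (g := fun x t => fderiv ℝ Φ (F 0 (x + t • y) σ) (F 1 (x + t • y) σ))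
      (g' := fun x t =>
        fderiv ℝ (fderiv ℝ Φ) (F 0 (x + t • y) σ) (F 1 (x + t • y) σ) (F 1 (x + t • y) σ)
          + fderiv ℝ Φ (F 0 (x + t • y) σ) (F 2 (x + t • y) σ))
      (m1 (cs 0) (cs 1)) ((m2 (cs 0) (cs 1) (cs 1)).add (m1 (cs 0) (cs 2)))
      (fun x t => hasDerivAt_fderiv_apply hΦ (h0 x σ t)
        (h1 x σ t)) 0
    have hp : ∀ j, Periodic2Pi fun x => F j x σ := fun j x i => by
      simp only [hF, expSum]
      exact Finset.sum_congr rfl fun k _ => by rw [hper k x i]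
    have hP : Periodic2Pi fun x => ((fderiv ℝ Φ (F 0 x σ) (F 1 x σ) : ℝ) : ℂ) := fun x i => by
      have e0 := hp 0 x i
      have e1 := hp 1 x i
      simp only at e0 e1
      simp only [e0, e1]
    have hconst : ∀ t : ℝ, ∫ x, fderiv ℝ Φ (F 0 (x + t • y) σ) (F 1 (x + t • y) σ)
        ∂torusMeasure d = ∫ x, fderiv ℝ Φ (F 0 x σ) (F 1 x σ) ∂torusMeasure d := fun t => by
      simpa only [Complex.ofReal_re] using integral_shift hP (t • y) Complex.re
    simp only [hconst] at this
    have hz := this.unique (hasDerivAt_const _ _)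
    simpa only [zero_smul, add_zero] using hz
  have cx : ∀ j σ, Continuous fun x => F j x σ := fun j σ =>
    (cF' j).comp (by fun_prop : Continuous fun x : Fin d → ℝ => (x, σ))
  refine convexOn_of_hasDerivWithinAt2_nonneg (convex_Ici 0) ?_
    (fun σ _ => (D1 σ).hasDerivWithinAt) (fun σ _ => (D2 σ).hasDerivWithinAt) ?_
  · exact fun σ _ => (D1 σ).continuousAt.continuousWithinAt
  · intro σ _
    have i1 := integrable_of_continuous ((m2 (cx 0 σ) (cI (cx 1 σ)) (cI (cx 1 σ))).add
        (m1 (cx 0 σ) (cI (cI (cx 2 σ)))))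
    have i2 := integrable_of_continuous ((m2 (cx 0 σ) (cx 1 σ) (cx 1 σ)).add
        (m1 (cx 0 σ) (cx 2 σ)))
    have hsum := integral_add i1 i2
    simp only [Pi.add_apply] at hsum
    rw [D3 σ, add_zero] at hsum
    rw [← hsum]
    refine integral_nonneg fun x => ?_
    have e : Complex.I * (Complex.I * F 2 x σ) = -F 2 x σ := by
      rw [← mul_assoc, Complex.I_mul_I]; ring
    simp only [e, map_neg, Pi.zero_apply]
    have := hΔ (F 0 x σ) (F 1 x σ)
    linarith

lemma integral_le_expSum_zero {Φ : ℂ → ℝ} (hΦ : ContDiff ℝ 2 Φ)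
    (hΔ : ∀ z w : ℂ, 0 ≤ fderiv ℝ (fderiv ℝ Φ) z w w +
      fderiv ℝ (fderiv ℝ Φ) z (Complex.I * w) (Complex.I * w))
    (hc : ∀ k, Continuous (w k)) (hper : ∀ k, Periodic2Pi (w k))
    (hw : ∀ k x (t : ℝ), w k (x + t • y) = Complex.exp (Complex.I * (a k * t : ℝ)) * w k x)
    (ha : ∀ k, 0 ≤ a k) :
    ∫ x, Φ (∑ k ∈ s with a k = 0, w k x) ∂torusMeasure d ≤
      ∫ x, Φ (∑ k ∈ s, w k x) ∂torusMeasure d := by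
  have h1 := convexOn_integral_expSum (s := s) hΦ hΔ hc hper hw
  have h2 : ∀ x, Filter.Tendsto (fun σ => expSum s a w 0 x σ) Filter.atTop
      (nhds (∑ k ∈ s with a k = 0, w k x)) := fun x => by
    rw [Finset.sum_filter]
    refine tendsto_finsetSum _ fun k _ => ?_
    split_ifs with h
    · simp [h]
    · have hk : 0 < a k := lt_of_le_of_ne (ha k) (Ne.symm h)
      have : Filter.Tendsto (fun σ : ℝ => Real.exp (-(a k * σ))) Filter.atTop (nhds 0) :=
        Real.tendsto_exp_neg_atTop_nhds_zero.comp (Filter.tendsto_id.const_mul_atTop hk)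
      have := ((Complex.continuous_ofReal.tendsto 0).comp this).mul_const (w k x)
      simpa [Function.comp_def] using this
  have hbox : ∀ᵐ x ∂torusMeasure d, x ∈ Set.univ.pi fun _ : Fin d => Set.Icc 0 (2 * Real.pi) := by
    rw [torusMeasure]
    exact ae_restrict_mem (MeasurableSet.univ_pi fun _ => measurableSet_Icc)
  have hbd : ∃ B, ∀ x ∈ Set.univ.pi (fun _ : Fin d => Set.Icc 0 (2 * Real.pi)),
      ∑ k ∈ s, ‖w k x‖ ≤ B := by
    obtain ⟨B, hB⟩ := (isCompact_univ_pi fun _ : Fin d => isCompact_Icc (a := (0 : ℝ))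
      (b := 2 * Real.pi)).exists_bound_of_continuousOn
      (f := fun x => ∑ k ∈ s, ‖w k x‖)
      (continuous_finsetSum _ fun k _ => (hc k).norm).continuousOn
    exact ⟨B, fun x hx => (Real.le_norm_self _).trans (hB x hx)⟩
  obtain ⟨B, hB⟩ := hbd
  obtain ⟨M, hM⟩ := (isCompact_closedBall (0 : ℂ) B).exists_bound_of_continuousOn
    hΦ.continuous.continuousOn
  have h3 : Filter.Tendsto (fun σ => ∫ x, Φ (expSum s a w 0 x σ) ∂torusMeasure d) Filter.atTop
      (nhds (∫ x, Φ (∑ k ∈ s with a k = 0, w k x) ∂torusMeasure d)) := by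
    refine tendsto_integral_filter_of_dominated_convergence (fun _ => M) ?_ ?_
      (integrable_const M) ?_
    · refine Filter.Eventually.of_forall fun σ => Continuous.aestronglyMeasurable ?_
      exact hΦ.continuous.comp ((continuous_expSum hc 0).comp
        (by fun_prop : Continuous fun x : Fin d → ℝ => (x, σ)))
    · filter_upwards [Filter.eventually_ge_atTop 0] with σ hσ
      filter_upwards [hbox] with x hx
      refine hM _ ?_
      rw [mem_closedBall_zero_iff]
      refine (norm_sum_le_of_le _ fun k _ => ?_).trans (hB x hx)
      rw [norm_mul, norm_mul, pow_zero, norm_one, one_mul, ← Complex.ofReal_neg, ← Complex.ofReal_exp, Complex.norm_real,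
        Real.norm_of_nonneg (Real.exp_pos _).le]
      refine mul_le_of_le_one_left (norm_nonneg _) (Real.exp_le_one_iff.2 ?_)
      have := mul_nonneg (ha k) hσ
      linarith
    · exact Filter.Eventually.of_forall fun x => (hΦ.continuous.tendsto _).comp (h2 x)
  have := ConvexOn.le_of_tendsto_atTop h1 h3
  simpa [expSum] using this

end HardyStein

section Subharmonic

lemma fderiv_fderiv_apply_eq {Φ : ℂ → ℝ} (hΦ : ContDiff ℝ 2 Φ) {z v : ℂ} {φ' : ℝ → ℝ} {φ'' : ℝ}
    (h1 : ∀ t : ℝ, HasDerivAt (fun t : ℝ => Φ (z + t * v)) (φ' t) t) (h2 : HasDerivAt φ' φ'' 0) :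
    fderiv ℝ (fderiv ℝ Φ) z v v = φ'' := by
  have hl : ∀ t : ℝ, HasDerivAt (fun t : ℝ => z + t * v) v t := fun t => by
    simpa using ((hasDerivAt_id t).ofReal_comp.mul_const v).const_add z
  have e : φ' = fun t : ℝ => fderiv ℝ Φ (z + t * v) v := by
    ext t
    exact (h1 t).unique ((hΦ.differentiable (by norm_num) _).hasFDerivAt.comp_hasDerivAt t (hl t))
  have := hasDerivAt_fderiv_apply hΦ (hl 0) (hasDerivAt_const 0 v)
  rw [e] at h2
  simpa using this.unique h2

/-- Nonnegativity of the Laplacian in terms of the two second partial derivatives. -/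
lemma laplacian_nonneg {Φ : ℂ → ℝ} {z : ℂ}
    (h : 0 ≤ fderiv ℝ (fderiv ℝ Φ) z 1 1 + fderiv ℝ (fderiv ℝ Φ) z Complex.I Complex.I) (w : ℂ) :
    0 ≤ fderiv ℝ (fderiv ℝ Φ) z w w +
      fderiv ℝ (fderiv ℝ Φ) z (Complex.I * w) (Complex.I * w) := by
  set B := fderiv ℝ (fderiv ℝ Φ) z
  have e1 : w = w.re • (1 : ℂ) + w.im • Complex.I := by simp [Complex.re_add_im]
  have e2 : Complex.I * w = w.re • Complex.I + (-w.im) • (1 : ℂ) := by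
    apply Complex.ext <;> simp
  have : B w w + B (Complex.I * w) (Complex.I * w) =
      (w.re ^ 2 + w.im ^ 2) * (B 1 1 + B Complex.I Complex.I) := by
    rw [e2]
    conv_lhs => enter [1]; rw [e1]
    simp only [map_add, map_smul, _root_.add_apply, _root_.smul_apply, smul_eq_mul]
    ring
  rw [this]
  positivity

lemma hasDerivAt_sq_add_rpow {b : ℝ} (hb : 0 < b) (q x t : ℝ) :
    HasDerivAt (fun t : ℝ => ((x + t) ^ 2 + b) ^ q)
      (2 * q * (x + t) * ((x + t) ^ 2 + b) ^ (q - 1)) t := by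
  have h1 : HasDerivAt (fun t : ℝ => (x + t) ^ 2 + b) (2 * (x + t)) t := by
    simpa using (((hasDerivAt_id t).const_add x).pow 2).add_const b
  refine (h1.rpow_const (p := q) (Or.inl (by positivity))).congr_deriv ?_
  ring

lemma hasDerivAt_sq_add_rpow_two {b : ℝ} (hb : 0 < b) (q x : ℝ) :
    HasDerivAt (fun t : ℝ => 2 * q * (x + t) * ((x + t) ^ 2 + b) ^ (q - 1))
      (2 * q * (x ^ 2 + b) ^ (q - 1) + 4 * q * (q - 1) * x ^ 2 * (x ^ 2 + b) ^ (q - 2)) 0 := by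
  have h1 : HasDerivAt (fun t : ℝ => 2 * q * (x + t)) (2 * q) 0 := by
    simpa using ((hasDerivAt_id (0 : ℝ)).const_add x).const_mul (2 * q)
  refine (h1.mul (hasDerivAt_sq_add_rpow hb (q - 1) x 0)).congr_deriv ?_
  rw [show q - 1 - 1 = q - 2 by ring]
  simp only [add_zero]; ring

lemma contDiff_sq_add_rpow {f : ℂ → ℝ} (hf : ContDiff ℝ 2 f) (h0 : ∀ z, 0 < f z) (q : ℝ) :
    ContDiff ℝ 2 fun z => f z ^ q :=
  hf.rpow_const_of_ne fun z => (h0 z).ne'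

lemma contDiff_re : ContDiff ℝ 2 fun z : ℂ => z.re := Complex.reCLM.contDiff
lemma contDiff_im : ContDiff ℝ 2 fun z : ℂ => z.im := Complex.imCLM.contDiff

lemma subharmonic_of_le_two {q ε : ℝ} (hq : 1 / 2 < q) (hq1 : q ≤ 1) (hε : 0 < ε) :
    ContDiff ℝ 2 (fun z : ℂ => 2 / (2 * q - 1) * (z.re ^ 2 + ε) ^ q -
      (z.re ^ 2 + (z.im ^ 2 + ε)) ^ q) ∧
    ∀ z w : ℂ, 0 ≤ fderiv ℝ (fderiv ℝ (fun z : ℂ => 2 / (2 * q - 1) * (z.re ^ 2 + ε) ^ q -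
      (z.re ^ 2 + (z.im ^ 2 + ε)) ^ q)) z w w +
      fderiv ℝ (fderiv ℝ (fun z : ℂ => 2 / (2 * q - 1) * (z.re ^ 2 + ε) ^ q -
      (z.re ^ 2 + (z.im ^ 2 + ε)) ^ q)) z (Complex.I * w) (Complex.I * w) := by
  have hΦ : ContDiff ℝ 2 (fun z : ℂ => 2 / (2 * q - 1) * (z.re ^ 2 + ε) ^ q -
      (z.re ^ 2 + (z.im ^ 2 + ε)) ^ q) := by
    refine ContDiff.sub (contDiff_const.mul (contDiff_sq_add_rpow ?_ (fun z => by positivity) q))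
      (contDiff_sq_add_rpow ?_ (fun z => by positivity) q)
    · exact (contDiff_re.pow 2).add contDiff_const
    · exact (contDiff_re.pow 2).add ((contDiff_im.pow 2).add contDiff_const)
  refine ⟨hΦ, fun z w => laplacian_nonneg ?_ w⟩
  have hb : 0 < z.im ^ 2 + ε := by positivity
  have hc : 0 < z.re ^ 2 + ε := by positivity
  rw [fderiv_fderiv_apply_eq hΦ (v := 1)
      (φ' := fun t => 2 / (2 * q - 1) * (2 * q * (z.re + t) * ((z.re + t) ^ 2 + ε) ^ (q - 1)) -
        (2 * q * (z.re + t) * ((z.re + t) ^ 2 + (z.im ^ 2 + ε)) ^ (q - 1)))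
      (fun t => ?_)
      (((hasDerivAt_sq_add_rpow_two hε q z.re).const_mul _).sub
        (hasDerivAt_sq_add_rpow_two hb q z.re)),
    fderiv_fderiv_apply_eq hΦ (v := Complex.I)
      (φ' := fun t => 0 - (2 * q * (z.im + t) * ((z.im + t) ^ 2 + (z.re ^ 2 + ε)) ^ (q - 1)))
      (fun t => ?_)
      ((hasDerivAt_const _ _).sub (hasDerivAt_sq_add_rpow_two hc q z.im))]
  rotate_left
  · have := ((hasDerivAt_const t (2 / (2 * q - 1) * (z.re ^ 2 + ε) ^ q))).sub
      (hasDerivAt_sq_add_rpow hc q z.im t)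
    refine this.congr_of_eventuallyEq (Filter.Eventually.of_forall fun t => ?_)
    simp only [Complex.add_re, Complex.add_im, Complex.mul_re, Complex.mul_im, Complex.I_re,
      Complex.I_im, Complex.ofReal_re, Complex.ofReal_im, Pi.sub_apply]
    ring_nf
  · have := ((hasDerivAt_sq_add_rpow hε q z.re t).const_mul (2 / (2 * q - 1))).sub
      (hasDerivAt_sq_add_rpow hb q z.re t)
    refine this.congr_of_eventuallyEq (Filter.Eventually.of_forall fun t => ?_)
    simp
  set u := z.re
  set v := z.im
  have eR : v ^ 2 + (u ^ 2 + ε) = u ^ 2 + (v ^ 2 + ε) := by ring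
  rw [eR]
  set R := u ^ 2 + (v ^ 2 + ε) with hR
  set S := u ^ 2 + ε with hS
  have hRS : S ≤ R := by rw [hR, hS]; nlinarith [sq_nonneg v]
  have hR0 : 0 < R := by positivity
  have e1 : S ^ (q - 1) = S * S ^ (q - 2) := by
    rw [mul_comm, ← Real.rpow_add_one hc.ne']; congr 1; ring
  have hle : R ^ (q - 1) ≤ S ^ (q - 1) :=
    Real.rpow_le_rpow_of_nonpos hc hRS (by linarith)
  have hS2 : 0 < S ^ (q - 2) := by positivity
  have hR2 : 0 < R ^ (q - 2) := by positivity
  have hq0 : 0 < 2 * q - 1 := by linarith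
  have k1 : 2 * q * (2 * q - 1) * S ^ (q - 1) ≤
      2 * q * S ^ (q - 1) + 4 * q * (q - 1) * u ^ 2 * S ^ (q - 2) := by
    have : u ^ 2 = S - ε := by rw [hS]; ring
    rw [this, e1]
    have : 0 ≤ 4 * q * (1 - q) * ε * S ^ (q - 2) := by
      have : 0 ≤ 1 - q := by linarith
      have : 0 < q := by linarith
      positivity
    nlinarith
  have k2 : 4 * q * S ^ (q - 1) ≤
      2 / (2 * q - 1) * (2 * q * S ^ (q - 1) + 4 * q * (q - 1) * u ^ 2 * S ^ (q - 2)) := by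
    calc 4 * q * S ^ (q - 1) = 2 / (2 * q - 1) * (2 * q * (2 * q - 1) * S ^ (q - 1)) := by
          rw [div_mul_eq_mul_div, eq_div_iff hq0.ne']; ring
      _ ≤ _ := mul_le_mul_of_nonneg_left k1 (by positivity)
  have k3 : 0 ≤ q * (1 - q) * (u ^ 2 + v ^ 2) * R ^ (q - 2) := by
    have : 0 ≤ 1 - q := by linarith
    have : 0 < q := by linarith
    positivity
  nlinarith

lemma subharmonic_of_two_le {q ε : ℝ} (hq : 1 ≤ q) (hε : 0 < ε) :
    ContDiff ℝ 2 (fun z : ℂ => 2 * q ^ 2 * ((z.re ^ 2 + (z.im ^ 2 + ε)) ^ (q - 1) * z.re ^ 2) -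
      (z.re ^ 2 + (z.im ^ 2 + ε)) ^ q) ∧
    ∀ z w : ℂ, 0 ≤ fderiv ℝ (fderiv ℝ (fun z : ℂ =>
      2 * q ^ 2 * ((z.re ^ 2 + (z.im ^ 2 + ε)) ^ (q - 1) * z.re ^ 2) -
      (z.re ^ 2 + (z.im ^ 2 + ε)) ^ q)) z w w +
      fderiv ℝ (fderiv ℝ (fun z : ℂ =>
      2 * q ^ 2 * ((z.re ^ 2 + (z.im ^ 2 + ε)) ^ (q - 1) * z.re ^ 2) -
      (z.re ^ 2 + (z.im ^ 2 + ε)) ^ q)) z (Complex.I * w) (Complex.I * w) := by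
  have hΦ : ContDiff ℝ 2 (fun z : ℂ =>
      2 * q ^ 2 * ((z.re ^ 2 + (z.im ^ 2 + ε)) ^ (q - 1) * z.re ^ 2) -
      (z.re ^ 2 + (z.im ^ 2 + ε)) ^ q) := by
    have h : ContDiff ℝ 2 fun z : ℂ => z.re ^ 2 + (z.im ^ 2 + ε) :=
      (contDiff_re.pow 2).add ((contDiff_im.pow 2).add contDiff_const)
    exact ContDiff.sub (contDiff_const.mul ((contDiff_sq_add_rpow h
      (fun z => by positivity) _).mul (contDiff_re.pow 2)))
      (contDiff_sq_add_rpow h (fun z => by positivity) q)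
  refine ⟨hΦ, fun z w => laplacian_nonneg ?_ w⟩
  have hb : 0 < z.im ^ 2 + ε := by positivity
  have hc : 0 < z.re ^ 2 + ε := by positivity
  rw [fderiv_fderiv_apply_eq hΦ (v := 1)
      (φ' := fun t => 2 * q ^ 2 *
        ((2 * q * (z.re + t) * ((z.re + t) ^ 2 + (z.im ^ 2 + ε)) ^ (q - 1)) - (z.im ^ 2 + ε) *
        (2 * (q - 1) * (z.re + t) * ((z.re + t) ^ 2 + (z.im ^ 2 + ε)) ^ (q - 1 - 1))) -
        (2 * q * (z.re + t) * ((z.re + t) ^ 2 + (z.im ^ 2 + ε)) ^ (q - 1)))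
      (fun t => ?_)
      ((((hasDerivAt_sq_add_rpow_two hb q z.re).sub
        ((hasDerivAt_sq_add_rpow_two hb (q - 1) z.re).const_mul _)).const_mul _).sub
        (hasDerivAt_sq_add_rpow_two hb q z.re)),
    fderiv_fderiv_apply_eq hΦ (v := Complex.I)
      (φ' := fun t => 2 * q ^ 2 *
        ((2 * (q - 1) * (z.im + t) * ((z.im + t) ^ 2 + (z.re ^ 2 + ε)) ^ (q - 1 - 1)) *
          z.re ^ 2) -
        (2 * q * (z.im + t) * ((z.im + t) ^ 2 + (z.re ^ 2 + ε)) ^ (q - 1)))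
      (fun t => ?_)
      ((((hasDerivAt_sq_add_rpow_two hc (q - 1) z.im).mul_const _).const_mul _).sub
        (hasDerivAt_sq_add_rpow_two hc q z.im))]
  rotate_left
  · have := (((hasDerivAt_sq_add_rpow hc (q - 1) z.im t).mul_const (z.re ^ 2)).const_mul
      (2 * q ^ 2)).sub (hasDerivAt_sq_add_rpow hc q z.im t)
    refine this.congr_of_eventuallyEq (Filter.Eventually.of_forall fun t => ?_)
    simp only [Complex.add_re, Complex.add_im, Complex.mul_re, Complex.mul_im, Complex.I_re,
      Complex.I_im, Complex.ofReal_re, Complex.ofReal_im, Pi.sub_apply]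
    ring_nf
  · have := (((hasDerivAt_sq_add_rpow hb q z.re t).sub
      ((hasDerivAt_sq_add_rpow hb (q - 1) z.re t).const_mul (z.im ^ 2 + ε))).const_mul
      (2 * q ^ 2)).sub (hasDerivAt_sq_add_rpow hb q z.re t)
    refine this.congr_of_eventuallyEq (Filter.Eventually.of_forall fun t => ?_)
    simp only [Complex.add_re, Complex.add_im, Complex.mul_re, Complex.mul_im, Complex.one_re,
      Complex.one_im, Complex.ofReal_re, Complex.ofReal_im, Pi.sub_apply]
    simp only [mul_one, mul_zero, sub_zero, add_zero]
    have : 0 < (z.re + t) ^ 2 + (z.im ^ 2 + ε) := by positivity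
    have e : ((z.re + t) ^ 2 + (z.im ^ 2 + ε)) ^ q = ((z.re + t) ^ 2 + (z.im ^ 2 + ε)) ^ (q - 1) *
        ((z.re + t) ^ 2 + (z.im ^ 2 + ε)) := by
      rw [← Real.rpow_add_one this.ne']; congr 1; ring
    rw [e]; ring
  set u := z.re
  set v := z.im
  have eR : v ^ 2 + (u ^ 2 + ε) = u ^ 2 + (v ^ 2 + ε) := by ring
  rw [eR]
  set R := u ^ 2 + (v ^ 2 + ε) with hR
  have hR0 : 0 < R := by positivity
  obtain ⟨W, hW⟩ : ∃ W, W = R ^ (q - 1 - 2) := ⟨_, rfl⟩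
  have e2 : R ^ (q - 2) = R * W := by
    rw [hW, mul_comm, ← Real.rpow_add_one hR0.ne']; congr 1; ring
  have e3 : R ^ (q - 1 - 1) = R * W := by rw [← e2]; congr 1; ring
  have e1 : R ^ (q - 1) = R * (R * W) := by
    rw [← e2, mul_comm, ← Real.rpow_add_one hR0.ne']; congr 1; ring
  have hW0 : 0 < W := by rw [hW]; positivity
  rw [e1, e2, e3, ← hW]
  have hb' : v ^ 2 + ε = R - u ^ 2 := by rw [hR]; ring
  have hv' : v ^ 2 = R - u ^ 2 - ε := by rw [hR]; ring
  have huR : 0 ≤ R - u ^ 2 - ε := hv' ▸ sq_nonneg v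
  rw [hb', hv']
  have hm : 0 ≤ q - 1 := by linarith
  have key : 2 * q ^ 2 * (2 * R ^ 2 + 12 * (q - 1) * u ^ 2 * R + 4 * (q - 1) * (q - 1 - 1) * u ^ 2 * (R - ε))
      - (4 * q * R ^ 2 + 4 * q * (q - 1) * (R - ε) * R) ≥ 0 := by
    have t1 : 0 ≤ (q - 1) * u ^ 2 * R := by positivity
    have t2 : 0 ≤ (q - 1) ^ 2 * u ^ 2 * (R - ε) := by
      have : 0 ≤ R - ε := by nlinarith [sq_nonneg u]
      positivity
    have t3 : 0 ≤ (q - 1) * u ^ 2 * ε := by positivity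
    have t4 : 0 ≤ q * (q - 1) * ε * R := by positivity
    have t5 : 0 ≤ 12 * (q - 1) * u ^ 2 * R + 4 * (q - 1) * (q - 1 - 1) * u ^ 2 * (R - ε) := by
      nlinarith
    have t6 : 0 ≤ q ^ 2 * (12 * (q - 1) * u ^ 2 * R + 4 * (q - 1) * (q - 1 - 1) * u ^ 2 * (R - ε)) :=
      mul_nonneg (sq_nonneg q) t5
    nlinarith
  have := mul_nonneg key hW0.le
  calc 0 ≤ _ := this
    _ = _ := by ring

end Subharmonic

section ImBound

variable {d : ℕ} {ι : Type*} {s : Finset ι} {a : ι → ℝ} {w : ι → (Fin d → ℝ) → ℂ} {y : Fin d → ℝ}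

lemma integral_rpow_im_le_of_le_two {q δ : ℝ} (hq : 1 / 2 < q) (hq1 : q ≤ 1) (hδ : 0 < δ)
    (hc : ∀ k, Continuous (w k)) (hper : ∀ k, Periodic2Pi (w k))
    (hw : ∀ k x (t : ℝ), w k (x + t • y) = Complex.exp (Complex.I * (a k * t : ℝ)) * w k x)
    (ha : ∀ k, 0 ≤ a k) (hre : ∀ k x, a k = 0 → (w k x).im = 0) :
    ∫ x, ((∑ k ∈ s, w k x).im ^ 2) ^ q ∂torusMeasure d ≤
      2 / (2 * q - 1) * (∫ x, ((∑ k ∈ s, w k x).re ^ 2) ^ q ∂torusMeasure d +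
        δ * (torusMeasure d).real Set.univ) := by
  have hq0 : 0 < q := by linarith
  have hA : 2 ≤ 2 / (2 * q - 1) := by rw [le_div_iff₀] <;> linarith
  set A := 2 / (2 * q - 1) with hAdef
  obtain ⟨ε, hε, hεδ⟩ : ∃ ε : ℝ, 0 < ε ∧ ε ^ q = δ :=
    ⟨δ ^ q⁻¹, by positivity, Real.rpow_inv_rpow hδ.le hq0.ne'⟩
  obtain ⟨h1, h2⟩ := subharmonic_of_le_two hq hq1 hε
  have h3 := integral_le_expSum_zero (s := s) h1 h2 hc hper hw ha
  have hcF : Continuous fun x => ∑ k ∈ s, w k x := continuous_finsetSum _ fun k _ => hc k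
  have hre' : Continuous fun x => (∑ k ∈ s, w k x).re := Complex.continuous_re.comp hcF
  have him' : Continuous fun x => (∑ k ∈ s, w k x).im := Complex.continuous_im.comp hcF
  have h4 : 0 ≤ ∫ x, (A * ((∑ k ∈ s with a k = 0, w k x).re ^ 2 + ε) ^ q -
      ((∑ k ∈ s with a k = 0, w k x).re ^ 2 +
        ((∑ k ∈ s with a k = 0, w k x).im ^ 2 + ε)) ^ q) ∂torusMeasure d := by
    refine integral_nonneg fun x => ?_
    have : (∑ k ∈ s with a k = 0, w k x).im = 0 := by
      rw [Complex.im_sum]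
      exact Finset.sum_eq_zero fun k hk => hre k x (Finset.mem_filter.1 hk).2
    simp only [this, Pi.zero_apply]
    generalize (∑ k ∈ s with a k = 0, w k x).re = u
    have : 0 ≤ (u ^ 2 + ε) ^ q := by positivity
    rw [show u ^ 2 + (0 ^ 2 + ε) = u ^ 2 + ε by ring]
    nlinarith
  have h5 := h4.trans h3
  have i1 : Integrable (fun x => ((∑ k ∈ s, w k x).im ^ 2) ^ q) (torusMeasure d) :=
    integrable_of_continuous ((him'.pow 2).rpow_const fun _ => Or.inr hq0.le)
  have i2 : Integrable (fun x => ((∑ k ∈ s, w k x).re ^ 2) ^ q) (torusMeasure d) :=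
    integrable_of_continuous ((hre'.pow 2).rpow_const fun _ => Or.inr hq0.le)
  have i3 : Integrable (fun x => A * (((∑ k ∈ s, w k x).re ^ 2) ^ q + δ)) (torusMeasure d) :=
    (i2.add (integrable_const _)).const_mul _
  have h6 : 0 ≤ ∫ x, (A * (((∑ k ∈ s, w k x).re ^ 2) ^ q + δ) -
      ((∑ k ∈ s, w k x).im ^ 2) ^ q) ∂torusMeasure d := by
    refine h5.trans (integral_mono ?_ (i3.sub i1) fun x => ?_)
    · exact integrable_of_continuous (h1.continuous.comp hcF)
    · set u := (∑ k ∈ s, w k x).re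
      set v := (∑ k ∈ s, w k x).im
      have e1 : (u ^ 2 + ε) ^ q ≤ (u ^ 2) ^ q + δ := by
        rw [← hεδ]; exact Real.rpow_add_le_add_rpow (sq_nonneg u) hε.le hq0.le hq1
      have e2 : (v ^ 2) ^ q ≤ (u ^ 2 + (v ^ 2 + ε)) ^ q :=
        Real.rpow_le_rpow (sq_nonneg v) (by nlinarith [sq_nonneg u]) hq0.le
      have := mul_le_mul_of_nonneg_left e1 (by linarith : 0 ≤ A)
      simp only
      linarith
  rw [integral_sub i3 i1, integral_const_mul, integral_add i2 (integrable_const _),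
    integral_const, smul_eq_mul] at h6
  linarith

lemma integral_rpow_im_le_of_two_le {q δ : ℝ} (hq : 1 ≤ q) (hδ : 0 < δ)
    (hc : ∀ k, Continuous (w k)) (hper : ∀ k, Periodic2Pi (w k))
    (hw : ∀ k x (t : ℝ), w k (x + t • y) = Complex.exp (Complex.I * (a k * t : ℝ)) * w k x)
    (ha : ∀ k, 0 ≤ a k) (hre : ∀ k x, a k = 0 → (w k x).im = 0) :
    ∫ x, ((∑ k ∈ s, w k x).im ^ 2) ^ q ∂torusMeasure d ≤
      4 * q ^ 2 * (4 * q ^ 2) ^ (q - 1) * (∫ x, ((∑ k ∈ s, w k x).re ^ 2) ^ q ∂torusMeasure d +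
        δ * (torusMeasure d).real Set.univ) := by
  have hq0 : 0 < q := by linarith
  have hm : 0 ≤ q - 1 := by linarith
  obtain ⟨ε, hε, hεδ⟩ : ∃ ε : ℝ, 0 < ε ∧ ε ^ q = δ :=
    ⟨δ ^ q⁻¹, by positivity, Real.rpow_inv_rpow hδ.le hq0.ne'⟩
  obtain ⟨h1, h2⟩ := subharmonic_of_two_le hq hε
  have h3 := integral_le_expSum_zero (s := s) h1 h2 hc hper hw ha
  have hcF : Continuous fun x => ∑ k ∈ s, w k x := continuous_finsetSum _ fun k _ => hc k
  have hcF0 : Continuous fun x => ∑ k ∈ s with a k = 0, w k x :=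
    continuous_finsetSum _ fun k _ => hc k
  have hre' : Continuous fun x => (∑ k ∈ s, w k x).re := Complex.continuous_re.comp hcF
  have him' : Continuous fun x => (∑ k ∈ s, w k x).im := Complex.continuous_im.comp hcF
  have hsplit : ∀ r : ℝ, 0 < r → r ^ q = r ^ (q - 1) * r := fun r hr => by
    rw [← Real.rpow_add_one hr.ne']; congr 1; ring
  have h4 : ∫ _, -(2 ^ (q - 1) * δ) ∂torusMeasure d ≤
      ∫ x, (2 * q ^ 2 * (((∑ k ∈ s with a k = 0, w k x).re ^ 2 +
        ((∑ k ∈ s with a k = 0, w k x).im ^ 2 + ε)) ^ (q - 1) *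
          (∑ k ∈ s with a k = 0, w k x).re ^ 2) -
      ((∑ k ∈ s with a k = 0, w k x).re ^ 2 +
        ((∑ k ∈ s with a k = 0, w k x).im ^ 2 + ε)) ^ q) ∂torusMeasure d := by
    refine integral_mono (integrable_const _)
      (integrable_of_continuous (h1.continuous.comp hcF0)) fun x => ?_
    have : (∑ k ∈ s with a k = 0, w k x).im = 0 := by
      rw [Complex.im_sum]
      exact Finset.sum_eq_zero fun k hk => hre k x (Finset.mem_filter.1 hk).2
    simp only [this]
    set u := (∑ k ∈ s with a k = 0, w k x).re
    have hR : 0 < u ^ 2 + (0 ^ 2 + ε) := by positivity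
    rw [hsplit _ hR]
    set R := u ^ 2 + (0 ^ 2 + ε) with hRdef
    have hW : 0 < R ^ (q - 1) := by positivity
    have : 2 * q ^ 2 * (R ^ (q - 1) * u ^ 2) - R ^ (q - 1) * R =
      R ^ (q - 1) * ((2 * q ^ 2 - 1) * u ^ 2 - ε) := by rw [hRdef]; ring
    rw [this]
    have hq2 : u ^ 2 ≤ (2 * q ^ 2 - 1) * u ^ 2 :=
      le_mul_of_one_le_left (sq_nonneg u) (by nlinarith)
    rcases le_total ε (u ^ 2) with h | h
    · have : 0 ≤ R ^ (q - 1) * ((2 * q ^ 2 - 1) * u ^ 2 - ε) :=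
        mul_nonneg hW.le (by linarith)
      have : 0 ≤ 2 ^ (q - 1) * δ := by positivity
      linarith
    · have hR2 : R = u ^ 2 + ε := by rw [hRdef]; ring
      have e1 : R ^ (q - 1) ≤ (2 * ε) ^ (q - 1) :=
        Real.rpow_le_rpow hR.le (by linarith) hm
      rw [Real.mul_rpow (by norm_num) hε.le] at e1
      rw [← hεδ, hsplit ε hε]
      have e2 := mul_le_mul_of_nonneg_right e1 hε.le
      have e3 : 0 ≤ R ^ (q - 1) * ((2 * q ^ 2 - 1) * u ^ 2) :=
        mul_nonneg hW.le (by nlinarith [sq_nonneg u])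
      nlinarith
  have h5 := h4.trans h3
  have i1 : Integrable (fun x => ((∑ k ∈ s, w k x).im ^ 2) ^ q) (torusMeasure d) :=
    integrable_of_continuous ((him'.pow 2).rpow_const fun _ => Or.inr hq0.le)
  have i2 : Integrable (fun x => ((∑ k ∈ s, w k x).re ^ 2) ^ q) (torusMeasure d) :=
    integrable_of_continuous ((hre'.pow 2).rpow_const fun _ => Or.inr hq0.le)
  set B := 2 * q ^ 2 * (4 * q ^ 2) ^ (q - 1) with hB
  have i3 : Integrable (fun x => B * ((∑ k ∈ s, w k x).re ^ 2) ^ q) (torusMeasure d) :=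
    i2.const_mul _
  have i4 : Integrable (fun x => (1 / 2 : ℝ) * ((∑ k ∈ s, w k x).im ^ 2) ^ q) (torusMeasure d) :=
    i1.const_mul _
  have h6 : ∫ _, -(2 ^ (q - 1) * δ) ∂torusMeasure d ≤ ∫ x, (B * ((∑ k ∈ s, w k x).re ^ 2) ^ q -
      (1 / 2 : ℝ) * ((∑ k ∈ s, w k x).im ^ 2) ^ q) ∂torusMeasure d := by
    refine h5.trans (integral_mono ?_ (i3.sub i4) fun x => ?_)
    · exact integrable_of_continuous (h1.continuous.comp hcF)
    · simp only
      set u := (∑ k ∈ s, w k x).re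
      set v := (∑ k ∈ s, w k x).im
      have hR : 0 < u ^ 2 + (v ^ 2 + ε) := by positivity
      have e2 : (v ^ 2) ^ q ≤ (u ^ 2 + (v ^ 2 + ε)) ^ q :=
        Real.rpow_le_rpow (sq_nonneg v) (by nlinarith [sq_nonneg u]) hq0.le
      set R := u ^ 2 + (v ^ 2 + ε) with hRdef
      have hW : 0 < R ^ (q - 1) := by positivity
      have hu0 : 0 ≤ (u ^ 2) ^ q := by positivity
      have hB0 : 0 ≤ B := by positivity
      rcases le_total (4 * q ^ 2 * u ^ 2) R with h | h
      · have : 2 * q ^ 2 * (R ^ (q - 1) * u ^ 2) ≤ 1 / 2 * R ^ q := by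
          rw [hsplit R hR]
          have := mul_le_mul_of_nonneg_left h hW.le
          linarith
        have := mul_nonneg hB0 hu0
        linarith
      · have hu : 0 < u ^ 2 := by
          by_contra hu
          have : u ^ 2 = 0 := le_antisymm (not_lt.1 hu) (sq_nonneg u)
          rw [this] at h; linarith
        have e3 : R ^ (q - 1) ≤ (4 * q ^ 2) ^ (q - 1) * (u ^ 2) ^ (q - 1) := by
          rw [← Real.mul_rpow (by positivity) hu.le]
          exact Real.rpow_le_rpow hR.le h hm
        have : 2 * q ^ 2 * (R ^ (q - 1) * u ^ 2) ≤ B * (u ^ 2) ^ q := by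
          rw [hsplit _ hu, hB]
          have := mul_le_mul_of_nonneg_left e3 (by positivity : 0 ≤ 2 * q ^ 2 * u ^ 2)
          linarith
        have : 0 ≤ R ^ q := by positivity
        linarith
  rw [integral_sub i3 i4, integral_const_mul, integral_const_mul, integral_const,
    smul_eq_mul] at h6
  have e4 : (2 : ℝ) ^ (q - 1) ≤ B := by
    have : (2 : ℝ) ^ (q - 1) ≤ (4 * q ^ 2) ^ (q - 1) :=
      Real.rpow_le_rpow (by norm_num) (by nlinarith) hm
    have h7 : (0:ℝ) ≤ (4 * q ^ 2) ^ (q - 1) := by positivity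
    exact this.trans (le_mul_of_one_le_left h7 (by nlinarith))
  have e5 : (2 : ℝ) ^ (q - 1) * (δ * (torusMeasure d).real Set.univ) ≤
      B * (δ * (torusMeasure d).real Set.univ) :=
    mul_le_mul_of_nonneg_right e4 (by positivity)
  have e6 : 4 * q ^ 2 * (4 * q ^ 2) ^ (q - 1) = 2 * B := by rw [hB]; ring
  rw [e6]
  linarith

/-- The M. Riesz inequality in the form `‖Im F‖ₚ ≲ ‖Re F‖ₚ`. -/
lemma exists_integral_rpow_im_le {p : ℝ} (hp : 1 < p) : ∃ A : ℝ, 0 < A ∧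
    ∀ {d : ℕ} {ι : Type} {s : Finset ι} {a : ι → ℝ} {w : ι → (Fin d → ℝ) → ℂ} {y : Fin d → ℝ},
    (∀ k, Continuous (w k)) → (∀ k, Periodic2Pi (w k)) →
    (∀ k x (t : ℝ), w k (x + t • y) = Complex.exp (Complex.I * (a k * t : ℝ)) * w k x) →
    (∀ k, 0 ≤ a k) → (∀ k x, a k = 0 → (w k x).im = 0) →
    ∫ x, |(∑ k ∈ s, w k x).im| ^ p ∂torusMeasure d ≤
      A * ∫ x, |(∑ k ∈ s, w k x).re| ^ p ∂torusMeasure d := by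
  have hpow : ∀ r : ℝ, |r| ^ p = (r ^ 2) ^ (p / 2) := fun r => by
    rw [← sq_abs, ← Real.rpow_natCast_mul (abs_nonneg r)]
    congr 1; push_cast; ring
  simp only [hpow]
  have lim : ∀ {X Y A m : ℝ}, 0 < A → 0 ≤ m → (∀ δ : ℝ, 0 < δ → X ≤ A * (Y + δ * m)) → X ≤ A * Y := by
    intro X Y A m hA hm h
    have : Filter.Tendsto (fun δ : ℝ => A * (Y + δ * m)) (nhdsWithin 0 (Set.Ioi 0))
        (nhds (A * (Y + 0 * m))) := by
      refine Filter.Tendsto.mono_left (Continuous.tendsto (by fun_prop) 0) nhdsWithin_le_nhds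
    rw [zero_mul, add_zero] at this
    exact ge_of_tendsto this (Filter.eventually_of_mem self_mem_nhdsWithin fun δ hδ => h δ hδ)
  rcases le_total p 2 with h | h
  · refine ⟨2 / (2 * (p / 2) - 1), div_pos two_pos (by linarith), fun hc hper hw ha hre =>
      lim (div_pos two_pos (by linarith)) measureReal_nonneg fun δ hδ =>
        integral_rpow_im_le_of_le_two (by linarith) (by linarith) hδ hc hper hw ha hre⟩
  · exact ⟨4 * (p / 2) ^ 2 * (4 * (p / 2) ^ 2) ^ (p / 2 - 1), by positivity,
      fun hc hper hw ha hre => lim (by positivity) measureReal_nonneg fun δ hδ =>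
        integral_rpow_im_le_of_two_le (by linarith) hδ hc hper hw ha hre⟩

end ImBound

section Characters

variable {d : ℕ}

/-- The trigonometric polynomial with coefficients `c` on `s`. -/
noncomputable def trig (s : Finset (Fin d → ℤ)) (c : (Fin d → ℤ) → ℂ) (x : Fin d → ℝ) : ℂ :=
  ∑ k ∈ s, c k * expChar k x

lemma continuous_trig (s : Finset (Fin d → ℤ)) (c : (Fin d → ℤ) → ℂ) : Continuous (trig s c) :=
  continuous_finsetSum _ fun k _ => continuous_const.mul (continuous_expChar k)

lemma periodic_trig (s : Finset (Fin d → ℤ)) (c : (Fin d → ℤ) → ℂ) : Periodic2Pi (trig s c) :=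
  fun x i => Finset.sum_congr rfl fun k _ => by rw [periodic_expChar k x i]

lemma memLp_of_continuous {f : (Fin d → ℝ) → ℂ} (hf : Continuous f) (p : ℝ≥0∞) :
    MemLp f p (torusMeasure d) := by
  obtain ⟨C, hC⟩ := (isCompact_univ_pi fun _ : Fin d =>
    isCompact_Icc (a := (0 : ℝ)) (b := 2 * Real.pi)).exists_bound_of_continuousOn hf.continuousOn
  refine MemLp.of_bound hf.aestronglyMeasurable C ?_
  exact (ae_restrict_iff' (MeasurableSet.univ_pi fun _ => measurableSet_Icc)).2
    (Filter.Eventually.of_forall hC)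

/-- The character `e^{i⟨k,x⟩}` as an element of `L_p(𝕋^d)`. -/
noncomputable def charLp (p : ℝ) (k : Fin d → ℤ) : Lp ℂ (ENNReal.ofReal p) (torusMeasure d) :=
  (memLp_of_continuous (continuous_expChar k) _).toLp (expChar k)

variable {p : ℝ}

lemma comb_charLp (s : Finset (Fin d → ℤ)) (c : (Fin d → ℤ) → ℂ)
    [Fact (1 ≤ ENNReal.ofReal p)] :
    comb (charLp p) s c = (memLp_of_continuous (continuous_trig s c) _).toLp (trig s c) := by
  classical
  induction s using Finset.induction_on with
  | empty =>
    symm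
    simp only [comb, Finset.sum_empty]
    rw [← norm_eq_zero, Lp.norm_toLp]
    simp [funext fun x => show trig (∅ : Finset (Fin d → ℤ)) c x = 0 by simp [trig]]
  | insert k s hk ih =>
    have h1 : comb (charLp p) (insert k s) c = c k • charLp p k + comb (charLp p) s c :=
      Finset.sum_insert hk
    rw [h1, ih, charLp, ← MemLp.toLp_const_smul, ← MemLp.toLp_add]
    refine MemLp.toLp_congr _ _ (Filter.Eventually.of_forall fun x => ?_)
    simp [trig, Finset.sum_insert hk]

lemma norm_comb_charLp [Fact (1 ≤ ENNReal.ofReal p)] (s : Finset (Fin d → ℤ))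
    (c : (Fin d → ℤ) → ℂ) :
    ‖comb (charLp p) s c‖ = (eLpNorm (trig s c) (ENNReal.ofReal p) (torusMeasure d)).toReal := by
  rw [comb_charLp, Lp.norm_toLp]

lemma norm_comb_charLp_rpow [Fact (1 ≤ ENNReal.ofReal p)] (hp : 0 < p) (s : Finset (Fin d → ℤ))
    (c : (Fin d → ℤ) → ℂ) :
    ‖comb (charLp p) s c‖ ^ p = ∫ x, ‖trig s c x‖ ^ p ∂torusMeasure d := by
  rw [norm_comb_charLp, MemLp.eLpNorm_eq_integral_rpow_norm (ENNReal.ofReal_pos.2 hp).ne'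
    ENNReal.ofReal_ne_top (memLp_of_continuous (continuous_trig s c) _),
    ENNReal.toReal_ofReal (by positivity), ENNReal.toReal_ofReal hp.le,
    Real.rpow_inv_rpow (integral_nonneg fun x => by positivity) hp.ne']

lemma trig_shift (s : Finset (Fin d → ℤ)) (c : (Fin d → ℤ) → ℂ) (x h : Fin d → ℝ) :
    trig s c (x + h) = trig s (fun k => Complex.exp (Complex.I * (dot k h : ℂ)) * c k) x :=
  Finset.sum_congr rfl fun k _ => by rw [expChar_shift]; ring

lemma isMult_shift [Fact (1 ≤ ENNReal.ofReal p)] (hp : 0 < p) (s : Finset (Fin d → ℤ))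
    (h : Fin d → ℝ) :
    IsMult (charLp p) s (fun k => Complex.exp (Complex.I * (dot k h : ℂ))) 1 := fun c => by
  rw [one_mul, norm_comb_charLp, norm_comb_charLp, ← eLpNorm_shift (periodic_trig s c) h hp]
  simp only [trig_shift]
  exact le_rfl

lemma norm_comb_modulate [Fact (1 ≤ ENNReal.ofReal p)] (s : Finset (Fin d → ℤ))
    (c : (Fin d → ℤ) → ℂ) (l : Fin d → ℤ) :
    ‖comb (charLp p) (s.map (Equiv.subRight l).toEmbedding) (fun k => c (k + l))‖ =
      ‖comb (charLp p) s c‖ := by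
  rw [norm_comb_charLp, norm_comb_charLp]
  congr 1
  refine eLpNorm_congr_norm_ae (Filter.Eventually.of_forall fun x => ?_)
  have : trig s c x = expChar l x *
      trig (s.map (Equiv.subRight l).toEmbedding) (fun k => c (k + l)) x := by
    simp only [trig, Finset.sum_map, Finset.mul_sum]
    refine Finset.sum_congr rfl fun k _ => ?_
    have : expChar k x = expChar (k - l) x * expChar l x := by
      rw [← expChar_add, sub_add_cancel]
    simp only [Equiv.coe_toEmbedding, Equiv.subRight_apply, sub_add_cancel, this]
    ring
  rw [this, norm_mul, norm_expChar, one_mul]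

lemma isMult_modulate [Fact (1 ≤ ENNReal.ofReal p)] {m : (Fin d → ℤ) → ℂ} {A : ℝ}
    (h : ∀ s, IsMult (charLp p) s m A) (s : Finset (Fin d → ℤ)) (l : Fin d → ℤ) :
    IsMult (charLp p) s (fun k => m (k - l)) A := fun c => by
  have := h (s.map (Equiv.subRight l).toEmbedding) (fun k => c (k + l))
  rw [norm_comb_modulate] at this
  refine (norm_comb_modulate s _ l).symm.trans_le (le_trans (le_of_eq ?_) this)
  simp only [add_sub_cancel_right]

end Characters

section Riesz

variable {d : ℕ} {p : ℝ}

lemma exists_integral_rpow_im_trig_le (hp : 1 < p) :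
    ∃ A : ℝ, 0 < A ∧ ∀ (d : ℕ) (s : Finset (Fin d → ℤ)) (y : Fin d → ℝ) (c : (Fin d → ℤ) → ℂ),
      ∫ x, |(trig s (fun k => (Real.sign (dot k y) : ℂ) * c k) x).im| ^ p ∂torusMeasure d ≤
        A * ∫ x, |(trig s c x).re| ^ p ∂torusMeasure d := by
  obtain ⟨A, hA, h⟩ := exists_integral_rpow_im_le hp
  refine ⟨A, hA, fun d s y c => ?_⟩
  have hcont : ∀ k, Continuous fun x => c k * expChar k x := fun k =>
    continuous_const.mul (continuous_expChar k)
  have := @h d _ s (fun k => |dot k y|)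
    (fun k x => if 0 < dot k y then c k * expChar k x else if dot k y < 0 then
      (starRingEnd ℂ) (c k * expChar k x) else ((c k * expChar k x).re : ℂ)) y ?_ ?_ ?_
      (fun k => abs_nonneg _) ?_
  · have e1 : ∀ x, (trig s (fun k => (Real.sign (dot k y) : ℂ) * c k) x).im = (∑ k ∈ s,
        if 0 < dot k y then c k * expChar k x else if dot k y < 0 then
        (starRingEnd ℂ) (c k * expChar k x) else ((c k * expChar k x).re : ℂ)).im := fun x => by
      simp only [trig, Complex.im_sum]
      refine Finset.sum_congr rfl fun k _ => ?_
      rcases lt_trichotomy (dot k y) 0 with h | h | h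
      · simp [Real.sign_of_neg h, h, not_lt.2 h.le]
        ring
      · simp [h]
      · simp [Real.sign_of_pos h, h]
    have e2 : ∀ x, (trig s c x).re = (∑ k ∈ s,
        if 0 < dot k y then c k * expChar k x else if dot k y < 0 then
        (starRingEnd ℂ) (c k * expChar k x) else ((c k * expChar k x).re : ℂ)).re := fun x => by
      rw [trig, Complex.re_sum, Complex.re_sum]
      refine Finset.sum_congr rfl fun k _ => ?_
      split_ifs <;> simp
    simp only [e1, e2]
    exact this
  · intro k
    by_cases h1 : 0 < dot k y
    · simpa only [h1, if_true] using hcont k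
    · by_cases h2 : dot k y < 0
      · simpa only [h1, h2, if_true, if_false, Function.comp_def] using Complex.continuous_conj.comp (hcont k)
      · simpa only [h1, h2, if_false, Function.comp_def] using
          Complex.continuous_ofReal.comp (Complex.continuous_re.comp (hcont k))
  · intro k x i
    simp only [periodic_expChar k x i]
  · intro k x t
    simp only [expChar_shift, dot_smul_right]
    rcases lt_trichotomy (dot k y) 0 with h | h | h
    · simp only [not_lt.2 h.le, h, if_true, if_false, abs_of_neg h, map_mul, ← Complex.exp_conj,
        Complex.conj_I, Complex.conj_ofReal]
      rw [show -Complex.I * ((t * dot k y : ℝ) : ℂ) = Complex.I * ((-dot k y * t : ℝ) : ℂ) by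
        push_cast; ring]
      ring
    · simp [h]
    · simp only [h, if_true, abs_of_pos h]
      rw [mul_comm t]
      ring
  · intro k x hk
    simp [abs_eq_zero.1 hk]

/-- The Riesz projections are bounded: signs of linear forms are multipliers. -/
lemma exists_isMult_sign (hp : 1 < p) [Fact (1 ≤ ENNReal.ofReal p)] : ∃ A : ℝ, 0 ≤ A ∧
    ∀ (d : ℕ) (s : Finset (Fin d → ℤ)) (y : Fin d → ℝ),
      IsMult (charLp p) s (fun k => (Real.sign (dot k y) : ℂ)) A := by
  obtain ⟨A, hA, h⟩ := exists_integral_rpow_im_trig_le hp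
  have hp0 : 0 < p := by linarith
  refine ⟨(2 ^ (p + 1) * A) ^ p⁻¹, by positivity, fun d s y c => ?_⟩
  set m : (Fin d → ℤ) → ℂ := fun k => (Real.sign (dot k y) : ℂ) with hm
  have cont : ∀ c : (Fin d → ℤ) → ℂ, Continuous (trig s c) := continuous_trig s
  have ire : ∀ c : (Fin d → ℤ) → ℂ, Integrable (fun x => |(trig s c x).re| ^ p) (torusMeasure d) :=
    fun c => integrable_of_continuous
      ((Complex.continuous_re.comp (cont c)).abs.rpow_const fun _ => Or.inr hp0.le)
  have iim : ∀ c : (Fin d → ℤ) → ℂ, Integrable (fun x => |(trig s c x).im| ^ p) (torusMeasure d) :=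
    fun c => integrable_of_continuous
      ((Complex.continuous_im.comp (cont c)).abs.rpow_const fun _ => Or.inr hp0.le)
  have inorm : ∀ c : (Fin d → ℤ) → ℂ, Integrable (fun x => ‖trig s c x‖ ^ p) (torusMeasure d) :=
    fun c => integrable_of_continuous ((cont c).norm.rpow_const fun _ => Or.inr hp0.le)
  have h1 := h d s y c
  have h2 := h d s y fun k => Complex.I * c k
  have hI : ∀ (c : (Fin d → ℤ) → ℂ) x, trig s (fun k => Complex.I * c k) x =
      Complex.I * trig s c x := fun c x => by
    simp only [trig, Finset.mul_sum, mul_assoc]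
  have e1 : ∀ x, trig s (fun k => (Real.sign (dot k y) : ℂ) * (Complex.I * c k)) x =
      Complex.I * trig s (fun k => m k * c k) x := fun x => by
    rw [← hI]; exact Finset.sum_congr rfl fun k _ => by ring
  simp only [e1, hI, Complex.I_mul_im, Complex.I_mul_re, abs_neg] at h2
  have h3 : ∫ x, ‖trig s (fun k => m k * c k) x‖ ^ p ∂torusMeasure d ≤
      2 ^ p * (∫ x, |(trig s (fun k => m k * c k) x).re| ^ p ∂torusMeasure d +
        ∫ x, |(trig s (fun k => m k * c k) x).im| ^ p ∂torusMeasure d) := by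
    rw [← integral_add (ire _) (iim _), ← integral_const_mul]
    refine integral_mono (inorm _) (((ire _).add (iim _)).const_mul _) fun x => ?_
    simp only
    generalize trig s (fun k => m k * c k) x = z
    have := Complex.norm_le_abs_re_add_abs_im z
    have hmax : ‖z‖ ≤ 2 * max |z.re| |z.im| := by
      linarith [le_max_left |z.re| |z.im|, le_max_right |z.re| |z.im|]
    refine (Real.rpow_le_rpow (norm_nonneg _) hmax hp0.le).trans ?_
    rw [Real.mul_rpow (by norm_num) (by positivity)]
    refine mul_le_mul_of_nonneg_left ?_ (by positivity)
    have : 0 ≤ |z.re| ^ p := by positivity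
    have : 0 ≤ |z.im| ^ p := by positivity
    rcases max_choice |z.re| |z.im| with h | h <;> rw [h] <;> linarith
  have h4 : ∫ x, |(trig s c x).re| ^ p ∂torusMeasure d ≤ ∫ x, ‖trig s c x‖ ^ p ∂torusMeasure d :=
    integral_mono (ire _) (inorm _) fun x =>
      Real.rpow_le_rpow (abs_nonneg _) (Complex.abs_re_le_norm _) hp0.le
  have h5 : ∫ x, |(trig s c x).im| ^ p ∂torusMeasure d ≤ ∫ x, ‖trig s c x‖ ^ p ∂torusMeasure d :=
    integral_mono (iim _) (inorm _) fun x =>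
      Real.rpow_le_rpow (abs_nonneg _) (Complex.abs_im_le_norm _) hp0.le
  rw [← Real.rpow_le_rpow_iff (norm_nonneg _) (by positivity) hp0,
    Real.mul_rpow (by positivity) (by positivity), norm_comb_charLp_rpow hp0,
    norm_comb_charLp_rpow hp0, Real.rpow_inv_rpow (by positivity) hp0.ne',
    Real.rpow_add_one (by norm_num)]
  refine h3.trans ?_
  have h6 := mul_le_mul_of_nonneg_left h4 hA.le
  have h7 := mul_le_mul_of_nonneg_left h5 hA.le
  have h8 : (0 : ℝ) ≤ 2 ^ p := by positivity
  rw [mul_assoc, mul_assoc]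
  refine mul_le_mul_of_nonneg_left ?_ h8
  linarith

/-- `K` bounds the sign and slab multipliers on `L_p(𝕋^d)`. -/
def RieszBound (d : ℕ) (p : ℝ) [Fact (1 ≤ ENNReal.ofReal p)] (K : ℝ) : Prop :=
  1 ≤ K ∧ ∀ (s : Finset (Fin d → ℤ)) (y : Fin d → ℝ),
    IsMult (charLp p) s (fun k => (Real.sign (dot k y) : ℂ)) K ∧
    ∀ a : ℝ, IsMult (charLp p) s (fun k => if |dot k y| ≤ a then 1 else 0) K

lemma exists_rieszBound (hp : 1 < p) [Fact (1 ≤ ENNReal.ofReal p)] (d : ℕ) :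
    ∃ K : ℝ, RieszBound d p K := by
  obtain ⟨A, hA, h⟩ := exists_isMult_sign hp
  replace h := h d
  set B : ℝ := 1 + A * (A + 1) / 2 with hB
  have hB1 : 0 ≤ A * (A + 1) / 2 := by positivity
  have hnonneg : ∀ (s : Finset (Fin d → ℤ)) (y : Fin d → ℝ),
      IsMult (charLp p) s (fun k => if 0 ≤ dot k y then 1 else 0) B := fun s y => by
    have h1 := ((h s y).mul ((h s y).sub isMult_one) hA).const_mul (1 / 2)
    refine ((isMult_one.sub h1).mono ?_).congr fun k _ => ?_
    · rw [hB]; norm_num; linarith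
    · rcases lt_trichotomy (dot k y) 0 with h | h | h
      · rw [if_neg (not_le.2 h), Real.sign_of_neg h]; push_cast; ring
      · rw [if_pos h.ge, h, Real.sign_zero]; push_cast; ring
      · rw [if_pos h.le, Real.sign_of_pos h]; push_cast; ring
  have hgt : ∀ (s : Finset (Fin d → ℤ)) (y : Fin d → ℝ) (a : ℝ),
      IsMult (charLp p) s (fun k => if a < dot k y then 1 else 0) B := fun s y a => by
    by_cases hne : (s.filter fun k => a < dot k y).Nonempty
    · obtain ⟨l, hl, hmin⟩ := Finset.exists_min_image _ (fun k => dot k y) hne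
      rw [Finset.mem_filter] at hl
      refine (isMult_modulate (fun s => hnonneg s y) s l).congr fun k hk =>
        if_congr ⟨fun h => ?_, fun h => ?_⟩ rfl rfl
      · rw [dot_sub_left]
        linarith [hmin k (Finset.mem_filter.2 ⟨hk, h⟩)]
      · rw [dot_sub_left] at h
        linarith [hl.2]
    · refine ((isMult_const 0).mono (A₁ := ‖(0 : ℂ)‖) (by rw [norm_zero]; linarith)).congr
        fun k hk => if_neg fun h => hne ⟨k, Finset.mem_filter.2 ⟨hk, h⟩⟩
  have hle : ∀ (s : Finset (Fin d → ℤ)) (y : Fin d → ℝ) (a : ℝ),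
      IsMult (charLp p) s (fun k => if dot k y ≤ a then 1 else 0) (1 + B) := fun s y a =>
    (isMult_one.sub (hgt s y a)).congr fun k _ => by
      by_cases h : dot k y ≤ a
      · simp [h, not_lt.2 h]
      · simp [h, not_le.1 h]
  refine ⟨max A ((1 + B) * (1 + B)), ?_, fun s y => ⟨(h s y).mono (le_max_left _ _), fun a => ?_⟩⟩
  · exact le_max_of_le_right (by nlinarith)
  · refine (((hle s y a).mul (hle s (-y) a) (by linarith)).mono (le_max_right _ _)).congr
      fun k _ => ?_
    rw [dot_neg_right]
    by_cases h1 : dot k y ≤ a <;> by_cases h2 : -dot k y ≤ a <;> simp [abs_le', h1, h2]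

end Riesz

lemma monotone_sign : Monotone Real.sign := fun a b h => by
  unfold Real.sign
  split_ifs <;> linarith

lemma measurable_sign : Measurable Real.sign := monotone_sign.measurable

lemma abs_sign_le (t : ℝ) : |Real.sign t| ≤ 1 := by
  rcases Real.sign_apply_eq t with h | h | h <;> rw [h] <;> simp

lemma sign_mul_of_pos {a : ℝ} (ha : 0 < a) (t : ℝ) : Real.sign (a * t) = Real.sign t := by
  rcases lt_trichotomy t 0 with h | h | h
  · rw [Real.sign_of_neg h, Real.sign_of_neg (mul_neg_of_pos_of_neg ha h)]
  · rw [h, mul_zero]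
  · rw [Real.sign_of_pos h, Real.sign_of_pos (mul_pos ha h)]

section Tent

variable {d : ℕ}

local notation "𝔼" => EuclideanSpace ℝ (Fin d)

/-- The tent function `max 0 (1 - ‖y‖)`. -/
noncomputable def tent (y : EuclideanSpace ℝ (Fin d)) : ℝ := max 0 (1 - ‖y‖)

lemma tent_nonneg (y : 𝔼) : 0 ≤ tent y := le_max_left _ _

lemma tent_le_one (y : 𝔼) : tent y ≤ 1 := max_le (by norm_num) (by linarith [norm_nonneg y])

lemma tent_neg (y : 𝔼) : tent (-y) = tent y := by rw [tent, tent, norm_neg]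

lemma tent_eq_zero {y : 𝔼} (h : 1 ≤ ‖y‖) : tent y = 0 := max_eq_left (by linarith)

lemma continuous_tent : Continuous (tent : 𝔼 → ℝ) := by unfold tent; fun_prop

lemma hasCompactSupport_tent : HasCompactSupport (tent : 𝔼 → ℝ) :=
  HasCompactSupport.intro (isCompact_closedBall 0 1) fun y hy =>
    tent_eq_zero (by simpa using (not_le.1 fun h => hy (by simpa using h)).le)

lemma integrable_mul_tent {g : 𝔼 → ℝ} (hg : Continuous g) : Integrable fun y => g y * tent y :=
  (hg.mul continuous_tent).integrable_of_hasCompactSupport hasCompactSupport_tent.mul_left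

lemma integrable_tent : Integrable (tent : 𝔼 → ℝ) :=
  continuous_tent.integrable_of_hasCompactSupport hasCompactSupport_tent

lemma integral_tent_pos : 0 < ∫ y : 𝔼, tent y :=
  continuous_tent.integral_pos_of_hasCompactSupport_nonneg_nonzero hasCompactSupport_tent
    tent_nonneg (x := 0) (by simp [tent])

/-- Integrals of ridge functions against the tent are rotation invariant. -/
lemma integral_inner_tent_congr {u v : 𝔼} (h : ‖u‖ = ‖v‖) (F : ℝ → ℝ) :
    ∫ y : 𝔼, F (inner ℝ u y) * tent y = ∫ y : 𝔼, F (inner ℝ v y) * tent y := by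
  set R := (Submodule.span ℝ {u - v})ᗮ.reflection with hR
  have hRu : R u = v := Submodule.reflection_sub h
  rw [← R.measurePreserving.integral_comp R.toHomeomorph.measurableEmbedding]
  refine integral_congr_ae (Filter.Eventually.of_forall fun y => ?_)
  simp only [← hRu, tent, LinearIsometryEquiv.norm_map]
  congr 2
  rw [← R.inner_map_map]
  simp [hR]

lemma integral_abs_tent_sub_le (v : 𝔼) :
    Integrable (fun y : 𝔼 => |tent (y - v) - tent y|) ∧ ∫ y : 𝔼, |tent (y - v) - tent y| ≤
      2 * volume.real (Metric.closedBall (0 : 𝔼) 1) * min 1 ‖v‖ := by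
  have hint : Integrable (fun y : 𝔼 => |tent (y - v) - tent y|) :=
    ((integrable_tent.comp_sub_right v).sub integrable_tent).abs
  refine ⟨hint, ?_⟩
  set B : 𝔼 → ℝ := (Metric.closedBall (0 : 𝔼) 1).indicator fun _ => 1 with hB
  have iB : Integrable B := (integrable_indicator_iff measurableSet_closedBall).2
    (integrableOn_const (measure_closedBall_lt_top.ne))
  have hBi : ∫ y, B y = volume.real (Metric.closedBall (0 : 𝔼) 1) := by
    rw [hB, integral_indicator measurableSet_closedBall]; simp
  have hB0 : ∀ y, 0 ≤ B y := fun y => Set.indicator_nonneg (fun _ _ => zero_le_one) y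
  have hBt : ∀ y, tent y ≠ 0 → B y = 1 := fun y hy => by
    refine Set.indicator_of_mem ?_ _
    by_contra hc
    exact hy (tent_eq_zero (by simpa using (not_le.1 fun h => hc (by simpa using h)).le))
  calc ∫ y : 𝔼, |tent (y - v) - tent y| ≤ ∫ y : 𝔼, min 1 ‖v‖ * (B (y - v) + B y) := by
        refine integral_mono hint (((iB.comp_sub_right v).add iB).const_mul _) fun y => ?_
        have h1 : |tent (y - v) - tent y| ≤ min 1 ‖v‖ := by
          refine le_min ?_ ?_
          · rw [abs_le]
            constructor <;>
            linarith [tent_nonneg y, tent_le_one y, tent_nonneg (y - v), tent_le_one (y - v)]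
          · have h3 := abs_max_sub_max_le_abs (1 - ‖y - v‖) (1 - ‖y‖) 0
            rw [max_comm _ (0 : ℝ), max_comm _ (0 : ℝ)] at h3
            refine h3.trans ?_
            have h4 := abs_norm_sub_norm_le y (y - v)
            rw [sub_sub_cancel] at h4
            rwa [sub_sub_sub_cancel_left]
        simp only
        by_cases hz : tent (y - v) = 0 ∧ tent y = 0
        · rw [hz.1, hz.2, sub_zero, abs_zero]
          exact mul_nonneg (by positivity) (add_nonneg (hB0 _) (hB0 _))
        · refine h1.trans (le_mul_of_one_le_right (by positivity) ?_)
          rcases not_and_or.1 hz with hz | hz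
          · rw [hBt _ hz]; linarith [hB0 y]
          · rw [hBt _ hz]; linarith [hB0 (y - v)]
    _ = _ := by
        rw [integral_const_mul, integral_add (iB.comp_sub_right v) iB,
          integral_sub_right_eq_self, hBi]
        ring

lemma integrable_sign_mul {u : 𝔼} {t : ℝ} {g : 𝔼 → ℝ} (hg : Integrable g) :
    Integrable fun y => Real.sign (inner ℝ u y + t) * g y := by
  refine hg.bdd_mul (c := 1) ?_ (Filter.Eventually.of_forall fun y => ?_)
  · exact (measurable_sign.comp (by fun_prop)).aestronglyMeasurable
  · exact abs_sign_le _

/-- The mean of `sign (⟪u, ·⟫ + t)` against the tent. -/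
noncomputable def signTent (u : EuclideanSpace ℝ (Fin d)) (t : ℝ) : ℝ :=
  ∫ y : 𝔼, Real.sign (inner ℝ u y + t) * tent y

lemma signTent_neg (u : 𝔼) (t : ℝ) : signTent u (-t) = -signTent u t := by
  rw [signTent, signTent, ← integral_neg_eq_self, ← integral_neg]
  refine integral_congr_ae (Filter.Eventually.of_forall fun y => ?_)
  simp only [inner_neg_right, tent_neg]
  rw [← neg_add, Real.sign_neg]
  ring

lemma signTent_zero (u : 𝔼) : signTent u 0 = 0 := by
  have := signTent_neg u 0
  rw [neg_zero] at this
  linarith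

lemma monotone_signTent (u : 𝔼) : Monotone (signTent u) := fun a b h =>
  integral_mono (integrable_sign_mul integrable_tent) (integrable_sign_mul integrable_tent)
    fun y => mul_le_mul_of_nonneg_right (monotone_sign (by linarith)) (tent_nonneg y)

lemma signTent_congr {u v : 𝔼} (h : ‖u‖ = ‖v‖) (t : ℝ) : signTent u t = signTent v t :=
  integral_inner_tent_congr h fun r => Real.sign (r + t)

lemma signTent_of_one_lt {u : 𝔼} (hu : ‖u‖ = 1) {t : ℝ} (ht : 1 < t) :
    signTent u t = ∫ y : 𝔼, tent y := by
  refine integral_congr_ae (Filter.Eventually.of_forall fun y => ?_)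
  simp only
  rcases le_total 1 ‖y‖ with h | h
  · rw [tent_eq_zero h, mul_zero]
  · have := abs_le.1 (abs_real_inner_le_norm u y)
    rw [hu, one_mul] at this
    rw [Real.sign_of_pos (by linarith), one_mul]

lemma integral_sign_mul_tent_sub (u v : 𝔼) :
    ∫ y : 𝔼, Real.sign (inner ℝ u y) * (tent (y - v) - tent y) = signTent u (inner ℝ u v) := by
  have i1 := integrable_sign_mul (u := u) (t := 0) (integrable_tent.comp_sub_right v)
  have i2 := integrable_sign_mul (u := u) (t := 0) integrable_tent
  simp only [add_zero] at i1 i2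
  simp only [mul_sub]
  rw [integral_sub i1 i2]
  have h1 := signTent_zero u
  simp only [signTent, add_zero] at h1
  rw [h1, sub_zero, signTent, ← integral_sub_right_eq_self
    (fun y : 𝔼 => Real.sign (inner ℝ u y + inner ℝ u v) * tent y) v]
  simp [inner_sub_right]

lemma abs_signTent_le {u : 𝔼} (hu : ‖u‖ = 1) (t : ℝ) :
    |signTent u t| ≤ 2 * volume.real (Metric.closedBall (0 : 𝔼) 1) * min 1 |t| := by
  have h := integral_sign_mul_tent_sub u (t • u)
  rw [inner_smul_right, real_inner_self_eq_norm_sq, hu, one_pow, mul_one] at h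
  have h2 := integral_abs_tent_sub_le (t • u)
  rw [norm_smul, hu, mul_one, Real.norm_eq_abs] at h2
  rw [← h]
  refine (abs_integral_le_integral_abs).trans (le_trans ?_ h2.2)
  refine integral_mono_of_nonneg (Filter.Eventually.of_forall fun y => abs_nonneg _) h2.1
    (Filter.Eventually.of_forall fun y => ?_)
  simp only [abs_mul]
  exact mul_le_of_le_one_left (abs_nonneg _) (abs_sign_le _)

lemma integrableOn_rpow_mul_min {β : ℝ} (h0 : 0 < β) (h1 : β < 1) :
    IntegrableOn (fun s : ℝ => s ^ (-1 - β) * min 1 s) (Set.Ioi 0) := by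
  rw [← Set.Ioc_union_Ioi_eq_Ioi zero_le_one]
  refine IntegrableOn.union ?_ ?_
  · have := (intervalIntegral.intervalIntegrable_rpow' (r := -β) (a := 0) (b := 1) (by linarith)).1
    refine this.congr_fun (fun s hs => ?_) measurableSet_Ioc
    simp only
    rw [min_eq_right hs.2, ← Real.rpow_add_one hs.1.ne']
    congr 1; ring
  · refine (integrableOn_Ioi_rpow_of_lt (a := -1 - β) (by linarith) zero_lt_one).congr_fun
      (fun s hs => ?_) measurableSet_Ioi
    simp only
    rw [min_eq_left (le_of_lt hs), mul_one]

lemma integrableOn_rpow_mul_signTent {β : ℝ} (h0 : 0 < β) (h1 : β < 1) {u : 𝔼} (hu : ‖u‖ = 1) :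
    IntegrableOn (fun s : ℝ => s ^ (-1 - β) * signTent u s) (Set.Ioi 0) := by
  have := (integrableOn_rpow_mul_min h0 h1).const_mul
    (2 * volume.real (Metric.closedBall (0 : 𝔼) 1))
  refine Integrable.mono' this ?_ ((ae_restrict_iff' measurableSet_Ioi).2
    (Filter.Eventually.of_forall fun s hs => ?_))
  · exact (((measurable_id.pow_const _).mul (monotone_signTent u).measurable)).aestronglyMeasurable
  · have h := abs_signTent_le hu s
    have hs' : (0 : ℝ) < s := hs
    rw [abs_of_pos hs'] at h
    rw [norm_mul, Real.norm_of_nonneg (by positivity), Real.norm_eq_abs]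
    have := mul_le_mul_of_nonneg_left h (by positivity : 0 ≤ s ^ (-1 - β))
    linarith

lemma integral_rpow_mul_signTent_pos {β : ℝ} (h0 : 0 < β) (h1 : β < 1) {u : 𝔼} (hu : ‖u‖ = 1) :
    0 < ∫ s in Set.Ioi (0 : ℝ), s ^ (-1 - β) * signTent u s := by
  have hi := integrableOn_rpow_mul_signTent h0 h1 hu
  have hnn : ∀ s ∈ Set.Ioi (0 : ℝ), 0 ≤ s ^ (-1 - β) * signTent u s := fun s hs =>
    mul_nonneg (Real.rpow_nonneg (le_of_lt hs) _)
      ((signTent_zero u).symm.trans_le (monotone_signTent u (le_of_lt hs)))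
  have h2 : ∫ s in Set.Ioi (1 : ℝ), s ^ (-1 - β) * signTent u s ≤
      ∫ s in Set.Ioi (0 : ℝ), s ^ (-1 - β) * signTent u s :=
    setIntegral_mono_set hi ((ae_restrict_iff' measurableSet_Ioi).2
      (Filter.Eventually.of_forall hnn)) (Set.Ioi_subset_Ioi zero_le_one).eventuallyLE
  refine lt_of_lt_of_le ?_ h2
  have : ∫ s in Set.Ioi (1 : ℝ), s ^ (-1 - β) * signTent u s =
      ∫ s in Set.Ioi (1 : ℝ), s ^ (-1 - β) * ∫ y : 𝔼, tent y :=
    setIntegral_congr_fun measurableSet_Ioi fun s hs => by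
      rw [signTent_of_one_lt hu hs]
  rw [this, integral_mul_const, integral_Ioi_rpow_of_lt (by linarith) zero_lt_one, Real.one_rpow]
  exact mul_pos (div_pos_of_neg_of_neg (by norm_num) (by linarith)) integral_tent_pos

lemma integral_rpow_mul_signTent_mul (β : ℝ) (u : 𝔼) (r : ℝ) :
    ∫ s in Set.Ioi (0 : ℝ), s ^ (-1 - β) * signTent u (s * r) =
      Real.sign r * |r| ^ β * ∫ s in Set.Ioi (0 : ℝ), s ^ (-1 - β) * signTent u s := by
  have key : ∀ r : ℝ, 0 < r → ∫ s in Set.Ioi (0 : ℝ), s ^ (-1 - β) * signTent u (s * r) =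
      r ^ β * ∫ s in Set.Ioi (0 : ℝ), s ^ (-1 - β) * signTent u s := fun r hr => by
    have h := integral_comp_mul_right_Ioi (fun s => s ^ (-1 - β) * signTent u s) 0 hr
    rw [zero_mul, smul_eq_mul] at h
    have h2 : ∫ s in Set.Ioi (0 : ℝ), (s * r) ^ (-1 - β) * signTent u (s * r) =
        ∫ s in Set.Ioi (0 : ℝ), r ^ (-1 - β) * (s ^ (-1 - β) * signTent u (s * r)) :=
      setIntegral_congr_fun measurableSet_Ioi fun s hs => by
        rw [Real.mul_rpow (le_of_lt hs) hr.le]; ring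
    rw [h2, integral_const_mul] at h
    have h3 : r ^ β = (r ^ (-1 - β))⁻¹ * r⁻¹ := by
      rw [← Real.rpow_neg hr.le, ← Real.rpow_neg_one, ← Real.rpow_add hr]
      congr 1; ring
    have h4 : r ^ (-1 - β) ≠ 0 := (Real.rpow_pos_of_pos hr _).ne'
    rw [h3, mul_assoc, ← h, inv_mul_cancel_left₀ h4]
  rcases lt_trichotomy r 0 with h | h | h
  · have := key (-r) (by linarith)
    simp only [mul_neg, signTent_neg] at this
    rw [integral_neg] at this
    rw [Real.sign_of_neg h, abs_of_neg h]
    linarith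
  · simp [h, signTent_zero]
  · rw [key r h, Real.sign_of_pos h, abs_of_pos h, one_mul]

end Tent

section RieszMultipliers

variable {d : ℕ} {p K α : ℝ}

/-- The Euclidean norm of a frequency. -/
noncomputable def intNorm (k : Fin d → ℤ) : ℝ := euclNorm fun i => (k i : ℝ)

/-- A frequency as a vector of Euclidean space. -/
noncomputable def intVec (k : Fin d → ℤ) : EuclideanSpace ℝ (Fin d) :=
  WithLp.toLp 2 fun i => (k i : ℝ)

lemma norm_toLp_eq_euclNorm (x : Fin d → ℝ) : ‖WithLp.toLp 2 x‖ = euclNorm x := by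
  rw [EuclideanSpace.norm_eq, euclNorm]
  simp

lemma euclNorm_ofLp (y : EuclideanSpace ℝ (Fin d)) : euclNorm y.ofLp = ‖y‖ :=
  (norm_toLp_eq_euclNorm _).symm

lemma norm_intVec (k : Fin d → ℤ) : ‖intVec k‖ = intNorm k := norm_toLp_eq_euclNorm _

lemma intNorm_nonneg (k : Fin d → ℤ) : 0 ≤ intNorm k := Real.sqrt_nonneg _

lemma inner_intVec (k : Fin d → ℤ) (y : EuclideanSpace ℝ (Fin d)) :
    inner ℝ (intVec k) y = dot k y.ofLp := by
  simp [intVec, PiLp.inner_apply, dot, mul_comm]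

lemma abs_dot_le (k : Fin d → ℤ) (y : Fin d → ℝ) : |dot k y| ≤ intNorm k * euclNorm y := by
  have := abs_real_inner_le_norm (intVec k) (WithLp.toLp 2 y)
  rwa [inner_intVec, norm_intVec, norm_toLp_eq_euclNorm] at this

variable [Fact (1 ≤ ENNReal.ofReal p)]

lemma isMult_signTent (hK : RieszBound d p K) (s : Finset (Fin d → ℤ))
    (v : EuclideanSpace ℝ (Fin d)) :
    IsMult (charLp p) s (fun k => (signTent (intVec k) (inner ℝ (intVec k) v) : ℂ))
      (2 * volume.real (Metric.closedBall (0 : EuclideanSpace ℝ (Fin d)) 1) * K *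
        min 1 ‖v‖) := by
  obtain ⟨hint, hle⟩ := integral_abs_tent_sub_le v
  have hint' : Integrable fun y : EuclideanSpace ℝ (Fin d) => tent (y - v) - tent y :=
    (integrable_tent.comp_sub_right v).sub integrable_tent
  have hK0 : 0 ≤ K := by linarith [hK.1]
  have := IsMult.integral (e := charLp p) (s := s) (ν := volume)
    (m := fun k => (signTent (intVec k) (inner ℝ (intVec k) v) : ℂ))
    (M := fun (y : EuclideanSpace ℝ (Fin d)) k =>
      ((Real.sign (dot k y.ofLp) * (tent (y - v) - tent y) : ℝ) : ℂ))
    (A := fun y => |tent (y - v) - tent y| * K) ?_ ?_ (hint.mul_const K) ?_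
  · refine this.mono ?_
    rw [integral_mul_const]
    nlinarith
  · intro k _
    have := integrable_sign_mul (u := intVec k) (t := 0) hint'
    simp only [add_zero, inner_intVec] at this
    exact this.ofReal
  · intro k _
    rw [integral_complex_ofReal, ← integral_sign_mul_tent_sub]
    simp only [inner_intVec]
  · refine Filter.Eventually.of_forall fun y => ?_
    have h1 := ((hK.2 s y.ofLp).1).const_mul ((tent (y - v) - tent y : ℝ) : ℂ)
    rw [Complex.norm_real, Real.norm_eq_abs] at h1
    exact h1.congr fun k _ => by push_cast; ring

lemma signTent_intVec {e v : EuclideanSpace ℝ (Fin d)} (he : ‖e‖ = 1) (k : Fin d → ℤ) :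
    signTent (intVec k) (inner ℝ (intVec k) v) = signTent e (dot k v.ofLp / intNorm k) := by
  rw [inner_intVec]
  rcases (intNorm_nonneg k).eq_or_lt with h0 | h0
  · have : intVec k = 0 := by rw [← norm_eq_zero, norm_intVec, ← h0]
    have hd : dot k v.ofLp = 0 := by rw [← inner_intVec, this, inner_zero_left]
    rw [this, hd, signTent_zero, zero_div, signTent_zero]
  · have hu : ‖(intNorm k)⁻¹ • intVec k‖ = ‖e‖ := by
      rw [norm_smul, norm_intVec, norm_inv, Real.norm_of_nonneg h0.le, inv_mul_cancel₀ h0.ne', he]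
    rw [← signTent_congr hu]
    refine integral_congr_ae (Filter.Eventually.of_forall fun y => ?_)
    simp only [inner_smul_left]
    rw [← sign_mul_of_pos (inv_pos.2 h0)]
    congr 2
    simp
    ring

/-- Homogeneous multipliers of degree zero along a direction. -/
lemma exists_isMult_sign_mul_rpow (hK : RieszBound d p K) {β : ℝ} (h0 : 0 < β) (h1 : β < 1) :
    ∃ C : ℝ, 0 ≤ C ∧ ∀ (s : Finset (Fin d → ℤ)) (e : EuclideanSpace ℝ (Fin d)), ‖e‖ = 1 →
      IsMult (charLp p) s (fun k => ((Real.sign (dot k e.ofLp / intNorm k) *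
        |dot k e.ofLp / intNorm k| ^ β : ℝ) : ℂ)) C := by
  by_cases hE : ∃ e : EuclideanSpace ℝ (Fin d), ‖e‖ = 1
  swap
  · exact ⟨0, le_rfl, fun s e he => (hE ⟨e, he⟩).elim⟩
  obtain ⟨e₀, he₀⟩ := hE
  have hpos := integral_rpow_mul_signTent_pos h0 h1 he₀
  have hint := integrableOn_rpow_mul_signTent h0 h1 he₀
  set c := ∫ s in Set.Ioi (0 : ℝ), s ^ (-1 - β) * signTent e₀ s with hc
  set V := 2 * volume.real (Metric.closedBall (0 : EuclideanSpace ℝ (Fin d)) 1) * K with hV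
  have hK0 : 0 ≤ K := by linarith [hK.1]
  have hV0 : 0 ≤ V := by positivity
  have hA := ((integrableOn_rpow_mul_min h0 h1).const_mul V).const_mul c⁻¹
  refine ⟨∫ s in Set.Ioi (0 : ℝ), c⁻¹ * (V * (s ^ (-1 - β) * min 1 s)),
    setIntegral_nonneg measurableSet_Ioi fun s hs => ?_, fun s e he => ?_⟩
  · have hs' : (0 : ℝ) < s := hs
    positivity
  · refine IsMult.integral (ν := volume.restrict (Set.Ioi (0 : ℝ)))
      (M := fun t k => ((c⁻¹ * (t ^ (-1 - β) *
        signTent e₀ (t * (dot k e.ofLp / intNorm k))) : ℝ) : ℂ)) ?_ ?_ hA ?_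
    · intro k _
      refine Integrable.ofReal (Integrable.const_mul ?_ _)
      generalize dot k e.ofLp / intNorm k = r
      have hB := (integrableOn_rpow_mul_min h0 h1).const_mul
        (2 * volume.real (Metric.closedBall (0 : EuclideanSpace ℝ (Fin d)) 1) * max 1 |r|)
      refine Integrable.mono' hB ?_ ((ae_restrict_iff' measurableSet_Ioi).2
        (Filter.Eventually.of_forall fun t ht => ?_))
      · exact ((measurable_id.pow_const _).mul ((monotone_signTent e₀).measurable.comp
          (measurable_id.mul_const r))).aestronglyMeasurable
      · have h := abs_signTent_le he₀ (t * r)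
        have ht' : (0 : ℝ) < t := ht
        rw [norm_mul, Real.norm_of_nonneg (by positivity), Real.norm_eq_abs]
        have h3 : min 1 |t * r| ≤ max 1 |r| * min 1 t := by
          rw [abs_mul, abs_of_pos ht']
          rcases le_total 1 t with h | h
          · rw [min_eq_left h, mul_one]
            exact (min_le_left _ _).trans (le_max_left _ _)
          · rw [min_eq_right h]
            refine (min_le_right _ _).trans ?_
            rw [mul_comm]
            exact mul_le_mul_of_nonneg_right (le_max_right _ _) ht'.le
        have h4 := mul_le_mul_of_nonneg_left h3
          (by positivity : 0 ≤ 2 * volume.real (Metric.closedBall (0 : EuclideanSpace ℝ (Fin d)) 1))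
        have := mul_le_mul_of_nonneg_left (h.trans h4) (by positivity : 0 ≤ t ^ (-1 - β))
        linarith
    · intro k _
      rw [integral_complex_ofReal, integral_const_mul, integral_rpow_mul_signTent_mul]
      congr 1
      rw [← hc]
      field_simp
    · refine (ae_restrict_iff' measurableSet_Ioi).2 (Filter.Eventually.of_forall fun t ht => ?_)
      have ht' : (0 : ℝ) < t := ht
      have h2 := (isMult_signTent hK s (t • e)).const_mul ((c⁻¹ * t ^ (-1 - β) : ℝ) : ℂ)
      rw [Complex.norm_real, Real.norm_of_nonneg (by positivity), norm_smul, he, mul_one,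
        Real.norm_of_nonneg ht'.le] at h2
      refine (h2.mono (le_of_eq ?_)).congr fun k _ => ?_
      · rw [hV]; ring
      · rw [signTent_intVec he₀]
        have : dot k (t • e).ofLp = t * dot k e.ofLp := dot_smul_right k t e.ofLp
        rw [this, mul_div_assoc]
        push_cast; ring

lemma exists_isMult_ratio (hK : RieszBound d p K) (hα : 0 < α) :
    ∃ C : ℝ, 0 ≤ C ∧ ∀ (s : Finset (Fin d → ℤ)) (e : EuclideanSpace ℝ (Fin d)), ‖e‖ = 1 →
      IsMult (charLp p) s (fun k => (((|dot k e.ofLp| / intNorm k) ^ α : ℝ) : ℂ)) C := by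
  obtain ⟨m, hm⟩ := exists_nat_gt α
  have hm0 : (0 : ℝ) < m := hα.trans hm
  obtain ⟨C, hC, h⟩ := exists_isMult_sign_mul_rpow (β := α / m) hK (by positivity)
    ((div_lt_one hm0).2 hm)
  have hK0 : 0 ≤ K := by linarith [hK.1]
  refine ⟨(K * C) ^ m, by positivity, fun s e he => ?_⟩
  refine ((((hK.2 s e.ofLp).1).mul (h s e he) hK0).pow (by positivity) m).congr fun k _ => ?_
  rw [← Complex.ofReal_mul, ← Complex.ofReal_pow]
  congr 1
  have hmne : m ≠ 0 := by rintro rfl; simp at hm0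
  have hpow : ∀ r : ℝ, 0 ≤ r → (r ^ (α / m)) ^ m = r ^ α := fun r hr => by
    rw [← Real.rpow_mul_natCast hr, div_mul_cancel₀ _ hm0.ne']
  rcases (intNorm_nonneg k).eq_or_lt with h0 | h0
  · have : intVec k = 0 := by rw [← norm_eq_zero, norm_intVec, ← h0]
    have hd : dot k e.ofLp = 0 := by rw [← inner_intVec, this, inner_zero_left]
    rw [hd, ← h0]
    simp [hα.ne', hmne]
  · have hs : Real.sign (dot k e.ofLp / intNorm k) = Real.sign (dot k e.ofLp) := by
      rw [div_eq_inv_mul, sign_mul_of_pos (inv_pos.2 h0)]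
    rw [hs, ← mul_assoc, mul_pow, hpow _ (abs_nonneg _), abs_div, abs_of_pos h0]
    rcases lt_trichotomy (dot k e.ofLp) 0 with h | h | h
    · rw [Real.sign_of_neg h]; simp
    · rw [h]; simp [hα.ne', hmne]
    · rw [Real.sign_of_pos h]; simp

lemma exists_integral_abs_dot_rpow (hd : 0 < d) (hα : 0 < α) : ∃ c : ℝ, 0 < c ∧
    ∀ k : Fin d → ℤ, ∫ y : EuclideanSpace ℝ (Fin d), |dot k y.ofLp| ^ α * tent y =
      c * intNorm k ^ α := by
  set e : EuclideanSpace ℝ (Fin d) := EuclideanSpace.single ⟨0, hd⟩ 1 with he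
  have hcont : Continuous fun y : EuclideanSpace ℝ (Fin d) => |inner ℝ e y| ^ α :=
    (Continuous.abs (by fun_prop)).rpow_const fun _ => Or.inr hα.le
  have hne : ‖e‖ = 1 := by simp [he]
  refine ⟨∫ y, |inner ℝ e y| ^ α * tent y, ?_, fun k => ?_⟩
  · refine (hcont.mul continuous_tent).integral_pos_of_hasCompactSupport_nonneg_nonzero
      hasCompactSupport_tent.mul_left (fun y => mul_nonneg (by positivity) (tent_nonneg y))
      (x := (1 / 2 : ℝ) • e) ?_
    have h2 : inner ℝ e ((1 / 2 : ℝ) • e) = 1 / 2 := by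
      rw [inner_smul_right, real_inner_self_eq_norm_sq, hne]; norm_num
    have h3 : tent ((1 / 2 : ℝ) • e) = 1 / 2 := by
      rw [tent, norm_smul, hne]; norm_num
    simp only [h2, h3]
    positivity
  · have h1 : ‖intVec k‖ = ‖intNorm k • e‖ := by
      rw [norm_smul, hne, mul_one, norm_intVec, Real.norm_of_nonneg (intNorm_nonneg k)]
    have h2 := integral_inner_tent_congr h1 fun r => |r| ^ α
    simp only [inner_intVec, inner_smul_left] at h2
    rw [h2, mul_comm, ← integral_const_mul]
    refine integral_congr_ae (Filter.Eventually.of_forall fun y => ?_)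
    simp only [abs_mul]
    rw [Real.mul_rpow (abs_nonneg _) (abs_nonneg _)]
    simp [abs_of_nonneg (intNorm_nonneg k), mul_assoc]

/-- Bernstein's inequality for the fractional Laplacian. -/
lemma exists_isMult_rpow_intNorm (hd : 0 < d) (hK : RieszBound d p K) (hα : 0 < α) :
    ∃ C : ℝ, 0 ≤ C ∧ ∀ (N : ℝ) (s : Finset (Fin d → ℤ)), 0 ≤ N → (∀ k ∈ s, intNorm k ≤ N) →
      IsMult (charLp p) s (fun k => ((intNorm k ^ α : ℝ) : ℂ)) (C * N ^ α) := by
  obtain ⟨c, hc, h⟩ := exists_integral_abs_dot_rpow hd hα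
  have hK0 : 0 ≤ K := by linarith [hK.1]
  have hT := integral_tent_pos (d := d)
  refine ⟨c⁻¹ * ((1 + K) * ∫ y : EuclideanSpace ℝ (Fin d), tent y), by positivity,
    fun N s hN hs => ?_⟩
  have := IsMult.integral (e := charLp p) (s := s) (ν := volume)
    (m := fun k => ((c * intNorm k ^ α : ℝ) : ℂ))
    (M := fun (y : EuclideanSpace ℝ (Fin d)) k => ((|dot k y.ofLp| ^ α * tent y : ℝ) : ℂ))
    (A := fun y => tent y * (N ^ α + N ^ α * K)) ?_ ?_ (integrable_tent.mul_const _) ?_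
  · have h2 := this.const_mul ((c⁻¹ : ℝ) : ℂ)
    rw [Complex.norm_real, Real.norm_of_nonneg (by positivity)] at h2
    refine (h2.mono (le_of_eq ?_)).congr fun k _ => ?_
    · rw [integral_mul_const]; ring
    · rw [← Complex.ofReal_mul]
      congr 1
      field_simp
  · intro k _
    refine (integrable_mul_tent ?_).ofReal
    exact ((continuous_dot k).comp (PiLp.continuous_ofLp 2 _)).abs.rpow_const
      fun _ => Or.inr hα.le
  · intro k _
    rw [integral_complex_ofReal, h]
  · refine Filter.Eventually.of_forall fun y => ?_
    rcases le_total 1 ‖y‖ with hy | hy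
    · simp only [tent_eq_zero hy, mul_zero, zero_mul]
      simpa using isMult_const (e := charLp p) (s := s) 0
    · have h1 := isMult_of_monotone (e := charLp p) (s := s) (w := fun k => |dot k y.ofLp|)
        (K := K) (B := N ^ α) (μ := fun k => |dot k y.ofLp| ^ α) (by positivity)
        (hK.2 s y.ofLp).2 (fun k _ => by positivity) (fun k hk => ?_)
        (fun k _ l _ h => Real.rpow_le_rpow (abs_nonneg _) h hα.le)
      · have h2 := h1.const_mul ((tent y : ℝ) : ℂ)
        rw [Complex.norm_real, Real.norm_of_nonneg (tent_nonneg y)] at h2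
        exact h2.congr fun k _ => by push_cast; ring
      · refine Real.rpow_le_rpow (abs_nonneg _) ((abs_dot_le k y.ofLp).trans ?_) hα.le
        rw [euclNorm_ofLp]
        exact (mul_le_of_le_one_right (intNorm_nonneg k) hy).trans (hs k hk)

end RieszMultipliers

section Binomial

variable {α : ℝ}

lemma gBinom_eq_choose (α : ℝ) (n : ℕ) : gBinom α n = Ring.choose α n := by
  induction n with
  | zero => simp [gBinom]
  | succ n ih =>
    have h := Ring.choose_smul_choose α (Nat.le_succ n)
    have h1 : n.succ - n = 1 := by omega
    rw [h1, Ring.choose_one_right, Nat.choose_succ_self_right, nsmul_eq_mul] at h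
    rw [gBinom, ih, ← h]
    push_cast
    field_simp

lemma abs_gBinom_succ {n : ℕ} (hn : α ≤ n) :
    α * |gBinom α n| = n * |gBinom α n| - (n + 1) * |gBinom α (n + 1)| := by
  have : |gBinom α (n + 1)| = |gBinom α n| * (n - α) / (n + 1) := by
    rw [gBinom, abs_div, abs_mul, abs_of_nonpos (by linarith : α - n ≤ 0),
      abs_of_pos (by positivity : (0 : ℝ) < n + 1)]
    ring
  rw [this]
  field_simp
  ring

lemma summable_abs_gBinom (hα : 0 < α) : Summable fun n => |gBinom α n| := by
  obtain ⟨N, hN⟩ := exists_nat_ge α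
  rw [← summable_nat_add_iff N]
  have key : ∀ m : ℕ, ∑ n ∈ Finset.range m, α * |gBinom α (n + N)| =
      N * |gBinom α N| - (m + N : ℕ) * |gBinom α (m + N)| := by
    intro m
    induction m with
    | zero => simp
    | succ m ih =>
      rw [Finset.sum_range_succ, ih, abs_gBinom_succ (n := m + N)]
      · rw [show m + 1 + N = m + N + 1 by ring]
        push_cast
        ring
      · push_cast
        have : (0 : ℝ) ≤ m := by positivity
        linarith
  refine summable_of_sum_range_le (c := N * |gBinom α N| / α) (fun _ => abs_nonneg _) fun m => ?_
  rw [le_div_iff₀ hα, mul_comm, Finset.mul_sum, key]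
  have : (0 : ℝ) ≤ (m + N : ℕ) * |gBinom α (m + N)| := by positivity
  linarith

/-- The total mass `∑ |binom(α,ν)|` of the fractional difference. -/
noncomputable def binomMass (α : ℝ) : ℝ := ∑' n, |gBinom α n|

lemma binomMass_nonneg : 0 ≤ binomMass α := tsum_nonneg fun _ => abs_nonneg _

lemma norm_signed_gBinom (n : ℕ) : ‖(((-1) ^ n * gBinom α n : ℝ) : ℂ)‖ = |gBinom α n| := by
  rw [Complex.norm_real, Real.norm_eq_abs, abs_mul, abs_pow, abs_neg, abs_one, one_pow, one_mul]

lemma summable_gBinom_mul (hα : 0 < α) {z : ℕ → ℂ} (hz : ∀ n, ‖z n‖ ≤ 1) :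
    Summable fun n => (((-1) ^ n * gBinom α n : ℝ) : ℂ) * z n := by
  refine Summable.of_norm_bounded (summable_abs_gBinom hα) fun n => ?_
  rw [norm_mul, norm_signed_gBinom]
  exact mul_le_of_le_one_right (abs_nonneg _) (hz n)

lemma tsum_gBinom_of_lt {z : ℂ} (hz : ‖z‖ < 1) :
    ∑' n, (((-1) ^ n * gBinom α n : ℝ) : ℂ) * z ^ n = (1 - z) ^ (α : ℂ) := by
  have h := (Complex.one_add_cpow_hasFPowerSeriesOnBall_zero (a := (α : ℂ))).hasSum
    (y := -z) (by simpa [enorm_eq_nnnorm, ← NNReal.coe_lt_one] using hz)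
  simp only [binomialSeries_apply, zero_add, List.ofFn_const, List.prod_replicate, smul_eq_mul]
    at h
  rw [sub_eq_add_neg, ← h.tsum_eq]
  refine tsum_congr fun n => ?_
  rw [gBinom_eq_choose, ← Complex.ofReal_choose, neg_pow z]
  push_cast
  ring

lemma continuousAt_one_sub_cpow (hα : 0 < α) {z : ℂ} (hz : ‖z‖ ≤ 1) :
    ContinuousAt (fun z : ℂ => (1 - z) ^ (α : ℂ)) z := by
  have h1 : ContinuousAt (fun z : ℂ => 1 - z) z := by fun_prop
  by_cases h : z = 1
  · have := Complex.continuousAt_cpow_const_of_re_pos (z := (1 - z)) (w := (α : ℂ))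
      (by simp [h]) (by simpa using hα)
    exact ContinuousAt.comp (f := fun z : ℂ => 1 - z) (g := fun w : ℂ => w ^ (α : ℂ)) this h1
  · have hs : (1 - z) ∈ Complex.slitPlane := by
      rw [Complex.mem_slitPlane_iff]
      by_contra hcon
      push Not at hcon
      simp only [Complex.sub_re, Complex.one_re, Complex.sub_im, Complex.one_im] at hcon
      have hre : z.re ≤ 1 := (Complex.re_le_norm z).trans hz
      exact h (Complex.ext (by simpa using le_antisymm hre (by linarith [hcon.1]))
        (by simpa using hcon.2))
    exact ContinuousAt.comp (f := fun z : ℂ => 1 - z) (g := fun w : ℂ => w ^ (α : ℂ))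
      (continuousAt_cpow_const hs) h1

lemma tsum_gBinom (hα : 0 < α) {z : ℂ} (hz : ‖z‖ ≤ 1) :
    ∑' n, (((-1) ^ n * gBinom α n : ℝ) : ℂ) * z ^ n = (1 - z) ^ (α : ℂ) := by
  have hc : ContinuousOn (fun z : ℂ => ∑' n, (((-1) ^ n * gBinom α n : ℝ) : ℂ) * z ^ n)
      (Metric.closedBall 0 1) := by
    refine continuousOn_tsum (fun n => by fun_prop) (summable_abs_gBinom hα) fun n w hw => ?_
    rw [norm_mul, norm_signed_gBinom, norm_pow]
    exact mul_le_of_le_one_right (abs_nonneg _)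
      (pow_le_one₀ (norm_nonneg _) (by simpa using hw))
  have hd : ContinuousOn (fun z : ℂ => (1 - z) ^ (α : ℂ)) (Metric.closedBall 0 1) := fun w hw =>
    (continuousAt_one_sub_cpow hα (by simpa using hw)).continuousWithinAt
  have hball : Set.EqOn (fun z : ℂ => ∑' n, (((-1) ^ n * gBinom α n : ℝ) : ℂ) * z ^ n)
      (fun z : ℂ => (1 - z) ^ (α : ℂ)) (Metric.ball 0 1) := fun w hw =>
    tsum_gBinom_of_lt (by simpa using hw)
  have hcl : Metric.closedBall (0 : ℂ) 1 ⊆ closure (Metric.ball 0 1) := by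
    rw [closure_ball _ one_ne_zero]
  exact hball.of_subset_closure hc hd Metric.ball_subset_closedBall hcl (by simpa using hz)

/-- The Fourier symbol of the fractional difference, as a function of `⟨k,h⟩`. -/
noncomputable def diffSymbol (α t : ℝ) : ℂ :=
  ∑' n : ℕ, (((-1) ^ n * gBinom α n : ℝ) : ℂ) * Complex.exp (Complex.I * ((α - n) * t : ℝ))

lemma diffSymbol_eq_cpow (hα : 0 < α) (t : ℝ) :
    diffSymbol α t = Complex.exp (Complex.I * (α * t : ℝ)) *
      (1 - Complex.exp (-(Complex.I * t))) ^ (α : ℂ) := by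
  have hz : ‖Complex.exp (-(Complex.I * t))‖ ≤ 1 := by
    rw [show -(Complex.I * (t : ℂ)) = ((-t : ℝ) : ℂ) * Complex.I by push_cast; ring,
      Complex.norm_exp_ofReal_mul_I]
  rw [← tsum_gBinom hα hz, ← tsum_mul_left, diffSymbol]
  refine tsum_congr fun n => ?_
  rw [← Complex.exp_nat_mul, mul_left_comm, ← Complex.exp_add]
  congr 2
  push_cast
  ring

/-- The constant unimodular factor of the symbol on each side of the origin. -/
noncomputable def signPhase (β t : ℝ) : ℂ :=
  (Real.cos β : ℂ) + (Real.sin β : ℂ) * Complex.I * (Real.sign t : ℂ)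

lemma signPhase_eq_exp {β t : ℝ} (ht : t ≠ 0) :
    signPhase β t = Complex.exp (Complex.I * (Real.sign t * β : ℝ)) := by
  rw [signPhase, mul_comm Complex.I, Complex.exp_mul_I]
  rcases lt_or_gt_of_ne ht with h | h
  · rw [Real.sign_of_neg h]
    simp
  · rw [Real.sign_of_pos h]
    simp

lemma signPhase_mul_neg {β t : ℝ} (ht : t ≠ 0) : signPhase β t * signPhase (-β) t = 1 := by
  rw [signPhase_eq_exp ht, signPhase_eq_exp ht, ← Complex.exp_add, ← Complex.exp_zero]
  congr 1
  push_cast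
  ring

lemma diffSymbol_eq_phase (hα : 0 < α) {t : ℝ} (ht : |t| ≤ 2) :
    diffSymbol α t = Complex.exp (Complex.I * (α * t / 2 : ℝ)) *
      signPhase (Real.pi * α / 2) t * (((2 * Real.sin (|t| / 2)) ^ α : ℝ) : ℂ) := by
  rw [diffSymbol_eq_cpow hα]
  rcases eq_or_ne t 0 with rfl | h0
  · simp [Real.zero_rpow hα.ne', Complex.zero_cpow (Complex.ofReal_ne_zero.2 hα.ne')]
  have h0' : 0 < |t| := abs_pos.2 h0
  have hpi := Real.pi_gt_three
  have hs : 0 < 2 * Real.sin (|t| / 2) :=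
    mul_pos two_pos (Real.sin_pos_of_pos_of_lt_pi (by linarith) (by linarith))
  set r := 2 * Real.sin (|t| / 2) with hr
  set φ := Real.sign t * (Real.pi / 2) - t / 2 with hφ
  have hsgn : Real.sign t = 1 ∨ Real.sign t = -1 := by
    rcases lt_or_gt_of_ne h0 with h | h
    · exact Or.inr (Real.sign_of_neg h)
    · exact Or.inl (Real.sign_of_pos h)
  have hb := abs_le.1 ht
  have hrt : r = Real.sign t * (2 * Real.sin (t / 2)) := by
    rcases lt_or_gt_of_ne h0 with h | h
    · rw [hr, Real.sign_of_neg h, abs_of_neg h, neg_div, Real.sin_neg]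
      ring
    · rw [hr, Real.sign_of_pos h, abs_of_pos h, one_mul]
  have h1 : 1 - Complex.exp (-(Complex.I * t)) = Complex.exp ((Real.log r : ℂ) + φ * Complex.I) := by
    rw [Complex.exp_add, ← Complex.ofReal_exp, Real.exp_log hs, Complex.exp_mul_I,
      ← Complex.ofReal_cos, ← Complex.ofReal_sin,
      show -(Complex.I * (t : ℂ)) = ((-t : ℝ) : ℂ) * Complex.I by push_cast; ring,
      Complex.exp_mul_I, ← Complex.ofReal_cos, ← Complex.ofReal_sin, Real.cos_neg, Real.sin_neg]
    have e1 : Real.cos t = 1 - 2 * Real.sin (t / 2) ^ 2 := by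
      have := Real.cos_sq' (t / 2)
      rw [show t = 2 * (t / 2) by ring, Real.cos_two_mul, this]
      rw [show 2 * (t / 2) / 2 = t / 2 by ring]
      ring
    have e2 : Real.sin t = 2 * Real.sin (t / 2) * Real.cos (t / 2) := by
      rw [← Real.sin_two_mul]
      congr 1
      ring
    rw [e1, e2, hφ, hrt]
    rcases hsgn with h | h <;> rw [h]
    · rw [one_mul, one_mul, Real.cos_pi_div_two_sub, Real.sin_pi_div_two_sub]
      push_cast
      ring
    · rw [show (-1 : ℝ) * (Real.pi / 2) - t / 2 = -(Real.pi / 2 + t / 2) by ring, Real.cos_neg,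
        Real.sin_neg, add_comm (Real.pi / 2), Real.cos_add_pi_div_two, Real.sin_add_pi_div_two]
      push_cast
      ring
  have him : ((Real.log r : ℂ) + φ * Complex.I).im = φ := by simp
  rw [h1, Complex.cpow_def_of_ne_zero (Complex.exp_ne_zero _), Complex.log_exp, signPhase_eq_exp h0,
    Real.rpow_def_of_pos hs, Complex.ofReal_exp, ← Complex.exp_add, ← Complex.exp_add,
    ← Complex.exp_add]
  · congr 1
    rw [hφ]
    push_cast
    ring
  · rw [him, hφ]
    rcases hsgn with h | h <;> rw [h] <;> linarith
  · rw [him, hφ]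
    rcases hsgn with h | h <;> rw [h] <;> linarith

lemma sinc_antitoneOn {x y : ℝ} (hx : 0 ≤ x) (hxy : x ≤ y) (hy : y ≤ Real.pi) :
    Real.sinc y ≤ Real.sinc x := by
  rcases hx.eq_or_lt with rfl | hx
  · simpa using Real.sinc_le_one y
  have hy0 := hx.trans_le hxy
  rw [Real.sinc_of_ne_zero hx.ne', Real.sinc_of_ne_zero hy0.ne', div_le_div_iff₀ hy0 hx]
  have hc := strictConcaveOn_sin_Icc.concaveOn.2 (Set.left_mem_Icc.2 Real.pi_pos.le)
    (Set.mem_Icc.2 ⟨hy0.le, hy⟩) (sub_nonneg.2 ((div_le_one hy0).2 hxy)) (by positivity : 0 ≤ x / y) (by ring)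
  simp only [smul_eq_mul, mul_zero, Real.sin_zero, zero_add] at hc
  rw [div_mul_cancel₀ _ hy0.ne', div_mul_eq_mul_div, div_le_iff₀ hy0] at hc
  linarith

lemma two_sin_eq_sinc (u : ℝ) : 2 * Real.sin (u / 2) = u * Real.sinc (u / 2) := by
  rcases eq_or_ne u 0 with rfl | h
  · simp
  · rw [Real.sinc_of_ne_zero (by simpa using h)]
    field_simp

lemma sinc_pos_of_le_one {x : ℝ} (hx : 0 ≤ x) (hx1 : x ≤ 1) : 0 < Real.sinc x := by
  rcases hx.eq_or_lt with rfl | hx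
  · simp
  · rw [Real.sinc_of_ne_zero hx.ne']
    exact div_pos (Real.sin_pos_of_pos_of_lt_pi hx (by linarith [Real.pi_gt_three])) hx

end Binomial

section Symbol

variable {d : ℕ} {p K α : ℝ} [Fact (1 ≤ ENNReal.ofReal p)]

lemma isMult_signPhase (hK : RieszBound d p K) (β : ℝ) (s : Finset (Fin d → ℤ)) (h : Fin d → ℝ) :
    IsMult (charLp p) s (fun k => signPhase β (dot k h)) (1 + K) := by
  have h1 := (isMult_const (e := charLp (d := d) p) (s := s) (Real.cos β : ℂ)).add
    (((hK.2 s h).1).const_mul ((Real.sin β : ℂ) * Complex.I))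
  refine h1.mono ?_
  have hK0 : 0 ≤ K := by linarith [hK.1]
  rw [norm_mul, Complex.norm_I, Complex.norm_real, Complex.norm_real, mul_one, Real.norm_eq_abs,
    Real.norm_eq_abs]
  exact add_le_add (Real.abs_cos_le_one β) (mul_le_of_le_one_left hK0 (Real.abs_sin_le_one β))

lemma isMult_shift_mul (hp : 0 < p) (s : Finset (Fin d → ℤ)) (h : Fin d → ℝ) (a : ℝ) :
    IsMult (charLp p) s (fun k => Complex.exp (Complex.I * (a * dot k h : ℝ))) 1 :=
  (isMult_shift hp s (a • h)).congr fun k _ => by rw [dot_smul_right]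

lemma isMult_sinc_rpow (hK : RieszBound d p K) (hα : 0 < α) (s : Finset (Fin d → ℤ))
    (h : Fin d → ℝ) (hs : ∀ k ∈ s, |dot k h| ≤ 2) :
    IsMult (charLp p) s (fun k => ((Real.sinc (|dot k h| / 2) ^ α : ℝ) : ℂ)) (1 * K) := by
  have hpi := Real.pi_gt_three
  have h0 : ∀ k ∈ s, 0 ≤ Real.sinc (|dot k h| / 2) := fun k hk =>
    (sinc_pos_of_le_one (by positivity) (by linarith [hs k hk])).le
  refine isMult_of_antitone (w := fun k => |dot k h|) zero_le_one (hK.2 s h).2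
    (fun k hk => Real.rpow_nonneg (h0 k hk) _)
    (fun k hk => Real.rpow_le_one (h0 k hk) (Real.sinc_le_one _) hα.le)
    fun k hk l hl hkl => Real.rpow_le_rpow (h0 l hl) ?_ hα.le
  exact sinc_antitoneOn (by positivity) (by linarith) (by linarith [hs l hl])

lemma isMult_sinc_rpow_neg (hK : RieszBound d p K) (hα : 0 < α) (s : Finset (Fin d → ℤ))
    (h : Fin d → ℝ) (hs : ∀ k ∈ s, |dot k h| ≤ 2) :
    IsMult (charLp p) s (fun k => ((Real.sinc (|dot k h| / 2) ^ (-α) : ℝ) : ℂ))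
      (Real.sinc 1 ^ (-α) + Real.sinc 1 ^ (-α) * K) := by
  have hpi := Real.pi_gt_three
  have h1 : 0 < Real.sinc 1 := sinc_pos_of_le_one zero_le_one le_rfl
  have h0 : ∀ k ∈ s, 0 < Real.sinc (|dot k h| / 2) := fun k hk =>
    sinc_pos_of_le_one (by positivity) (by linarith [hs k hk])
  refine isMult_of_monotone (w := fun k => |dot k h|) (by positivity) (hK.2 s h).2
    (fun k hk => Real.rpow_nonneg (h0 k hk).le _)
    (fun k hk => Real.rpow_le_rpow_of_nonpos h1 ?_ (by linarith))
    fun k hk l hl hkl => Real.rpow_le_rpow_of_nonpos (h0 l hl) ?_ (by linarith)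
  · exact sinc_antitoneOn (by positivity) (by linarith [hs k hk]) (by linarith)
  · exact sinc_antitoneOn (by positivity) (by linarith) (by linarith [hs l hl])

lemma diffSymbol_eq_sinc (hα : 0 < α) {t : ℝ} (ht : |t| ≤ 2) :
    diffSymbol α t = Complex.exp (Complex.I * (α / 2 * t : ℝ)) *
      signPhase (Real.pi * α / 2) t * ((Real.sinc (|t| / 2) ^ α : ℝ) : ℂ) * ((|t| ^ α : ℝ) : ℂ) := by
  rw [diffSymbol_eq_phase hα ht, two_sin_eq_sinc, Real.mul_rpow (abs_nonneg _)
    (sinc_pos_of_le_one (by positivity) (by linarith)).le, mul_div_right_comm]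
  push_cast
  ring

/-- Fractional differences are dominated by the corresponding power of `⟨k,h⟩`, and conversely. -/
lemma exists_diffSymbol_comparable (hp : 0 < p) (hK : RieszBound d p K) (hα : 0 < α) :
    ∃ C : ℝ, 0 ≤ C ∧ ∀ (s : Finset (Fin d → ℤ)) (h : Fin d → ℝ), (∀ k ∈ s, |dot k h| ≤ 2) →
      ∀ c : (Fin d → ℤ) → ℂ,
        ‖comb (charLp p) s (fun k => diffSymbol α (dot k h) * c k)‖ ≤
          C * ‖comb (charLp p) s (fun k => ((|dot k h| ^ α : ℝ) : ℂ) * c k)‖ ∧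
        ‖comb (charLp p) s (fun k => ((|dot k h| ^ α : ℝ) : ℂ) * c k)‖ ≤
          C * ‖comb (charLp p) s (fun k => diffSymbol α (dot k h) * c k)‖ := by
  have hK0 : 0 ≤ K := by linarith [hK.1]
  have hc1 : 0 < Real.sinc 1 := sinc_pos_of_le_one zero_le_one le_rfl
  set A₁ := 1 * (1 + K) * (1 * K) with hA₁
  set A₂ := 1 * (1 + K) * (Real.sinc 1 ^ (-α) + Real.sinc 1 ^ (-α) * K) with hA₂
  refine ⟨max A₁ A₂, le_max_of_le_left (by positivity), fun s h hs c => ⟨?_, ?_⟩⟩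
  · have h1 := ((isMult_shift_mul hp s h (α / 2)).mul
      (isMult_signPhase hK (Real.pi * α / 2) s h) zero_le_one).mul
      (isMult_sinc_rpow hK hα s h hs) (by positivity)
    refine le_trans (le_of_eq ?_) ((h1.mono (le_max_left A₁ A₂)) _)
    refine congrArg norm (comb_congr fun k hk => ?_)
    rw [diffSymbol_eq_sinc hα (hs k hk)]
    ring
  · have h1 := ((isMult_shift_mul hp s h (-(α / 2))).mul
      (isMult_signPhase hK (-(Real.pi * α / 2)) s h) zero_le_one).mul
      (isMult_sinc_rpow_neg hK hα s h hs) (by positivity)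
    refine le_trans (le_of_eq ?_) ((h1.mono (le_max_right A₁ A₂)) _)
    refine congrArg norm (comb_congr fun k hk => ?_)
    rw [diffSymbol_eq_sinc hα (hs k hk)]
    rcases eq_or_ne (dot k h) 0 with h0 | h0
    · simp [h0, Real.zero_rpow hα.ne']
    have hsinc : 0 < Real.sinc (|dot k h| / 2) :=
      sinc_pos_of_le_one (by positivity) (by linarith [hs k hk])
    have e1 : Complex.exp (Complex.I * (-(α / 2) * dot k h : ℝ)) *
        Complex.exp (Complex.I * (α / 2 * dot k h : ℝ)) = 1 := by
      rw [← Complex.exp_add, ← Complex.exp_zero]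
      congr 1
      push_cast
      ring
    have e2 := signPhase_mul_neg (β := Real.pi * α / 2) h0
    have e3 : ((Real.sinc (|dot k h| / 2) ^ (-α) : ℝ) : ℂ) *
        ((Real.sinc (|dot k h| / 2) ^ α : ℝ) : ℂ) = 1 := by
      rw [← Complex.ofReal_mul, ← Real.rpow_add hsinc]
      simp
    linear_combination (-(((|dot k h| ^ α : ℝ) : ℂ) * c k)) *
      (e1 * (signPhase (Real.pi * α / 2) (dot k h) * signPhase (-(Real.pi * α / 2)) (dot k h)) *
        (((Real.sinc (|dot k h| / 2) ^ (-α) : ℝ) : ℂ) *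
        ((Real.sinc (|dot k h| / 2) ^ α : ℝ) : ℂ)) + e2 * (((Real.sinc (|dot k h| / 2) ^ (-α) : ℝ) : ℂ) *
        ((Real.sinc (|dot k h| / 2) ^ α : ℝ) : ℂ)) + e3)

/-- Fractional differences of band-limited sums are controlled by the fractional Laplacian. -/
lemma exists_norm_diffSymbol_le (hp : 0 < p) (hK : RieszBound d p K) (hα : 0 < α) :
    ∃ C : ℝ, 0 ≤ C ∧ ∀ (N : ℝ) (s : Finset (Fin d → ℤ)), 0 < N → (∀ k ∈ s, intNorm k ≤ 2 * N) →
      ∀ h : Fin d → ℝ, euclNorm h ≤ 1 / N → ∀ c : (Fin d → ℤ) → ℂ,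
        ‖comb (charLp p) s (fun k => diffSymbol α (dot k h) * c k)‖ ≤
          C * (N ^ (-α) * ‖comb (charLp p) s (fun k => ((intNorm k ^ α : ℝ) : ℂ) * c k)‖) := by
  obtain ⟨A, hA, hcomp⟩ := exists_diffSymbol_comparable hp hK hα
  obtain ⟨B, hB, hratio⟩ := exists_isMult_ratio hK hα
  refine ⟨A * B, by positivity, fun N s hN hs h hh c => ?_⟩
  have hh0 : 0 ≤ euclNorm h := Real.sqrt_nonneg _
  have hdot : ∀ k ∈ s, |dot k h| ≤ 2 := fun k hk => by
    refine (abs_dot_le k h).trans ((mul_le_mul (hs k hk) hh hh0 (by positivity)).trans ?_)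
    rw [mul_assoc, mul_one_div_cancel hN.ne', mul_one]
  refine ((hcomp s h hdot c).1).trans ?_
  rw [mul_assoc]
  refine mul_le_mul_of_nonneg_left ?_ hA
  rcases hh0.eq_or_lt with h0 | h0
  · have hz : comb (charLp p) s (fun k => ((|dot k h| ^ α : ℝ) : ℂ) * c k) = 0 := by
      refine Finset.sum_eq_zero fun k _ => ?_
      have : |dot k h| = 0 := le_antisymm (by simpa [← h0] using abs_dot_le k h) (abs_nonneg _)
      simp [this, Real.zero_rpow hα.ne']
    rw [hz, norm_zero]
    positivity
  set e : EuclideanSpace ℝ (Fin d) := (euclNorm h)⁻¹ • WithLp.toLp 2 h with he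
  have hne : ‖e‖ = 1 := by
    rw [he, norm_smul, norm_toLp_eq_euclNorm, norm_inv, Real.norm_of_nonneg hh0,
      inv_mul_cancel₀ h0.ne']
  have hdote : ∀ k : Fin d → ℤ, |dot k h| = euclNorm h * |dot k e.ofLp| := fun k => by
    rw [he, WithLp.ofLp_smul, dot_smul_right, abs_mul, abs_inv, abs_of_pos h0,
      mul_inv_cancel_left₀ h0.ne']
  have e1 : comb (charLp p) s (fun k => ((|dot k h| ^ α : ℝ) : ℂ) * c k) =
      ((euclNorm h ^ α : ℝ) : ℂ) • comb (charLp p) s (fun k =>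
        (((|dot k e.ofLp| / intNorm k) ^ α : ℝ) : ℂ) * (((intNorm k ^ α : ℝ) : ℂ) * c k)) := by
    rw [← comb_smul]
    refine comb_congr fun k _ => ?_
    have : |dot k h| ^ α =
        euclNorm h ^ α * ((|dot k e.ofLp| / intNorm k) ^ α * intNorm k ^ α) := by
      rcases (intNorm_nonneg k).eq_or_lt with hk | hk
      · have : |dot k h| = 0 := le_antisymm (by simpa [← hk] using abs_dot_le k h) (abs_nonneg _)
        rw [this, ← hk, Real.zero_rpow hα.ne', mul_zero, mul_zero]
      · rw [hdote, Real.mul_rpow hh0 (abs_nonneg _), ← Real.mul_rpow (by positivity) hk.le,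
          div_mul_cancel₀ _ hk.ne']
    rw [this]
    push_cast
    ring
  rw [e1, norm_smul, Complex.norm_real, Real.norm_of_nonneg (by positivity)]
  have h3 : euclNorm h ^ α ≤ N ^ (-α) := by
    rw [Real.rpow_neg hN.le, ← Real.inv_rpow hN.le, ← one_div]
    exact Real.rpow_le_rpow hh0 hh hα.le
  calc _ ≤ N ^ (-α) * (B * _) :=
        mul_le_mul h3 (hratio s e hne _) (norm_nonneg _) (by positivity)
    _ = _ := by ring

/-- The fractional Laplacian of a band-limited sum is controlled by its fractional differences. -/
lemma exists_norm_rpow_intNorm_le (hd : 0 < d) (hp : 0 < p) (hK : RieszBound d p K) (hα : 0 < α) :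
    ∃ C : ℝ, 0 ≤ C ∧ ∀ (N : ℝ) (s : Finset (Fin d → ℤ)), 0 < N → (∀ k ∈ s, intNorm k ≤ N) →
      ∀ (c : (Fin d → ℤ) → ℂ) (W : ℝ), (∀ h : Fin d → ℝ, euclNorm h ≤ 1 / N →
        ‖comb (charLp p) s (fun k => diffSymbol α (dot k h) * c k)‖ ≤ W) →
      N ^ (-α) * ‖comb (charLp p) s (fun k => ((intNorm k ^ α : ℝ) : ℂ) * c k)‖ ≤ C * W := by
  obtain ⟨A, hA, hcomp⟩ := exists_diffSymbol_comparable hp hK hα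
  obtain ⟨a, ha, hint⟩ := exists_integral_abs_dot_rpow hd hα
  have hT := integral_tent_pos (d := d)
  refine ⟨a⁻¹ * (A * ∫ y : EuclideanSpace ℝ (Fin d), tent y), by positivity,
    fun N s hN hs c W hW => ?_⟩
  have hdot : ∀ (k : Fin d → ℤ) (y : EuclideanSpace ℝ (Fin d)),
      |dot k (N⁻¹ • y.ofLp)| ^ α = N ^ (-α) * |dot k y.ofLp| ^ α := fun k y => by
    rw [dot_smul_right, abs_mul, Real.mul_rpow (abs_nonneg _) (abs_nonneg _),
      abs_of_pos (inv_pos.2 hN), Real.inv_rpow hN.le, Real.rpow_neg hN.le]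
  have hcont : ∀ k : Fin d → ℤ, Continuous fun y : EuclideanSpace ℝ (Fin d) =>
      |dot k (N⁻¹ • y.ofLp)| ^ α := fun k => by
    refine Continuous.rpow_const (Continuous.abs ((continuous_dot k).comp ?_))
      fun _ => Or.inr hα.le
    fun_prop
  have h1 := norm_comb_integral_le (e := charLp (d := d) p) (s := s) (c := c)
    (ν := (volume : Measure (EuclideanSpace ℝ (Fin d))))
    (m := fun k => ((N ^ (-α) * (a * intNorm k ^ α) : ℝ) : ℂ))
    (M := fun y k => ((|dot k (N⁻¹ • y.ofLp)| ^ α * tent y : ℝ) : ℂ))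
    (B := fun y => A * W * tent y) (fun k _ => (integrable_mul_tent (hcont k)).ofReal) ?_
    (integrable_tent.const_mul _) (Filter.Eventually.of_forall fun y => ?_)
  · have h2 : comb (charLp p) s (fun k => ((N ^ (-α) * (a * intNorm k ^ α) : ℝ) : ℂ) * c k) =
        ((N ^ (-α) * a : ℝ) : ℂ) • comb (charLp p) s (fun k => ((intNorm k ^ α : ℝ) : ℂ) * c k) := by
      rw [← comb_smul]
      refine comb_congr fun k _ => ?_
      push_cast
      ring
    rw [h2, norm_smul, Complex.norm_real, Real.norm_of_nonneg (by positivity),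
      integral_const_mul] at h1
    calc _ = a⁻¹ * (N ^ (-α) * a * ‖comb (charLp p) s
          (fun k => ((intNorm k ^ α : ℝ) : ℂ) * c k)‖) := by field_simp
      _ ≤ a⁻¹ * (A * W * ∫ y : EuclideanSpace ℝ (Fin d), tent y) :=
          mul_le_mul_of_nonneg_left h1 (inv_nonneg.2 ha.le)
      _ = _ := by ring
  · intro k _
    rw [← hint k, ← integral_const_mul]
    refine Eq.trans (congrArg _ (integral_congr_ae (Filter.Eventually.of_forall fun y => ?_)))
      integral_ofReal.symm
    change _ = |dot k (N⁻¹ • y.ofLp)| ^ α * tent y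
    rw [hdot, mul_assoc]
  · rcases le_or_gt 1 ‖y‖ with hy | hy
    · simp [tent_eq_zero hy, comb]
    have hle : euclNorm (N⁻¹ • y.ofLp) ≤ 1 / N := by
      rw [← WithLp.ofLp_smul, euclNorm_ofLp, norm_smul, Real.norm_of_nonneg (by positivity),
        one_div]
      exact mul_le_of_le_one_right (by positivity) hy.le
    have hd2 : ∀ k ∈ s, |dot k (N⁻¹ • y.ofLp)| ≤ 2 := fun k hk => by
      refine (abs_dot_le k _).trans
        ((mul_le_mul (hs k hk) hle (Real.sqrt_nonneg _) hN.le).trans ?_)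
      rw [mul_one_div_cancel hN.ne']
      norm_num
    have h2 : comb (charLp p) s
        (fun k => ((|dot k (N⁻¹ • y.ofLp)| ^ α * tent y : ℝ) : ℂ) * c k) =
        (tent y : ℂ) • comb (charLp p) s (fun k => ((|dot k (N⁻¹ • y.ofLp)| ^ α : ℝ) : ℂ) * c k) := by
      rw [← comb_smul]
      refine comb_congr fun k _ => ?_
      push_cast
      ring
    rw [h2, norm_smul, Complex.norm_real, Real.norm_of_nonneg (tent_nonneg y), mul_comm]
    exact mul_le_mul_of_nonneg_right (((hcomp s _ hd2 c).2).trans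
      (mul_le_mul_of_nonneg_left (hW _ hle) hA)) (tent_nonneg y)

end Symbol

section SineMoments

/-- The exponential moments `∫₀^∞ e^{-t} sin(vt)^{2q} dt` in closed form. -/
noncomputable def sineMoment : ℕ → ℝ → ℝ
  | 0, _ => 1
  | q + 1, v => (2 * q + 2) * (2 * q + 1) * v ^ 2 / (1 + (2 * q + 2) ^ 2 * v ^ 2) * sineMoment q v

lemma sineMoment_nonneg (q : ℕ) (v : ℝ) : 0 ≤ sineMoment q v := by
  induction q with
  | zero => exact zero_le_one
  | succ q ih => exact mul_nonneg (by positivity) ih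

lemma sineMoment_pos (q : ℕ) {v : ℝ} (hv : 0 < v) : 0 < sineMoment q v := by
  induction q with
  | zero => exact zero_lt_one
  | succ q ih => exact mul_pos (by positivity) ih

lemma sineMoment_abs (q : ℕ) (v : ℝ) : sineMoment q |v| = sineMoment q v := by
  induction q with
  | zero => rfl
  | succ q ih => rw [sineMoment, sineMoment, ih, sq_abs]

lemma sineMoment_mono (q : ℕ) {u v : ℝ} (hu : 0 ≤ u) (huv : u ≤ v) :
    sineMoment q u ≤ sineMoment q v := by
  induction q with
  | zero => exact le_rfl
  | succ q ih =>
    refine mul_le_mul ?_ ih (sineMoment_nonneg q u) (by positivity)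
    rw [div_le_div_iff₀ (by positivity) (by positivity)]
    have h2 : u ^ 2 ≤ v ^ 2 := pow_le_pow_left₀ hu huv 2
    have h3 : (0 : ℝ) ≤ (2 * q + 2) * (2 * q + 1) := by positivity
    nlinarith [mul_le_mul_of_nonneg_left h2 h3]

lemma abs_sin_pow_mul_le (n m : ℕ) (x : ℝ) : |Real.sin x ^ n * Real.cos x ^ m| ≤ 1 := by
  rw [abs_mul, abs_pow, abs_pow]
  exact mul_le_one₀ (pow_le_one₀ (abs_nonneg _) (Real.abs_sin_le_one x)) (by positivity)
    (pow_le_one₀ (abs_nonneg _) (Real.abs_cos_le_one x))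

lemma integrableOn_exp_neg_mul_sin (n : ℕ) (v : ℝ) :
    IntegrableOn (fun t => Real.exp (-t) * Real.sin (v * t) ^ n) (Set.Ioi 0) := by
  refine (integrableOn_exp_neg_Ioi 0).mono' (by fun_prop)
    (Filter.Eventually.of_forall fun t => ?_)
  rw [norm_mul, Real.norm_of_nonneg (Real.exp_pos _).le, Real.norm_eq_abs]
  refine mul_le_of_le_one_right (Real.exp_pos _).le ?_
  simpa using abs_sin_pow_mul_le n 0 (v * t)

lemma integral_exp_neg_mul_sin (q : ℕ) (v : ℝ) :
    ∫ t in Set.Ioi (0 : ℝ), Real.exp (-t) * Real.sin (v * t) ^ (2 * q) = sineMoment q v := by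
  induction q with
  | zero => simpa [sineMoment] using integral_exp_neg_Ioi_zero
  | succ q ih =>
    set n : ℝ := 2 * q + 2 with hn
    set F : ℝ → ℝ := fun t => -(Real.exp (-t) * (Real.sin (v * t) ^ (2 * q + 2) +
      n * v * (Real.sin (v * t) ^ (2 * q + 1) * Real.cos (v * t)))) with hF
    set G : ℝ → ℝ := fun t => (1 + n ^ 2 * v ^ 2) * (Real.exp (-t) * Real.sin (v * t) ^ (2 * (q + 1)))
      - n * (n - 1) * v ^ 2 * (Real.exp (-t) * Real.sin (v * t) ^ (2 * q)) with hG
    have hderiv : ∀ t ∈ Set.Ioi (0 : ℝ), HasDerivAt F (G t) t := fun t _ => by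
      have h1 : HasDerivAt (fun t => Real.exp (-t)) (-Real.exp (-t)) t := by
        simpa using (hasDerivAt_neg t).exp
      have hvt : HasDerivAt (fun t => v * t) v t := by simpa using (hasDerivAt_id t).const_mul v
      have hs := hvt.sin
      have hc := hvt.cos
      have := (h1.mul ((hs.pow (2 * q + 2)).add (((hs.pow (2 * q + 1)).mul hc).const_mul (n * v)))).neg
      refine this.congr_deriv ?_
      have e1 : Real.cos (v * t) ^ 2 = 1 - Real.sin (v * t) ^ 2 := Real.cos_sq' _
      simp only [hG, Pi.add_apply, Pi.pow_apply, Pi.mul_apply]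
      rw [show 2 * q + 2 - 1 = 2 * q + 1 by omega, show 2 * q + 1 - 1 = 2 * q by omega]
      push_cast
      linear_combination (-Real.exp (-t) * n * v ^ 2 * (2 * q + 1) * Real.sin (v * t) ^ (2 * q)) * e1
    have hGint : IntegrableOn G (Set.Ioi 0) :=
      ((integrableOn_exp_neg_mul_sin _ v).const_mul _).sub
        ((integrableOn_exp_neg_mul_sin _ v).const_mul _)
    have hlim : Filter.Tendsto F Filter.atTop (nhds 0) := by
      refine squeeze_zero_norm (a := fun t => Real.exp (-t) * (1 + |n * v|)) (fun t => ?_) ?_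
      · simp only [hF, norm_neg, norm_mul, Real.norm_of_nonneg (Real.exp_pos _).le]
        refine mul_le_mul_of_nonneg_left ((norm_add_le _ _).trans (add_le_add ?_ ?_))
          (Real.exp_pos _).le
        · simpa using abs_sin_pow_mul_le (2 * q + 2) 0 (v * t)
        · rw [norm_mul, Real.norm_eq_abs, Real.norm_eq_abs]
          refine mul_le_of_le_one_right (abs_nonneg _) ?_
          simpa using abs_sin_pow_mul_le (2 * q + 1) 1 (v * t)
      · simpa using Real.tendsto_exp_neg_atTop_nhds_zero.mul_const (1 + |n * v|)
    have hcontF : Continuous F := by fun_prop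
    have key := integral_Ioi_of_hasDerivAt_of_tendsto hcontF.continuousWithinAt hderiv hGint hlim
    have hF0 : F 0 = 0 := by simp [hF]
    rw [hF0, sub_zero, integral_sub ((integrableOn_exp_neg_mul_sin _ v).const_mul _)
        ((integrableOn_exp_neg_mul_sin _ v).const_mul _), integral_const_mul, integral_const_mul,
      ih] at key
    rw [sineMoment, eq_comm, div_mul_eq_mul_div, div_eq_iff (by positivity)]
    rw [hn] at key
    linear_combination -key

end SineMoments

section Cutoff

variable {d : ℕ} {p K α : ℝ} [Fact (1 ≤ ENNReal.ofReal p)]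

lemma isMult_diffSymbol (hp : 0 < p) (hα : 0 < α) (s : Finset (Fin d → ℤ)) (h : Fin d → ℝ) :
    IsMult (charLp p) s (fun k => diffSymbol α (dot k h)) (binomMass α) := fun c => by
  set M : ℕ → (Fin d → ℤ) → ℂ := fun n k => (((-1) ^ n * gBinom α n : ℝ) : ℂ) *
    Complex.exp (Complex.I * ((α - n) * dot k h : ℝ)) with hM
  have hlim : Filter.Tendsto (fun m => comb (charLp p) s
      fun k => (∑ n ∈ Finset.range m, M n k) * c k) Filter.atTop
      (nhds (comb (charLp p) s fun k => diffSymbol α (dot k h) * c k)) := by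
    refine tendsto_finsetSum _ fun k _ => Filter.Tendsto.smul_const (.mul_const _ ?_) _
    refine (summable_gBinom_mul hα fun n => ?_).hasSum.tendsto_sum_nat
    rw [mul_comm, Complex.norm_exp_ofReal_mul_I]
  refine le_of_tendsto hlim.norm (Filter.Eventually.of_forall fun m => ?_)
  have h1 := IsMult.sum (e := charLp (d := d) p) (s := s) (Finset.range m) (M := M)
    (A := fun n => |gBinom α n| * 1) fun n _ => by
      rw [← norm_signed_gBinom]
      exact (isMult_shift_mul hp s h (α - n)).const_mul _
  refine (h1 c).trans (mul_le_mul_of_nonneg_right ?_ (norm_nonneg _))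
  simp only [mul_one]
  exact (summable_abs_gBinom hα).sum_le_tsum _ fun _ _ => abs_nonneg _

lemma dot_single (k : Fin d → ℤ) (i : Fin d) : dot k (Pi.single i 1) = k i := by
  simp [dot, Pi.single_apply]

lemma euclNorm_smul (t : ℝ) (x : Fin d → ℝ) : euclNorm (t • x) = |t| * euclNorm x := by
  rw [← norm_toLp_eq_euclNorm, WithLp.toLp_smul, norm_smul, norm_toLp_eq_euclNorm,
    Real.norm_eq_abs]

lemma euclNorm_single (i : Fin d) : euclNorm (Pi.single i (1 : ℝ) : Fin d → ℝ) = 1 := by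
  simp [euclNorm, Pi.single_apply]

lemma sin_sq_half_eq (t : ℝ) : ((Real.sin (t / 2) ^ 2 : ℝ) : ℂ) =
    (-1 / 4) * (Complex.exp (Complex.I * t) * (1 - Complex.exp (-(Complex.I * t))) ^ 2) := by
  have h1 : Complex.exp (Complex.I * t) * Complex.exp (-(Complex.I * t)) = 1 := by
    rw [← Complex.exp_add]; simp
  have h2 : Complex.exp (Complex.I * t) + Complex.exp (-(Complex.I * t)) = 2 * (Real.cos t : ℂ) := by
    rw [Complex.ofReal_cos, Complex.cos]
    ring_nf
  have h3 : Real.sin (t / 2) ^ 2 = (1 - Real.cos t) / 2 := by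
    rw [Real.sin_sq_eq_half_sub, mul_div_cancel₀ _ (two_ne_zero)]
    ring
  rw [h3]
  push_cast at h2 ⊢
  linear_combination (Complex.exp (-(Complex.I * t)) / 4 - 1 / 2) * h1 + h2 / 4

lemma exists_norm_sin_pow_le (hp : 0 < p) (hα : 0 < α) {q : ℕ} (hq : α < 2 * q) :
    ∃ C : ℝ, 0 ≤ C ∧ ∀ (N : ℝ) (s : Finset (Fin d → ℤ)), 0 < N →
      ∀ (c : (Fin d → ℤ) → ℂ) (W : ℝ), (∀ h : Fin d → ℝ, euclNorm h ≤ 1 / N →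
        ‖comb (charLp p) s (fun k => diffSymbol α (dot k h) * c k)‖ ≤ W) →
      ∀ (i : Fin d) (t : ℝ), 0 < t →
        ‖comb (charLp p) s (fun k => ((Real.sin (k i / N * t) ^ (2 * q) : ℝ) : ℂ) * c k)‖ ≤
          C * (2 * t + 1) ^ (2 * q) * W := by
  have hβ : 0 < 2 * q - α := by linarith
  refine ⟨‖((-1 / 4 : ℂ)) ^ q‖ * binomMass (2 * q - α), mul_nonneg (norm_nonneg _) binomMass_nonneg,
    fun N s hN c W hW i t ht => ?_⟩
  set m : ℕ := ⌈2 * t⌉₊ with hm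
  have hm0 : 0 < m := Nat.ceil_pos.2 (by linarith)
  have hm0' : (0 : ℝ) < m := by exact_mod_cast hm0
  have hm1 : 2 * t ≤ m := Nat.le_ceil _
  have hm2 : (m : ℝ) ≤ 2 * t + 1 := (Nat.ceil_lt_add_one (by linarith)).le
  set h : Fin d → ℝ := (2 * t / (m * N)) • (Pi.single i 1 : Fin d → ℝ) with hh
  have hle : euclNorm h ≤ 1 / N := by
    rw [hh, euclNorm_smul, euclNorm_single, mul_one, abs_of_pos (by positivity),
      div_le_div_iff₀ (by positivity) hN]
    nlinarith
  have hdot : ∀ k : Fin d → ℤ, (k i : ℝ) / N * t = m * dot k h / 2 := fun k => by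
    rw [hh, dot_smul_right, dot_single]
    field_simp
  have hgeom : IsMult (charLp p) s
      (fun k => ∑ j ∈ Finset.range m, Complex.exp (Complex.I * (-j * dot k h : ℝ))) m := by
    have := IsMult.sum (e := charLp (d := d) p) (s := s) (Finset.range m) (A := fun _ => 1)
      fun j _ => isMult_shift_mul hp s h (-(j : ℝ))
    simpa using this
  have hmult := ((((isMult_shift_mul hp s h (q * m - 2 * q)).mul (hgeom.pow hm0'.le (2 * q))
    zero_le_one).mul (isMult_diffSymbol hp hβ s h) (by positivity)).const_mul ((-1 / 4 : ℂ) ^ q))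
  have heq : comb (charLp p) s (fun k => ((Real.sin (k i / N * t) ^ (2 * q) : ℝ) : ℂ) * c k) =
      comb (charLp p) s (fun k => (((-1 / 4 : ℂ) ^ q) *
        (Complex.exp (Complex.I * ((q * m - 2 * q) * dot k h : ℝ)) *
        (∑ j ∈ Finset.range m, Complex.exp (Complex.I * (-j * dot k h : ℝ))) ^ (2 * q) *
        diffSymbol (2 * q - α) (dot k h))) * (diffSymbol α (dot k h) * c k)) := by
    refine comb_congr fun k _ => ?_
    rw [hdot, pow_mul, Complex.ofReal_pow, sin_sq_half_eq, diffSymbol_eq_cpow hα,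
      diffSymbol_eq_cpow hβ]
    set T : ℝ := dot k h
    set δ : ℂ := 1 - Complex.exp (-(Complex.I * T)) with hδ
    have e1 : 1 - Complex.exp (-(Complex.I * (m * T : ℝ))) =
        (∑ j ∈ Finset.range m, Complex.exp (Complex.I * (-j * T : ℝ))) * δ := by
      have : ∀ j : ℕ, Complex.exp (Complex.I * (-j * T : ℝ)) =
          Complex.exp (-(Complex.I * T)) ^ j := fun j => by
        rw [← Complex.exp_nat_mul]
        congr 1
        push_cast
        ring
      simp only [this]
      rw [hδ, geom_sum_mul_neg, ← Complex.exp_nat_mul]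
      congr 2
      push_cast
      ring
    have e2 : δ ^ (2 * q) = δ ^ ((2 * q - α : ℝ) : ℂ) * δ ^ (α : ℂ) := by
      rcases eq_or_ne δ 0 with h0 | h0
      · have hq0 : q ≠ 0 := by
          rintro rfl
          simp at hq
          linarith
        rw [h0, Complex.zero_cpow (Complex.ofReal_ne_zero.2 hα.ne'), mul_zero,
          zero_pow (by omega)]
      · rw [← Complex.cpow_add _ _ h0, ← Complex.cpow_natCast]
        congr 1
        push_cast
        ring
    have e3 : Complex.exp (Complex.I * (m * T : ℝ)) ^ q =
        Complex.exp (Complex.I * ((q * m - 2 * q) * T : ℝ)) *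
        (Complex.exp (Complex.I * ((2 * q - α) * T : ℝ)) * Complex.exp (Complex.I * (α * T : ℝ))) := by
      rw [← Complex.exp_nat_mul, ← Complex.exp_add, ← Complex.exp_add]
      congr 1
      push_cast
      ring
    rw [e1, mul_pow, mul_pow, ← pow_mul, mul_pow _ δ, e2, e3]
    ring
  rw [heq]
  refine (hmult _).trans ?_
  have hb := binomMass_nonneg (α := 2 * q - α)
  have hpow : (m : ℝ) ^ (2 * q) ≤ (2 * t + 1) ^ (2 * q) := pow_le_pow_left₀ hm0'.le hm2 _
  refine mul_le_mul ?_ (hW h hle) (norm_nonneg _) (by positivity)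
  rw [one_mul, mul_assoc, mul_comm (binomMass _)]
  gcongr

/-- The frequencies in the cube inscribed in the ball of radius `N`. -/
def InBox (N : ℝ) (k : Fin d → ℤ) : Prop := ∀ i, |(k i : ℝ)| ≤ N / Real.sqrt d

lemma intNorm_le_of_inBox {N : ℝ} (hN : 0 ≤ N) {k : Fin d → ℤ} (h : InBox N k) : intNorm k ≤ N := by
  rw [intNorm, euclNorm]
  refine Real.sqrt_le_iff.2 ⟨hN, ?_⟩
  calc ∑ i, (k i : ℝ) ^ 2 ≤ ∑ _i : Fin d, (N / Real.sqrt d) ^ 2 :=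
        Finset.sum_le_sum fun i _ => sq_le_sq.2 ((h i).trans (le_abs_self _))
    _ ≤ N ^ 2 := by
        rw [Finset.sum_const, Finset.card_univ, Fintype.card_fin, nsmul_eq_mul, div_pow,
          Real.sq_sqrt (by positivity), mul_div_assoc']
        rcases Nat.eq_zero_or_pos d with h0 | h0
        · simp only [h0, Nat.cast_zero, zero_mul, zero_div]
          positivity
        · rw [mul_div_cancel_left₀ _ (by positivity)]

open Classical in
lemma norm_comb_cutoff_le (hK : RieszBound d p K) {s : Finset (Fin d → ℤ)} {a W : ℝ} (hW : 0 ≤ W)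
    {c : (Fin d → ℤ) → ℂ}
    (h : ∀ i, ‖comb (charLp p) s (fun k => if |(k i : ℝ)| ≤ a then 0 else c k)‖ ≤ W)
    (t : Finset (Fin d)) :
    ‖comb (charLp p) s (fun k => if ∀ i ∈ t, |(k i : ℝ)| ≤ a then 0 else c k)‖ ≤
      t.card * K ^ t.card * W := by
  induction t using Finset.induction_on with
  | empty => simp [comb]
  | insert i t hi ih =>
    have e : comb (charLp p) s (fun k => if ∀ j ∈ insert i t, |(k j : ℝ)| ≤ a then 0 else c k) =
        comb (charLp p) s (fun k => if |(k i : ℝ)| ≤ a then 0 else c k) +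
        comb (charLp p) s (fun k => (if |dot k (Pi.single i 1)| ≤ a then 1 else 0) *
          if ∀ j ∈ t, |(k j : ℝ)| ≤ a then 0 else c k) := by
      rw [← comb_add]
      refine comb_congr fun k _ => ?_
      rw [dot_single]
      simp only [Finset.forall_mem_insert]
      by_cases h1 : |(k i : ℝ)| ≤ a
      · by_cases h2 : ∀ j ∈ t, |(k j : ℝ)| ≤ a
        · simp [h1, if_pos h2]
        · simp [h1, if_neg h2]
      · simp [h1]
    rw [e, Finset.card_insert_of_notMem hi]
    refine (norm_add_le _ _).trans ((add_le_add (h i) (((hK.2 s _).2 a) _)).trans ?_)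
    have hK1 := hK.1
    have hKn : 1 ≤ K ^ (t.card + 1) := one_le_pow₀ hK1
    push_cast
    calc W + K * _ ≤ W + K * (t.card * K ^ t.card * W) := by gcongr
      _ ≤ K ^ (t.card + 1) * W + K * (t.card * K ^ t.card * W) := by
          have := le_mul_of_one_le_left hW hKn
          linarith
      _ = _ := by ring

lemma integrableOn_exp_neg_mul_pow (n : ℕ) :
    IntegrableOn (fun t : ℝ => Real.exp (-t) * (2 * t + 1) ^ n) (Set.Ioi 0) := by
  refine integrable_of_isBigO_exp_neg (b := 1 / 2) (by norm_num)
    (Continuous.continuousOn (by fun_prop)) ?_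
  have h1 : (fun t : ℝ => (2 * t + 1) ^ n) =O[Filter.atTop] fun t => Real.exp (1 / 2 * t) := by
    have h2 : (fun t : ℝ => (2 * t + 1) ^ n) =O[Filter.atTop] fun t : ℝ => t ^ n := by
      refine Asymptotics.IsBigO.pow (Asymptotics.IsBigO.of_bound 3 ?_) n
      filter_upwards [Filter.eventually_ge_atTop 1] with t ht
      rw [Real.norm_of_nonneg (by linarith), Real.norm_of_nonneg (by linarith)]
      linarith
    exact h2.trans (isLittleO_pow_exp_pos_mul_atTop n (by norm_num)).isBigO
  have h3 := (Asymptotics.isBigO_refl (fun t : ℝ => Real.exp (-t)) Filter.atTop).mul h1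
  refine h3.congr_right fun t => ?_
  rw [← Real.exp_add]
  congr 1
  ring

open Classical in
/-- Jackson's inequality for the part of a trigonometric sum outside a cube. -/
lemma exists_norm_outside_le_of_diff (hd : 0 < d) (hp : 0 < p) (hK : RieszBound d p K)
    (hα : 0 < α) :
    ∃ C : ℝ, 0 ≤ C ∧ ∀ (N : ℝ) (s : Finset (Fin d → ℤ)), 0 < N →
      ∀ (c : (Fin d → ℤ) → ℂ) (W : ℝ), (∀ h : Fin d → ℝ, euclNorm h ≤ 1 / N →
        ‖comb (charLp p) s (fun k => diffSymbol α (dot k h) * c k)‖ ≤ W) →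
      ‖comb (charLp p) s (fun k => if InBox N k then 0 else c k)‖ ≤ C * W := by
  obtain ⟨q, hq'⟩ := exists_nat_gt α
  have hq : α < 2 * q := by
    have : (0 : ℝ) ≤ q := by positivity
    linarith
  obtain ⟨A, hA, hsin⟩ := exists_norm_sin_pow_le (d := d) hp hα hq
  have hK1 := hK.1
  set κ : ℝ := 1 / Real.sqrt d with hκ
  have hκ0 : 0 < κ := by positivity
  set I : ℝ := ∫ t in Set.Ioi (0 : ℝ), Real.exp (-t) * (2 * t + 1) ^ (2 * q) with hI
  have hI0 : 0 ≤ I := setIntegral_nonneg measurableSet_Ioi fun t ht => by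
    have : (0 : ℝ) < t := ht
    positivity
  have hj := sineMoment_pos q hκ0
  set B : ℝ := (1 + K) * ((sineMoment q κ)⁻¹ * K) * (A * I) with hB
  refine ⟨d * K ^ d * B, by positivity, fun N s hN c W hW => ?_⟩
  have hW0 : 0 ≤ W := (norm_nonneg _).trans (hW 0 (by simp [euclNorm]; positivity))
  have hmain : ∀ i, ‖comb (charLp p) s
      (fun k => if |(k i : ℝ)| ≤ N / Real.sqrt d then 0 else c k)‖ ≤ B * W := fun i => by
    have h1 : ‖comb (charLp p) s (fun k => (sineMoment q (k i / N) : ℂ) * c k)‖ ≤ A * I * W := by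
      have := norm_comb_integral_le (e := charLp (d := d) p) (s := s) (c := c)
        (ν := volume.restrict (Set.Ioi (0 : ℝ))) (m := fun k => (sineMoment q (k i / N) : ℂ))
        (M := fun t k => ((Real.exp (-t) * Real.sin (k i / N * t) ^ (2 * q) : ℝ) : ℂ))
        (B := fun t => A * W * (Real.exp (-t) * (2 * t + 1) ^ (2 * q)))
        (fun k _ => (integrableOn_exp_neg_mul_sin _ _).ofReal) ?_
        ((integrableOn_exp_neg_mul_pow _).const_mul _) ?_
      · rw [integral_const_mul] at this
        exact this.trans_eq (by ring)
      · intro k _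
        rw [← integral_exp_neg_mul_sin]
        exact integral_ofReal.symm
      · refine (ae_restrict_iff' measurableSet_Ioi).2 (Filter.Eventually.of_forall fun t ht => ?_)
        have e : comb (charLp p) s
            (fun k => ((Real.exp (-t) * Real.sin (k i / N * t) ^ (2 * q) : ℝ) : ℂ) * c k) =
            (Real.exp (-t) : ℂ) • comb (charLp p) s
              (fun k => ((Real.sin (k i / N * t) ^ (2 * q) : ℝ) : ℂ) * c k) := by
          rw [← comb_smul]
          refine comb_congr fun k _ => ?_
          push_cast
          ring
        rw [e, norm_smul, Complex.norm_real,
          Real.norm_of_nonneg (Real.exp_pos _).le]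
        refine (mul_le_mul_of_nonneg_left (hsin N s hN c W hW i t ht)
          (Real.exp_pos _).le).trans_eq ?_
        ring
    have hout : IsMult (charLp p) s
        (fun k => 1 - if |dot k (Pi.single i 1)| ≤ N / Real.sqrt d then 1 else 0) (1 + K) :=
      isMult_one.sub ((hK.2 s (Pi.single i 1)).2 _)
    have hmax : ∀ k : Fin d → ℤ, κ ≤ max (|dot k (Pi.single i 1)| / N) κ := fun k =>
      le_max_right _ _
    have hμ := isMult_of_antitone (e := charLp (d := d) p) (s := s)
      (w := fun k => |dot k (Pi.single i 1)|)
      (μ := fun k => (sineMoment q (max (|dot k (Pi.single i 1)| / N) κ))⁻¹)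
      (inv_nonneg.2 hj.le) (hK.2 s (Pi.single i 1)).2
      (fun k _ => inv_nonneg.2 (sineMoment_nonneg _ _))
      (fun k _ => inv_anti₀ hj (sineMoment_mono q hκ0.le (hmax k)))
      (fun k _ l _ hkl => inv_anti₀ (sineMoment_pos q (hκ0.trans_le (hmax k)))
        (sineMoment_mono q (hκ0.le.trans (hmax k))
          (max_le_max (div_le_div_of_nonneg_right hkl hN.le) le_rfl)))
    have h2 := (hout.mul hμ (by positivity)) (fun k => (sineMoment q (k i / N) : ℂ) * c k)
    refine (le_of_eq (congrArg norm (comb_congr fun k _ => ?_))).trans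
      (h2.trans ((mul_le_mul_of_nonneg_left h1 (by positivity)).trans_eq (by rw [hB]; ring)))
    beta_reduce
    rw [dot_single]
    split_ifs with hk
    · simp
    · have hgt : κ ≤ |(k i : ℝ)| / N := by
        rw [hκ, le_div_iff₀ hN, div_mul_eq_mul_div, one_mul]
        exact (not_le.1 hk).le
      have hpos : 0 < sineMoment q (|(k i : ℝ)| / N) := sineMoment_pos q (hκ0.trans_le hgt)
      have : sineMoment q (k i / N) = sineMoment q (|(k i : ℝ)| / N) := by
        rw [← sineMoment_abs q (k i / N), abs_div, abs_of_pos hN]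
      have hne : ((sineMoment q (|(k i : ℝ)| / N) : ℝ) : ℂ) ≠ 0 := Complex.ofReal_ne_zero.2 hpos.ne'
      rw [max_eq_left hgt, this]
      push_cast
      field_simp
      ring
  have := norm_comb_cutoff_le hK (by positivity) hmain Finset.univ
  simp only [Finset.mem_univ, true_implies, Finset.card_univ, Fintype.card_fin] at this
  refine (le_of_eq (congrArg norm (comb_congr fun k _ => ?_))).trans
    (this.trans_eq (mul_assoc _ _ _).symm)
  by_cases h : InBox N k
  · rw [if_pos h, if_pos (show ∀ i, _ from h)]
  · rw [if_neg h, if_neg (show ¬ ∀ i, _ from h)]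

open Classical in
/-- The part of a trigonometric sum outside a cube is controlled by the fractional Laplacian. -/
lemma exists_norm_outside_le_of_laplacian (hK : RieszBound d p K) (hα : 0 < α) :
    ∃ C : ℝ, 0 ≤ C ∧ ∀ (N : ℝ) (s : Finset (Fin d → ℤ)), 0 < N → ∀ (c : (Fin d → ℤ) → ℂ),
      ‖comb (charLp p) s (fun k => if InBox N k then 0 else c k)‖ ≤
        C * (N ^ (-α) * ‖comb (charLp p) s (fun k => ((intNorm k ^ α : ℝ) : ℂ) * c k)‖) := by
  obtain ⟨A, hA, hratio⟩ := exists_isMult_ratio hK hα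
  have hK1 := hK.1
  rcases Nat.eq_zero_or_pos d with rfl | hd
  · refine ⟨0, le_rfl, fun N s hN c => ?_⟩
    have : ∀ k : Fin 0 → ℤ, InBox N k := fun k i => i.elim0
    simp [this, comb]
  have hsd : 0 < Real.sqrt d := by positivity
  set B : ℝ := (1 + K) * (Real.sqrt d ^ α * K) * A with hB
  refine ⟨d * K ^ d * B, by positivity, fun N s hN c => ?_⟩
  set a : ℝ := N / Real.sqrt d with ha
  have ha0 : 0 < a := by positivity
  set W : ℝ := N ^ (-α) * ‖comb (charLp p) s (fun k => ((intNorm k ^ α : ℝ) : ℂ) * c k)‖ with hW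
  have hmain : ∀ i, ‖comb (charLp p) s (fun k => if |(k i : ℝ)| ≤ a then 0 else c k)‖ ≤ B * W :=
      fun i => by
    have hout : IsMult (charLp p) s
        (fun k => 1 - if |dot k (Pi.single i 1)| ≤ a then 1 else 0) (1 + K) :=
      isMult_one.sub ((hK.2 s (Pi.single i 1)).2 _)
    have hmax : ∀ k : Fin d → ℤ, a ≤ max |dot k (Pi.single i 1)| a := fun k => le_max_right _ _
    have hμ := isMult_of_antitone (e := charLp (d := d) p) (s := s)
      (w := fun k => |dot k (Pi.single i 1)|)
      (μ := fun k => (max |dot k (Pi.single i 1)| a) ^ (-α)) (B := a ^ (-α))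
      (by positivity) (hK.2 s (Pi.single i 1)).2
      (fun k _ => Real.rpow_nonneg (ha0.le.trans (hmax k)) _)
      (fun k _ => Real.rpow_le_rpow_of_nonpos ha0 (hmax k) (by linarith))
      (fun k _ l _ hkl => Real.rpow_le_rpow_of_nonpos (ha0.trans_le (hmax k))
        (max_le_max hkl le_rfl) (by linarith))
    have hr := hratio s (EuclideanSpace.single i 1) (by simp)
    have h2 := ((hout.mul hμ (by positivity)).mul hr (by positivity))
      (fun k => ((intNorm k ^ α : ℝ) : ℂ) * c k)
    have ea : a ^ (-α) = Real.sqrt d ^ α * N ^ (-α) := by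
      rw [ha, Real.div_rpow hN.le hsd.le, Real.rpow_neg hsd.le, div_inv_eq_mul, mul_comm]
    refine (le_of_eq (congrArg norm (comb_congr fun k _ => ?_))).trans
      (h2.trans_eq (by rw [hB, hW, ea]; ring))
    have hdk : dot k (EuclideanSpace.single i (1 : ℝ)).ofLp = k i := dot_single k i
    beta_reduce
    rw [dot_single, hdk]
    split_ifs with hk
    · simp
    · have hgt : a < |(k i : ℝ)| := not_le.1 hk
      have hki : 0 < |(k i : ℝ)| := ha0.trans hgt
      have hk0 : 0 < intNorm k := by
        have h3 := abs_dot_le k (Pi.single i 1)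
        rw [dot_single, euclNorm_single, mul_one] at h3
        exact hki.trans_le h3
      have : |(k i : ℝ)| ^ (-α) * ((|(k i : ℝ)| / intNorm k) ^ α * intNorm k ^ α) = 1 := by
        rw [← Real.mul_rpow (by positivity) hk0.le, div_mul_cancel₀ _ hk0.ne', ← Real.rpow_add hki]
        simp
      rw [max_eq_left hgt.le, sub_zero, one_mul]
      have h4 := congrArg (fun x : ℝ => (x : ℂ)) this
      simp only [Complex.ofReal_mul, Complex.ofReal_one] at h4
      linear_combination (-c k) * h4
  have := norm_comb_cutoff_le hK (by positivity) hmain Finset.univ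
  simp only [Finset.mem_univ, true_implies, Finset.card_univ, Fintype.card_fin] at this
  refine (le_of_eq (congrArg norm (comb_congr fun k _ => ?_))).trans
    (this.trans_eq (mul_assoc _ _ _).symm)
  by_cases h : InBox N k
  · rw [if_pos h, if_pos (show ∀ i, _ from h)]
  · rw [if_neg h, if_neg (show ¬ ∀ i, _ from h)]

end Cutoff

variable {d : ℕ} {α : ℝ}

open Classical in
lemma torusFourierCoeff_trig (s : Finset (Fin d → ℤ)) (c : (Fin d → ℤ) → ℂ) (k : Fin d → ℤ) :
    torusFourierCoeff d (trig s c) k = if k ∈ s then c k else 0 := by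
  have e : ∀ x : Fin d → ℝ, trig s c x *
      Complex.exp (-(Complex.I * ((∑ i, (k i : ℝ) * x i : ℝ) : ℂ))) =
      ∑ l ∈ s, c l * expChar (l - k) x := fun x => by
    have : expChar k x * Complex.exp (-(Complex.I * ((∑ i, (k i : ℝ) * x i : ℝ) : ℂ))) = 1 := by
      rw [expChar, ← Complex.exp_add, add_neg_cancel, Complex.exp_zero]
    rw [trig, Finset.sum_mul]
    refine Finset.sum_congr rfl fun l _ => ?_
    have h2 : expChar l x = expChar (l - k) x * expChar k x := by rw [← expChar_add, sub_add_cancel]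
    rw [h2, mul_assoc, mul_assoc, this, mul_one]
  have hπ : ((2 * Real.pi : ℝ) : ℂ) ^ d ≠ 0 :=
    pow_ne_zero _ (Complex.ofReal_ne_zero.2 (by positivity))
  simp only [torusFourierCoeff, e]
  have hI : ∀ l ∈ s, Integrable (fun x => c l * expChar (l - k) x) (torusMeasure d) := fun l _ =>
    integrable_of_continuous (continuous_const.mul (continuous_expChar (l - k)))
  rw [integral_finsetSum _ hI]
  simp only [integral_const_mul, integral_expChar, sub_eq_zero, mul_ite, mul_zero,
    Finset.sum_ite_eq']
  split_ifs
  · rw [Complex.real_smul]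
    push_cast at hπ ⊢
    field_simp
  · simp

lemma fracLaplacian_trig (s : Finset (Fin d → ℤ)) (c : (Fin d → ℤ) → ℂ) :
    fracLaplacian d α (trig s c) = trig s (fun k => ((intNorm k ^ α : ℝ) : ℂ) * c k) := by
  classical
  funext x
  rw [fracLaplacian, tsum_eq_sum (s := s)]
  · refine Finset.sum_congr rfl fun k hk => ?_
    rw [torusFourierCoeff_trig, if_pos hk]
    rfl
  · intro k hk
    rw [torusFourierCoeff_trig, if_neg hk]
    simp

lemma fracDiff_trig (hα : 0 < α) (h : Fin d → ℝ) (s : Finset (Fin d → ℤ))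
    (c : (Fin d → ℤ) → ℂ) :
    fracDiff α h (trig s c) = trig s (fun k => diffSymbol α (dot k h) * c k) := by
  funext x
  have e : ∀ ν : ℕ, ((-1 : ℝ) ^ ν * gBinom α ν) • trig s c (x + (α - ν) • h) =
      ∑ k ∈ s, ((((-1) ^ ν * gBinom α ν : ℝ) : ℂ) *
        Complex.exp (Complex.I * (((α - ν) * dot k h : ℝ) : ℂ))) * (c k * expChar k x) := fun ν => by
    rw [trig_shift, Complex.real_smul, trig, Finset.mul_sum]
    refine Finset.sum_congr rfl fun k _ => ?_
    rw [dot_smul_right]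
    ring
  have hs : ∀ k : Fin d → ℤ, Summable fun ν : ℕ => (((-1) ^ ν * gBinom α ν : ℝ) : ℂ) *
        Complex.exp (Complex.I * (((α - ν) * dot k h : ℝ) : ℂ)) := fun k =>
    summable_gBinom_mul hα fun n => by rw [mul_comm, Complex.norm_exp_ofReal_mul_I]
  simp only [fracDiff, e]
  rw [Summable.tsum_finsetSum fun k _ => (hs k).mul_right _]
  refine Finset.sum_congr rfl fun k _ => ?_
  rw [tsum_mul_right]
  simp only [diffSymbol]
  ring

end FracSmooth

namespace FracSmooth

variable {d : ℕ} {α : ℝ}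

lemma mem_trigPoly {n : ℝ} {s : Finset (Fin d → ℤ)} {c : (Fin d → ℤ) → ℂ}
    (h : ∀ k ∈ s, intNorm k ≤ n) : trig s c ∈ TrigPoly d n := ⟨s, c, h, fun _ => rfl⟩

/-- The point of the standard torus with angular coordinates `x`. -/
noncomputable def toUnitTorus (x : Fin d → ℝ) : UnitAddTorus (Fin d) :=
  fun i => ((x i / (2 * Real.pi) : ℝ) : UnitAddCircle)

lemma continuous_toUnitTorus : Continuous (toUnitTorus (d := d)) :=
  continuous_pi fun i => (AddCircle.continuous_mk' 1).comp ((continuous_apply i).div_const _)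

lemma mFourier_toUnitTorus (k : Fin d → ℤ) (x : Fin d → ℝ) :
    UnitAddTorus.mFourier k (toUnitTorus x) = expChar k x := by
  have hπ : (Real.pi : ℂ) ≠ 0 := Complex.ofReal_ne_zero.2 Real.pi_ne_zero
  simp only [UnitAddTorus.mFourier, ContinuousMap.coe_mk, toUnitTorus, fourier_coe_apply, expChar]
  rw [← Complex.exp_sum]
  congr 1
  push_cast
  rw [Finset.mul_sum]
  refine Finset.sum_congr rfl fun i _ => ?_
  field_simp

/-- Angular coordinates in `(0, 2π]` of a point of the standard torus. -/
noncomputable def ofUnitTorus (t : UnitAddTorus (Fin d)) : Fin d → ℝ :=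
  fun i => 2 * Real.pi * (AddCircle.measurableEquivIoc 1 0 (t i) : ℝ)

lemma measurable_ofUnitTorus : Measurable (ofUnitTorus (d := d)) :=
  measurable_pi_lambda _ fun i => measurable_const.mul
    (measurable_subtype_coe.comp ((AddCircle.measurableEquivIoc 1 0).measurable.comp
      (measurable_pi_apply i)))

lemma ae_ofUnitTorus_toUnitTorus :
    ∀ᵐ x ∂torusMeasure d, ofUnitTorus (toUnitTorus x) = x := by
  have h1 : torusMeasure d = volume.restrict (Set.univ.pi fun _ => Set.Ioc 0 (2 * Real.pi)) := by
    rw [torusMeasure]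
    refine Measure.restrict_congr_set ?_
    have := (Measure.univ_pi_Ioc_ae_eq_Icc (μ := fun _ : Fin d => (volume : Measure ℝ))
      (f := fun _ => 0) (g := fun _ => 2 * Real.pi)).symm
    rwa [← Set.pi_univ_Icc] at this
  rw [h1]
  refine (ae_restrict_iff' (MeasurableSet.univ_pi fun _ => measurableSet_Ioc)).2
    (Filter.Eventually.of_forall fun x hx => funext fun i => ?_)
  have hxi := hx i (Set.mem_univ i)
  have hpi := Real.pi_pos
  have hmem : x i / (2 * Real.pi) ∈ Set.Ioc (0 : ℝ) (0 + 1) :=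
    ⟨div_pos hxi.1 (by positivity), by rw [zero_add, div_le_one (by positivity)]; exact hxi.2⟩
  have : (AddCircle.measurableEquivIoc 1 0 (((x i / (2 * Real.pi) : ℝ) : UnitAddCircle)) : ℝ) =
      x i / (2 * Real.pi) := by
    have := AddCircle.equivIoc_coe_eq (p := (1 : ℝ)) (a := 0) hmem
    exact congrArg Subtype.val this
  simp only [ofUnitTorus, toUnitTorus, this]
  field_simp

lemma exists_trig_of_mem_span {G : C(UnitAddTorus (Fin d), ℂ)}
    (hG : G ∈ Submodule.span ℂ (Set.range (UnitAddTorus.mFourier (d := Fin d)))) :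
    ∃ (s : Finset (Fin d → ℤ)) (c : (Fin d → ℤ) → ℂ), ∀ x, G (toUnitTorus x) = trig s c x := by
  obtain ⟨c, rfl⟩ := (Finsupp.mem_span_range_iff_exists_finsupp).1 hG
  refine ⟨c.support, c, fun x => ?_⟩
  simp [Finsupp.sum, trig, ContinuousMap.sum_apply, mFourier_toUnitTorus]

lemma exists_trig_eLpNorm_sub_lt {p : ℝ} [Fact (1 ≤ ENNReal.ofReal p)] {f : (Fin d → ℝ) → ℂ}
    (hf : MemLp f (ENNReal.ofReal p) (torusMeasure d)) {ε : ℝ} (hε : 0 < ε) :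
    ∃ (s : Finset (Fin d → ℤ)) (c : (Fin d → ℤ) → ℂ),
      eLpNorm (f - trig s c) (ENNReal.ofReal p) (torusMeasure d) ≤ ENNReal.ofReal ε := by
  have hmΦ := (continuous_toUnitTorus (d := d)).measurable
  set ν := (torusMeasure d).map toUnitTorus with hν
  have hfin : IsFiniteMeasure ν := by rw [hν]; infer_instance
  set f' := hf.1.mk f with hf'
  have hcomp : (fun t => f' (ofUnitTorus t)) ∘ toUnitTorus =ᵐ[torusMeasure d] f := by
    filter_upwards [ae_ofUnitTorus_toUnitTorus, hf.1.ae_eq_mk] with x hx hx'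
    rw [Function.comp_apply, hx, hx']
  have hFm : AEStronglyMeasurable (fun t => f' (ofUnitTorus t)) ν :=
    (hf.1.stronglyMeasurable_mk.comp_measurable measurable_ofUnitTorus).aestronglyMeasurable
  have hF : MemLp (fun t => f' (ofUnitTorus t)) (ENNReal.ofReal p) ν :=
    (memLp_map_measure_iff hFm hmΦ.aemeasurable).2 ((memLp_congr_ae hcomp).2 hf)
  have hdense : DenseRange ((ContinuousMap.toLp (E := ℂ) (ENNReal.ofReal p) ν ℂ)) :=
    ContinuousMap.toLp_denseRange ℂ ν ℂ ENNReal.ofReal_ne_top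
  have hspan : Dense ((Submodule.span ℂ (Set.range (UnitAddTorus.mFourier (d := Fin d))) :
      Submodule ℂ C(UnitAddTorus (Fin d), ℂ)) : Set C(UnitAddTorus (Fin d), ℂ)) :=
    Submodule.dense_iff_topologicalClosure_eq_top.2 UnitAddTorus.span_mFourier_closure_eq_top
  have hd2 := hdense.dense_image (ContinuousMap.toLp (E := ℂ) (ENNReal.ofReal p) ν ℂ).continuous hspan
  obtain ⟨g, ⟨G, hG, rfl⟩, hg⟩ := Metric.dense_iff.1 hd2 (hF.toLp _) ε hε |>.imp
    fun _ h => And.symm h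
  obtain ⟨s, c, hsc⟩ := exists_trig_of_mem_span hG
  refine ⟨s, c, ?_⟩
  have hGm : MemLp G (ENNReal.ofReal p) ν :=
    MemLp.of_bound G.continuous.aestronglyMeasurable ‖G‖
      (Filter.Eventually.of_forall fun t => G.norm_coe_le_norm t)
  have hGL : ContinuousMap.toLp (E := ℂ) (ENNReal.ofReal p) ν ℂ G = hGm.toLp G := by
    refine Lp.ext ?_
    exact (ContinuousMap.coeFn_toLp ν G).trans hGm.coeFn_toLp.symm
  rw [hGL, Metric.mem_ball, dist_comm, dist_eq_norm, ← MemLp.toLp_sub, Lp.norm_toLp] at hg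
  have e : eLpNorm (f - trig s c) (ENNReal.ofReal p) (torusMeasure d) =
      eLpNorm ((fun t => f' (ofUnitTorus t)) - ⇑G) (ENNReal.ofReal p) ν := by
    rw [eLpNorm_map_measure (hFm.sub hGm.1) hmΦ.aemeasurable]
    refine eLpNorm_congr_ae ?_
    filter_upwards [hcomp] with x hx
    simp only [Function.comp_apply, Pi.sub_apply] at hx ⊢
    rw [hsc, hx]
  rw [e]
  exact ENNReal.le_ofReal_iff_toReal_le (hF.sub hGm).2.ne hε.le |>.2 hg.le

end FracSmooth

namespace FracSmooth

variable {d : ℕ} {α p : ℝ}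

lemma memLp_shift (hp : 0 < p) {f : (Fin d → ℝ) → ℂ} (hper : Periodic2Pi f)
    (hf : MemLp f (ENNReal.ofReal p) (torusMeasure d)) (h : Fin d → ℝ) :
    MemLp (fun x => f (x + h)) (ENNReal.ofReal p) (torusMeasure d) :=
  ⟨aestronglyMeasurable_shift hper hf.1 h, by rw [eLpNorm_shift hper h hp]; exact hf.2⟩

lemma tsum_eLpNorm_fracDiff_term (hα : 0 < α) (hp : 0 < p) {f : (Fin d → ℝ) → ℂ}
    (hper : Periodic2Pi f) (h : Fin d → ℝ) :
    ∑' ν : ℕ, eLpNorm (fun x => ((-1 : ℝ) ^ ν * gBinom α ν) • f (x + (α - ν) • h))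
      (ENNReal.ofReal p) (torusMeasure d) =
      ENNReal.ofReal (binomMass α) * eLpNorm f (ENNReal.ofReal p) (torusMeasure d) := by
  have e : ∀ ν : ℕ, eLpNorm (fun x => ((-1 : ℝ) ^ ν * gBinom α ν) • f (x + (α - ν) • h))
      (ENNReal.ofReal p) (torusMeasure d) = ENNReal.ofReal |gBinom α ν| *
      eLpNorm f (ENNReal.ofReal p) (torusMeasure d) := fun ν => by
    have : eLpNorm (fun x => ((-1 : ℝ) ^ ν * gBinom α ν) • f (x + (α - ν) • h))
      (ENNReal.ofReal p) (torusMeasure d) = _ := eLpNorm_const_smul ((-1 : ℝ) ^ ν * gBinom α ν)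
        (fun x => f (x + (α - ν) • h)) (ENNReal.ofReal p) (torusMeasure d)
    rw [this, eLpNorm_shift hper _ hp, ← ofReal_norm, Real.norm_eq_abs, abs_mul, abs_pow, abs_neg,
      abs_one, one_pow, one_mul]
  simp only [e]
  rw [ENNReal.tsum_mul_right, binomMass,
    ENNReal.ofReal_tsum_of_nonneg (fun _ => abs_nonneg _) (summable_abs_gBinom hα)]

lemma ae_summable_fracDiff [Fact (1 ≤ ENNReal.ofReal p)] (hα : 0 < α) (hp : 0 < p)
    {f : (Fin d → ℝ) → ℂ} (hper : Periodic2Pi f)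
    (hf : MemLp f (ENNReal.ofReal p) (torusMeasure d)) (h : Fin d → ℝ) :
    ∀ᵐ x ∂torusMeasure d,
      Summable fun ν : ℕ => ((-1 : ℝ) ^ ν * gBinom α ν) • f (x + (α - ν) • h) := by
  have := summable_norm_of_tsum_eLpNorm_ne_top (Fact.out : 1 ≤ ENNReal.ofReal p)
    (f := fun (ν : ℕ) x => ((-1 : ℝ) ^ ν * gBinom α ν) • f (x + (α - ν) • h))
    (fun ν => (memLp_shift hp hper hf ((α - ν) • h)).1.const_smul ((-1 : ℝ) ^ ν * gBinom α ν))
    (by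
      rw [tsum_eLpNorm_fracDiff_term hα hp hper]
      exact ENNReal.mul_ne_top ENNReal.ofReal_ne_top hf.2.ne)
  filter_upwards [this] with x hx
  exact hx.of_norm

lemma fracDiff_sub_ae [Fact (1 ≤ ENNReal.ofReal p)] (hα : 0 < α) (hp : 0 < p)
    {f g : (Fin d → ℝ) → ℂ} (hfp : Periodic2Pi f) (hgp : Periodic2Pi g)
    (hf : MemLp f (ENNReal.ofReal p) (torusMeasure d))
    (hg : MemLp g (ENNReal.ofReal p) (torusMeasure d)) (h : Fin d → ℝ) :
    fracDiff α h (f - g) =ᵐ[torusMeasure d] fracDiff α h f - fracDiff α h g := by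
  filter_upwards [ae_summable_fracDiff hα hp hfp hf h, ae_summable_fracDiff hα hp hgp hg h]
    with x h1 h2
  simp only [fracDiff, Pi.sub_apply, smul_sub]
  exact h1.tsum_sub h2

lemma memLp_fracDiff [Fact (1 ≤ ENNReal.ofReal p)] (hα : 0 < α) (hp : 0 < p)
    {f : (Fin d → ℝ) → ℂ} (hper : Periodic2Pi f)
    (hf : MemLp f (ENNReal.ofReal p) (torusMeasure d)) (h : Fin d → ℝ) :
    MemLp (fracDiff α h f) (ENNReal.ofReal p) (torusMeasure d) ∧
    eLpNorm (fracDiff α h f) (ENNReal.ofReal p) (torusMeasure d) ≤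
      ENNReal.ofReal (binomMass α) * eLpNorm f (ENNReal.ofReal p) (torusMeasure d) := by
  set g : ℕ → Lp ℂ (ENNReal.ofReal p) (torusMeasure d) := fun ν =>
    ((memLp_shift hp hper hf ((α - ν) • h)).const_smul ((-1 : ℝ) ^ ν * gBinom α ν)).toLp _ with hg
  have hn : ∑' ν, ‖g ν‖ₑ =
      ENNReal.ofReal (binomMass α) * eLpNorm f (ENNReal.ofReal p) (torusMeasure d) := by
    rw [← tsum_eLpNorm_fracDiff_term hα hp hper h]
    refine tsum_congr fun ν => ?_
    rw [hg, Lp.enorm_toLp]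
    rfl
  have htop : ∑' ν, ‖g ν‖ₑ ≠ ∞ := by
    rw [hn]
    exact ENNReal.mul_ne_top ENNReal.ofReal_ne_top hf.2.ne
  have hae : (∑' ν, g ν : Lp ℂ (ENNReal.ofReal p) (torusMeasure d)) =ᵐ[torusMeasure d]
      fracDiff α h f := by
    filter_upwards [Lp.hasSum_coeFn_tsum htop, ae_all_iff.2 fun ν : ℕ => (MemLp.coeFn_toLp
      ((memLp_shift hp hper hf ((α - ν) • h)).const_smul ((-1 : ℝ) ^ ν * gBinom α ν)))]
      with x h1 h2
    rw [← h1.tsum_eq, fracDiff]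
    exact tsum_congr h2
  refine ⟨(memLp_congr_ae hae).1 (Lp.memLp _), ?_⟩
  rw [← eLpNorm_congr_ae hae, ← Lp.enorm_def, ← hn]
  exact enorm_tsum_le_tsum_enorm

end FracSmooth

namespace FracSmooth

section Scalar

variable {p : ℝ}

lemma rpow_eq_sq_rpow {x : ℝ} (hx : 0 ≤ x) (p : ℝ) : x ^ p = (x ^ 2) ^ (p / 2) := by
  rw [← Real.rpow_natCast x 2, ← Real.rpow_mul hx]
  congr 1
  push_cast
  ring

lemma norm_add_sq_add_norm_sub_sq (a b : ℂ) :
    ‖a + b‖ ^ 2 + ‖a - b‖ ^ 2 = 2 * (‖a‖ ^ 2 + ‖b‖ ^ 2) := by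
  have := parallelogram_law_with_norm ℝ a b
  nlinarith

lemma norm_add_rpow_add_le (hp : 1 < p) (hp2 : p ≤ 2) (a b : ℂ) :
    ‖a + b‖ ^ p + ‖a - b‖ ^ p ≤ 2 * ‖a‖ ^ p + 2 * ‖b‖ ^ p := by
  have hc := Real.concaveOn_rpow (p := p / 2) (by linarith) (by linarith)
  have h1 := hc.2 (Set.mem_Ici.2 (sq_nonneg ‖a + b‖)) (Set.mem_Ici.2 (sq_nonneg ‖a - b‖))
    (show (0 : ℝ) ≤ 1 / 2 by norm_num) (show (0 : ℝ) ≤ 1 / 2 by norm_num) (by norm_num)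
  simp only [smul_eq_mul, ← rpow_eq_sq_rpow (norm_nonneg _)] at h1
  rw [← mul_add, ← mul_add, norm_add_sq_add_norm_sub_sq, ← mul_assoc, one_div_mul_cancel two_ne_zero,
    one_mul] at h1
  have h2 := Real.rpow_add_le_add_rpow (sq_nonneg ‖a‖) (sq_nonneg ‖b‖) (p := p / 2) (by linarith)
    (by linarith)
  rw [← rpow_eq_sq_rpow (norm_nonneg _), ← rpow_eq_sq_rpow (norm_nonneg _)] at h2
  linarith

lemma le_norm_add_rpow_add (hp2 : 2 ≤ p) (a b : ℂ) :
    2 * ‖a‖ ^ p + 2 * ‖b‖ ^ p ≤ ‖a + b‖ ^ p + ‖a - b‖ ^ p := by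
  have hc := convexOn_rpow (p := p / 2) (by linarith)
  have h1 := hc.2 (Set.mem_Ici.2 (sq_nonneg ‖a + b‖)) (Set.mem_Ici.2 (sq_nonneg ‖a - b‖))
    (show (0 : ℝ) ≤ 1 / 2 by norm_num) (show (0 : ℝ) ≤ 1 / 2 by norm_num) (by norm_num)
  simp only [smul_eq_mul, ← rpow_eq_sq_rpow (norm_nonneg _)] at h1
  rw [← mul_add, ← mul_add, norm_add_sq_add_norm_sub_sq, ← mul_assoc, one_div_mul_cancel two_ne_zero,
    one_mul] at h1
  have h2 := Real.add_rpow_le_rpow_add (sq_nonneg ‖a‖) (sq_nonneg ‖b‖) (p := p / 2) (by linarith)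
  rw [← rpow_eq_sq_rpow (norm_nonneg _), ← rpow_eq_sq_rpow (norm_nonneg _)] at h2
  linarith

lemma norm_one_add_sq (z : ℂ) : ‖1 + z‖ ^ 2 = 1 + 2 * z.re + ‖z‖ ^ 2 := by
  rw [← Complex.normSq_eq_norm_sq, ← Complex.normSq_eq_norm_sq, Complex.normSq_apply,
    Complex.normSq_apply]
  simp
  ring

lemma norm_one_add_rpow_add_le (hp2 : 2 ≤ p) {z : ℂ} (hz : ‖z‖ ≤ 1) :
    ‖1 + z‖ ^ p + ‖1 - z‖ ^ p ≤ 2 * (1 + Real.exp (p + 1) * ‖z‖ ^ 2) ^ (p / 2) := by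
  have key : ∀ w : ℂ, ‖1 + w‖ ^ p ≤ Real.exp (p * w.re + p / 2 * ‖w‖ ^ 2) := fun w => by
    rw [rpow_eq_sq_rpow (norm_nonneg _)]
    refine (Real.rpow_le_rpow (sq_nonneg _) (y := Real.exp (2 * w.re + ‖w‖ ^ 2)) ?_
      (by linarith)).trans_eq ?_
    · rw [norm_one_add_sq]
      have := Real.add_one_le_exp (2 * w.re + ‖w‖ ^ 2)
      linarith
    · rw [← Real.exp_mul]
      congr 1
      ring
  have h1 := key z
  have h2 := key (-z)
  rw [← sub_eq_add_neg, norm_neg, Complex.neg_re] at h2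
  have h3 := Real.cosh_le_exp_half_sq (p * z.re)
  rw [Real.cosh_eq] at h3
  have h4 : ‖z‖ ^ 2 ≤ 1 := pow_le_one₀ (norm_nonneg _) hz
  have h5 : Real.exp ((p + 1) * ‖z‖ ^ 2) ≤ 1 + Real.exp (p + 1) * ‖z‖ ^ 2 := by
    have := convexOn_exp.2 (Set.mem_univ (0 : ℝ)) (Set.mem_univ (p + 1))
      (show 0 ≤ 1 - ‖z‖ ^ 2 by linarith) (sq_nonneg ‖z‖) (by ring)
    simp only [smul_eq_mul, mul_zero, zero_add, Real.exp_zero, mul_one] at this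
    rw [mul_comm (p + 1)]
    nlinarith [sq_nonneg ‖z‖]
  have h6 : z.re ^ 2 ≤ ‖z‖ ^ 2 := sq_le_sq.2 (by simpa using Complex.abs_re_le_norm z)
  calc ‖1 + z‖ ^ p + ‖1 - z‖ ^ p
      ≤ Real.exp (p * z.re + p / 2 * ‖z‖ ^ 2) + Real.exp (p * -z.re + p / 2 * ‖z‖ ^ 2) :=
        add_le_add h1 h2
    _ = 2 * ((Real.exp (p * z.re) + Real.exp (-(p * z.re))) / 2) * Real.exp (p / 2 * ‖z‖ ^ 2) := by
        rw [Real.exp_add, Real.exp_add, mul_neg]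
        ring
    _ ≤ 2 * Real.exp ((p * z.re) ^ 2 / 2) * Real.exp (p / 2 * ‖z‖ ^ 2) := by gcongr
    _ ≤ 2 * Real.exp (p / 2 * ((p + 1) * ‖z‖ ^ 2)) := by
        rw [mul_assoc, ← Real.exp_add]
        gcongr
        nlinarith [sq_nonneg p, mul_le_mul_of_nonneg_left h6 (sq_nonneg p)]
    _ = 2 * (Real.exp ((p + 1) * ‖z‖ ^ 2)) ^ (p / 2) := by rw [← Real.exp_mul, mul_comm (p / 2)]
    _ ≤ _ := by gcongr

lemma norm_add_rpow_add_le_of_le (hp2 : 2 ≤ p) {a b : ℂ} (h : ‖b‖ ≤ ‖a‖) :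
    ‖a + b‖ ^ p + ‖a - b‖ ^ p ≤ 2 * (‖a‖ ^ 2 + Real.exp (p + 1) * ‖b‖ ^ 2) ^ (p / 2) := by
  rcases eq_or_ne a 0 with rfl | ha
  · have : b = 0 := by simpa using h
    have h0 : p ≠ 0 := by positivity
    simp [this, Real.zero_rpow h0, Real.zero_rpow (show p / 2 ≠ 0 by positivity)]
  have ha' : 0 < ‖a‖ := norm_pos_iff.2 ha
  have h1 := norm_one_add_rpow_add_le hp2 (z := b / a)
    (by rw [norm_div]; exact div_le_one_of_le₀ h ha'.le)
  have e1 : a + b = a * (1 + b / a) := by field_simp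
  have e2 : a - b = a * (1 - b / a) := by field_simp
  have e3 : ‖a‖ ^ 2 + Real.exp (p + 1) * ‖b‖ ^ 2 =
      ‖a‖ ^ 2 * (1 + Real.exp (p + 1) * ‖b / a‖ ^ 2) := by
    rw [norm_div]
    field_simp
  rw [e1, e2, e3, norm_mul, norm_mul, Real.mul_rpow (norm_nonneg _) (norm_nonneg _),
    Real.mul_rpow (norm_nonneg _) (norm_nonneg _), Real.mul_rpow (by positivity) (by positivity),
    ← rpow_eq_sq_rpow (norm_nonneg _)]
  have := mul_le_mul_of_nonneg_left h1 (Real.rpow_nonneg ha'.le p)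
  linarith

lemma norm_add_rpow_add_le_two_mul (hp2 : 2 ≤ p) (a b : ℂ) :
    ‖a + b‖ ^ p + ‖a - b‖ ^ p ≤ 2 * (‖a‖ ^ 2 + Real.exp (p + 1) * ‖b‖ ^ 2) ^ (p / 2) := by
  rcases le_total ‖b‖ ‖a‖ with h | h
  · exact norm_add_rpow_add_le_of_le hp2 h
  · have h1 := norm_add_rpow_add_le_of_le hp2 h
    rw [add_comm b a, norm_sub_rev b a] at h1
    have hK : 1 ≤ Real.exp (p + 1) := Real.one_le_exp (by linarith)
    refine h1.trans ?_
    gcongr 2 * ?_ ^ (p / 2)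
    nlinarith [mul_nonneg (sub_nonneg.2 hK) (sub_nonneg.2 (pow_le_pow_left₀ (norm_nonneg a) h 2))]

lemma one_add_rpow_add_one_sub_rpow_ge (hp : 1 < p) (hp2 : p ≤ 2) {t : ℝ} (ht : 0 ≤ t)
    (ht1 : t ≤ 1) : 2 + p * (p - 1) / 2 * t ^ 2 ≤ (1 + t) ^ p + (1 - t) ^ p := by
  have hd : ∀ x : ℝ, HasDerivAt (fun t : ℝ => (1 + t) ^ p + (1 - t) ^ p - p * (p - 1) / 2 * t ^ 2)
      (p * (1 + x) ^ (p - 1) - p * (1 - x) ^ (p - 1) - p * (p - 1) * x) x := fun x => by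
    have h1 := ((hasDerivAt_id x).const_add 1).rpow_const (p := p) (Or.inr hp.le)
    have h2 := ((hasDerivAt_id x).const_sub 1).rpow_const (p := p) (Or.inr hp.le)
    have h3 := ((hasDerivAt_pow 2 x).const_mul (p * (p - 1) / 2))
    refine ((h1.add h2).sub h3).congr_deriv ?_
    simp
    ring
  have hmono : MonotoneOn (fun t : ℝ => (1 + t) ^ p + (1 - t) ^ p - p * (p - 1) / 2 * t ^ 2)
      (Set.Icc 0 1) := by
    refine monotoneOn_of_deriv_nonneg (convex_Icc 0 1)
      (fun x _ => (hd x).continuousAt.continuousWithinAt)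
      (fun x _ => (hd x).differentiableAt.differentiableWithinAt) fun x hx => ?_
    rw [interior_Icc] at hx
    rw [(hd x).deriv]
    have h1 : 1 ≤ (1 + x) ^ (p - 1) :=
      Real.one_le_rpow (by linarith [hx.1]) (by linarith)
    have h2 := rpow_one_add_le_one_add_mul_self (s := -x) (by linarith [hx.2]) (p := p - 1)
      (by linarith) (by linarith)
    rw [← sub_eq_add_neg] at h2
    nlinarith
  have := hmono (Set.left_mem_Icc.2 zero_le_one) ⟨ht, ht1⟩ ht
  simp only [add_zero, Real.one_rpow, sub_zero] at this
  linarith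

lemma sq_add_rpow_le (hp : 1 < p) (hp2 : p ≤ 2) {x y : ℝ} (hy : 0 ≤ y) (hxy : y ≤ x) :
    2 * (x ^ 2 + (p - 1) / 2 * y ^ 2) ^ (p / 2) ≤ (x + y) ^ p + (x - y) ^ p := by
  rcases hy.eq_or_lt with rfl | hy'
  · have := rpow_eq_sq_rpow hxy p
    simp [← this, two_mul]
  have hx : 0 < x := hy'.trans_le hxy
  have ht1 : y / x ≤ 1 := div_le_one_of_le₀ hxy hx.le
  have h1 := one_add_rpow_add_one_sub_rpow_ge hp hp2 (t := y / x) (by positivity) ht1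
  have h2 := rpow_one_add_le_one_add_mul_self (s := (p - 1) / 2 * (y / x) ^ 2)
    (by nlinarith [sq_nonneg (y / x)]) (p := p / 2) (by linarith) (by linarith)
  have e1 : x + y = x * (1 + y / x) := by field_simp
  have e2 : x - y = x * (1 - y / x) := by field_simp
  have e3 : x ^ 2 + (p - 1) / 2 * y ^ 2 = x ^ 2 * (1 + (p - 1) / 2 * (y / x) ^ 2) := by field_simp
  have hpm : 0 ≤ (p - 1) / 2 := by linarith
  rw [e1, e2, e3, Real.mul_rpow hx.le (by positivity), Real.mul_rpow hx.le (by linarith),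
    Real.mul_rpow (by positivity) (by positivity), ← rpow_eq_sq_rpow hx.le]
  have h3 : 2 * (1 + (p - 1) / 2 * (y / x) ^ 2) ^ (p / 2) ≤ (1 + y / x) ^ p + (1 - y / x) ^ p := by
    nlinarith
  have := mul_le_mul_of_nonneg_left h3 (Real.rpow_nonneg hx.le p)
  linarith

lemma add_rpow_add_sub_rpow_anti {q : ℝ} (hq : 0 ≤ q) (hq1 : q ≤ 1) {s r R : ℝ} (hr : |r| ≤ R)
    (hR : R ≤ s) : (s + R) ^ q + (s - R) ^ q ≤ (s + r) ^ q + (s - r) ^ q := by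
  have hR0 : 0 ≤ R := (abs_nonneg r).trans hr
  rcases hR0.eq_or_lt with rfl | hR'
  · have : r = 0 := abs_nonpos_iff.1 hr
    simp [this]
  have hc := Real.concaveOn_rpow hq hq1
  obtain ⟨h1, h2⟩ := abs_le.1 hr
  have ha : 0 ≤ (R + r) / (2 * R) := div_nonneg (by linarith) (by linarith)
  have hb : 0 ≤ (R - r) / (2 * R) := div_nonneg (by linarith) (by linarith)
  have hab : (R + r) / (2 * R) + (R - r) / (2 * R) = 1 := by field_simp; ring
  have hx : s + R ∈ Set.Ici (0 : ℝ) := Set.mem_Ici.2 (by linarith)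
  have hy : s - R ∈ Set.Ici (0 : ℝ) := Set.mem_Ici.2 (by linarith)
  have k1 := hc.2 hx hy ha hb hab
  have k2 := hc.2 hx hy hb ha (by rw [add_comm, hab])
  simp only [smul_eq_mul] at k1 k2
  have e1 : (R + r) / (2 * R) * (s + R) + (R - r) / (2 * R) * (s - R) = s + r := by field_simp; ring
  have e2 : (R - r) / (2 * R) * (s + R) + (R + r) / (2 * R) * (s - R) = s - r := by field_simp; ring
  rw [e1] at k1
  rw [e2] at k2
  have e3 : (R + r) / (2 * R) = 1 - (R - r) / (2 * R) := by linarith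
  rw [e3] at k1 k2
  linarith

lemma two_mul_le_norm_add_rpow_add_of_le (hp : 1 < p) (hp2 : p ≤ 2) {a b : ℂ} (h : ‖b‖ ≤ ‖a‖) :
    2 * (‖a‖ ^ 2 + (p - 1) / 2 * ‖b‖ ^ 2) ^ (p / 2) ≤ ‖a + b‖ ^ p + ‖a - b‖ ^ p := by
  refine (sq_add_rpow_le hp hp2 (norm_nonneg b) h).trans ?_
  rw [rpow_eq_sq_rpow (add_nonneg (norm_nonneg a) (norm_nonneg b)),
    rpow_eq_sq_rpow (sub_nonneg.2 h), rpow_eq_sq_rpow (norm_nonneg _),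
    rpow_eq_sq_rpow (norm_nonneg _)]
  have e1 : ‖a + b‖ ^ 2 = (‖a‖ ^ 2 + ‖b‖ ^ 2) + 2 * inner ℝ a b := by
    rw [norm_add_sq_real]; ring
  have e2 : ‖a - b‖ ^ 2 = (‖a‖ ^ 2 + ‖b‖ ^ 2) - 2 * inner ℝ a b := by
    rw [norm_sub_sq_real]; ring
  have e3 : (‖a‖ + ‖b‖) ^ 2 = (‖a‖ ^ 2 + ‖b‖ ^ 2) + 2 * (‖a‖ * ‖b‖) := by ring
  have e4 : (‖a‖ - ‖b‖) ^ 2 = (‖a‖ ^ 2 + ‖b‖ ^ 2) - 2 * (‖a‖ * ‖b‖) := by ring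
  rw [e1, e2, e3, e4]
  refine add_rpow_add_sub_rpow_anti (by linarith) (by linarith) ?_ ?_
  · rw [abs_mul, abs_two]
    exact mul_le_mul_of_nonneg_left (abs_real_inner_le_norm a b) two_pos.le
  · nlinarith [sq_nonneg (‖a‖ - ‖b‖)]

lemma two_mul_le_norm_add_rpow_add (hp : 1 < p) (hp2 : p ≤ 2) (a b : ℂ) :
    2 * (‖a‖ ^ 2 + (p - 1) / 2 * ‖b‖ ^ 2) ^ (p / 2) ≤ ‖a + b‖ ^ p + ‖a - b‖ ^ p := by
  rcases le_total ‖b‖ ‖a‖ with h | h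
  · exact two_mul_le_norm_add_rpow_add_of_le hp hp2 h
  · have h1 := two_mul_le_norm_add_rpow_add_of_le hp hp2 h
    rw [add_comm b a, norm_sub_rev b a] at h1
    refine le_trans ?_ h1
    have hp1 : 0 ≤ (p - 1) / 2 := by linarith
    gcongr 2 * ?_ ^ (p / 2)
    nlinarith [mul_nonneg (show 0 ≤ 1 - (p - 1) / 2 by linarith)
      (sub_nonneg.2 (pow_le_pow_left₀ (norm_nonneg a) h 2))]

end Scalar

section LpConvexity

variable {p : ℝ} {X : Type*} [MeasurableSpace X] {μ : Measure X}

lemma norm_rpow_eq_integral (hp : 0 < p) (F : Lp ℂ (ENNReal.ofReal p) μ) :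
    ‖F‖ ^ p = ∫ x, ‖F x‖ ^ p ∂μ := by
  rw [Lp.norm_def, MemLp.eLpNorm_eq_integral_rpow_norm (ENNReal.ofReal_pos.2 hp).ne'
    ENNReal.ofReal_ne_top (Lp.memLp F), ENNReal.toReal_ofReal (by positivity),
    ENNReal.toReal_ofReal hp.le, Real.rpow_inv_rpow (integral_nonneg fun x => by positivity) hp.ne']

lemma integrable_norm_rpow_Lp (hp : 0 < p) (F : Lp ℂ (ENNReal.ofReal p) μ) :
    Integrable (fun x => ‖F x‖ ^ p) μ := by
  have := (Lp.memLp F).integrable_norm_rpow (ENNReal.ofReal_pos.2 hp).ne' ENNReal.ofReal_ne_top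
  rwa [ENNReal.toReal_ofReal hp.le] at this

lemma norm_rpow_add_le_of_pointwise (hp : 0 < p) {A B : ℝ}
    (h : ∀ a b : ℂ, ‖a + b‖ ^ p + ‖a - b‖ ^ p ≤ A * ‖a‖ ^ p + B * ‖b‖ ^ p)
    (F G : Lp ℂ (ENNReal.ofReal p) μ) :
    ‖F + G‖ ^ p + ‖F - G‖ ^ p ≤ A * ‖F‖ ^ p + B * ‖G‖ ^ p := by
  simp only [norm_rpow_eq_integral hp]
  rw [← integral_const_mul, ← integral_const_mul,
    ← integral_add (integrable_norm_rpow_Lp hp _) (integrable_norm_rpow_Lp hp _),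
    ← integral_add ((integrable_norm_rpow_Lp hp _).const_mul _)
      ((integrable_norm_rpow_Lp hp _).const_mul _)]
  refine integral_mono_ae ((integrable_norm_rpow_Lp hp _).add (integrable_norm_rpow_Lp hp _))
    (((integrable_norm_rpow_Lp hp _).const_mul _).add
      ((integrable_norm_rpow_Lp hp _).const_mul _)) ?_
  filter_upwards [Lp.coeFn_add F G, Lp.coeFn_sub F G] with x h1 h2
  rw [h1, h2]
  exact h _ _

lemma le_norm_rpow_add_of_pointwise (hp : 0 < p) {A B : ℝ}
    (h : ∀ a b : ℂ, A * ‖a‖ ^ p + B * ‖b‖ ^ p ≤ ‖a + b‖ ^ p + ‖a - b‖ ^ p)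
    (F G : Lp ℂ (ENNReal.ofReal p) μ) :
    A * ‖F‖ ^ p + B * ‖G‖ ^ p ≤ ‖F + G‖ ^ p + ‖F - G‖ ^ p := by
  simp only [norm_rpow_eq_integral hp]
  rw [← integral_const_mul, ← integral_const_mul,
    ← integral_add (integrable_norm_rpow_Lp hp _) (integrable_norm_rpow_Lp hp _),
    ← integral_add ((integrable_norm_rpow_Lp hp _).const_mul _)
      ((integrable_norm_rpow_Lp hp _).const_mul _)]
  refine integral_mono_ae (((integrable_norm_rpow_Lp hp _).const_mul _).add
      ((integrable_norm_rpow_Lp hp _).const_mul _))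
      ((integrable_norm_rpow_Lp hp _).add (integrable_norm_rpow_Lp hp _)) ?_
  filter_upwards [Lp.coeFn_add F G, Lp.coeFn_sub F G] with x h1 h2
  rw [h1, h2]
  exact h _ _

/-- Normalizing weights turning `(s + t) ^ q` into a convex combination. -/
lemma add_eq_convex_comb {U V : ℝ} (hU : 0 < U) (hV : 0 < V) (s t : ℝ) :
    s + t = (U + V) * (U / (U + V) * (s / U) + V / (U + V) * (t / V)) := by
  field_simp

lemma rpow_add_le_weighted {q U V s t : ℝ} (hq : 1 ≤ q) (hU : 0 < U) (hV : 0 < V) (hs : 0 ≤ s)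
    (ht : 0 ≤ t) : (s + t) ^ q ≤
      (U + V) ^ q * (U / (U + V) * (s ^ q / U ^ q) + V / (U + V) * (t ^ q / V ^ q)) := by
  rw [add_eq_convex_comb hU hV, Real.mul_rpow (by positivity) (by positivity),
    ← Real.div_rpow hs hU.le, ← Real.div_rpow ht hV.le]
  refine mul_le_mul_of_nonneg_left ?_ (by positivity)
  exact (convexOn_rpow hq).2 (Set.mem_Ici.2 (show 0 ≤ s / U by positivity))
    (Set.mem_Ici.2 (show 0 ≤ t / V by positivity)) (show 0 ≤ U / (U + V) by positivity)
    (show 0 ≤ V / (U + V) by positivity) (by field_simp)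

lemma weighted_le_rpow_add {q U V s t : ℝ} (hq : 0 ≤ q) (hq1 : q ≤ 1) (hU : 0 < U) (hV : 0 < V)
    (hs : 0 ≤ s) (ht : 0 ≤ t) :
      (U + V) ^ q * (U / (U + V) * (s ^ q / U ^ q) + V / (U + V) * (t ^ q / V ^ q)) ≤
        (s + t) ^ q := by
  rw [add_eq_convex_comb hU hV s t, Real.mul_rpow (by positivity) (by positivity),
    ← Real.div_rpow hs hU.le, ← Real.div_rpow ht hV.le]
  refine mul_le_mul_of_nonneg_left ?_ (by positivity)
  exact (Real.concaveOn_rpow hq hq1).2 (Set.mem_Ici.2 (show 0 ≤ s / U by positivity))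
    (Set.mem_Ici.2 (show 0 ≤ t / V by positivity)) (show 0 ≤ U / (U + V) by positivity)
    (show 0 ≤ V / (U + V) by positivity) (by field_simp)

lemma weighted_self {q U V κ a b : ℝ} (hU : 0 < U) (hV : 0 < V) (hκ : 0 ≤ κ) (ha : 0 ≤ a)
    (hb : 0 ≤ b) (haU : a ^ 2 = U) (hbV : κ * b ^ 2 = V) :
    2 * (U + V) ^ q * (U / (U + V)) / U ^ q * a ^ (2 * q) +
      2 * (U + V) ^ q * (V / (U + V)) * κ ^ q / V ^ q * b ^ (2 * q) = 2 * (U + V) ^ q := by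
  have e1 : a ^ (2 * q) = U ^ q := by rw [rpow_eq_sq_rpow ha, haU]; congr 1; ring
  have e2 : κ ^ q * b ^ (2 * q) = V ^ q := by
    rw [rpow_eq_sq_rpow hb, ← hbV, Real.mul_rpow hκ (by positivity)]; congr 2; ring
  have hUq : 0 < U ^ q := by positivity
  have hVq : 0 < V ^ q := by positivity
  rw [e1]
  have : 2 * (U + V) ^ q * (V / (U + V)) * κ ^ q / V ^ q * b ^ (2 * q) =
    2 * (U + V) ^ q * (V / (U + V)) * ((κ ^ q * b ^ (2 * q)) / V ^ q) := by ring
  rw [this, e2, div_self hVq.ne']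
  field_simp

/-- The uniform smoothness inequality of `L_p` with power `min 2 p`. -/
lemma exists_norm_add_rpow_le [Fact (1 ≤ ENNReal.ofReal p)] (hp : 1 < p) :
    ∃ K : ℝ, 0 ≤ K ∧ ∀ F G : Lp ℂ (ENNReal.ofReal p) μ,
      ‖F + G‖ ^ min 2 p + ‖F - G‖ ^ min 2 p ≤ 2 * ‖F‖ ^ min 2 p + K * ‖G‖ ^ min 2 p := by
  have hp0 : 0 < p := by linarith
  rcases le_total p 2 with hp2 | hp2
  · rw [min_eq_right hp2]
    exact ⟨2, by norm_num, norm_rpow_add_le_of_pointwise hp0 (norm_add_rpow_add_le hp hp2)⟩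
  rw [min_eq_left hp2]
  set κ := Real.exp (p + 1)
  have hκ : 1 ≤ κ := Real.one_le_exp (by linarith)
  refine ⟨2 * κ, by positivity, fun F G => ?_⟩
  simp only [Real.rpow_two]
  rcases eq_or_ne F 0 with rfl | hF
  · simp only [zero_add, zero_sub, norm_neg, norm_zero]
    nlinarith [sq_nonneg ‖G‖]
  rcases eq_or_ne G 0 with rfl | hG
  · simp only [add_zero, sub_zero, norm_zero]
    linarith
  have hF' := norm_pos_iff.2 hF
  have hG' := norm_pos_iff.2 hG
  set U : ℝ := ‖F‖ ^ 2 with hUd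
  set V : ℝ := κ * ‖G‖ ^ 2 with hVd
  have hU : 0 < U := by positivity
  have hV : 0 < V := by positivity
  have hpq : 2 * (p / 2) = p := by ring
  have h1 := norm_rpow_add_le_of_pointwise (μ := μ) hp0
    (A := 2 * (U + V) ^ (p / 2) * (U / (U + V)) / U ^ (p / 2))
    (B := 2 * (U + V) ^ (p / 2) * (V / (U + V)) * κ ^ (p / 2) / V ^ (p / 2)) (fun a b => by
      refine (norm_add_rpow_add_le_two_mul hp2 a b).trans ?_
      have := rpow_add_le_weighted (q := p / 2) (by linarith) hU hV (sq_nonneg ‖a‖)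
        (t := κ * ‖b‖ ^ 2) (by positivity)
      rw [Real.mul_rpow (by positivity) (by positivity), ← rpow_eq_sq_rpow (norm_nonneg a),
        ← rpow_eq_sq_rpow (norm_nonneg b)] at this
      refine (mul_le_mul_of_nonneg_left this two_pos.le).trans_eq ?_
      ring) F G
  have h2 := weighted_self (q := p / 2) hU hV (by positivity) hF'.le hG'.le hUd.symm hVd.symm
  rw [hpq] at h2
  rw [h2] at h1
  have hc := (convexOn_rpow (p := p / 2) (by linarith)).2 (Set.mem_Ici.2 (sq_nonneg ‖F + G‖))
    (Set.mem_Ici.2 (sq_nonneg ‖F - G‖))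
    (show (0 : ℝ) ≤ 1 / 2 by norm_num) (show (0 : ℝ) ≤ 1 / 2 by norm_num) (by norm_num)
  simp only [smul_eq_mul, ← rpow_eq_sq_rpow (norm_nonneg _)] at hc
  have h3 := (Real.rpow_le_rpow_iff (by positivity) (by positivity) (by positivity)).1
    (hc.trans (show _ ≤ (U + V) ^ (p / 2) by linarith))
  linarith

/-- The uniform convexity inequality of `L_p` with power `max 2 p`. -/
lemma exists_le_norm_add_rpow [Fact (1 ≤ ENNReal.ofReal p)] (hp : 1 < p) :
    ∃ κ : ℝ, 0 < κ ∧ ∀ F G : Lp ℂ (ENNReal.ofReal p) μ,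
      2 * ‖F‖ ^ max 2 p + κ * ‖G‖ ^ max 2 p ≤ ‖F + G‖ ^ max 2 p + ‖F - G‖ ^ max 2 p := by
  have hp0 : 0 < p := by linarith
  rcases le_total p 2 with hp2 | hp2
  swap
  · rw [max_eq_right hp2]
    exact ⟨2, by norm_num, le_norm_rpow_add_of_pointwise hp0 (le_norm_add_rpow_add hp2)⟩
  rw [max_eq_left hp2]
  set κ := (p - 1) / 2
  have hκ : 0 < κ := by simp only [κ]; linarith
  have hκ1 : κ ≤ 1 := by simp only [κ]; linarith
  refine ⟨2 * κ, by positivity, fun F G => ?_⟩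
  simp only [Real.rpow_two]
  rcases eq_or_ne F 0 with rfl | hF
  · simp only [zero_add, zero_sub, norm_neg, norm_zero]
    nlinarith [sq_nonneg ‖G‖]
  rcases eq_or_ne G 0 with rfl | hG
  · simp only [add_zero, sub_zero, norm_zero]
    linarith
  have hF' := norm_pos_iff.2 hF
  have hG' := norm_pos_iff.2 hG
  set U : ℝ := ‖F‖ ^ 2 with hUd
  set V : ℝ := κ * ‖G‖ ^ 2 with hVd
  have hU : 0 < U := by positivity
  have hV : 0 < V := by positivity
  have hpq : 2 * (p / 2) = p := by ring
  have h1 := le_norm_rpow_add_of_pointwise (μ := μ) hp0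
    (A := 2 * (U + V) ^ (p / 2) * (U / (U + V)) / U ^ (p / 2))
    (B := 2 * (U + V) ^ (p / 2) * (V / (U + V)) * κ ^ (p / 2) / V ^ (p / 2)) (fun a b => by
      refine le_trans ?_ (two_mul_le_norm_add_rpow_add hp hp2 a b)
      have := weighted_le_rpow_add (q := p / 2) (by linarith) (by linarith) hU hV
        (sq_nonneg ‖a‖) (t := κ * ‖b‖ ^ 2) (by positivity)
      rw [Real.mul_rpow (by positivity) (by positivity), ← rpow_eq_sq_rpow (norm_nonneg a),
        ← rpow_eq_sq_rpow (norm_nonneg b)] at this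
      refine le_trans (le_of_eq ?_) (mul_le_mul_of_nonneg_left this two_pos.le)
      ring) F G
  have h2 := weighted_self (q := p / 2) hU hV hκ.le hF'.le hG'.le hUd.symm hVd.symm
  rw [hpq] at h2
  rw [h2] at h1
  have hc := (Real.concaveOn_rpow (p := p / 2) (by linarith) (by linarith)).2
    (Set.mem_Ici.2 (sq_nonneg ‖F + G‖)) (Set.mem_Ici.2 (sq_nonneg ‖F - G‖))
    (show (0 : ℝ) ≤ 1 / 2 by norm_num) (show (0 : ℝ) ≤ 1 / 2 by norm_num) (by norm_num)
  simp only [smul_eq_mul, ← rpow_eq_sq_rpow (norm_nonneg _)] at hc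
  have h3 := (Real.rpow_le_rpow_iff (by positivity) (by positivity) (by positivity)).1
    ((show (U + V) ^ (p / 2) ≤ _ by linarith).trans hc)
  linarith

end LpConvexity

lemma sum_rpow_le_of_recursion {τ r C : ℝ} (hτ : 1 ≤ τ) (hr0 : 0 ≤ r) (hr1 : r < 1) (hC : 0 ≤ C) :
    ∃ D : ℝ, 0 ≤ D ∧ ∀ L b : ℕ → ℝ, (∀ k, 0 ≤ L k) → (∀ k, 0 ≤ b k) →
      (∀ k, L (k + 1) ≤ r * L k + C * b k) → ∀ N,
      ∑ k ∈ Finset.range N, L (k + 1) ^ τ ≤ D * (L 0 ^ τ + ∑ k ∈ Finset.range N, b k ^ τ) := by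
  have h1r : 0 < 1 - r := by linarith
  set B : ℝ := (1 - r) * (C / (1 - r)) ^ τ with hB
  have hB0 : 0 ≤ B := by positivity
  refine ⟨(r + B) / (1 - r), by positivity, fun L b hL hb hrec N => ?_⟩
  have step : ∀ k, L (k + 1) ^ τ ≤ r * L k ^ τ + B * b k ^ τ := fun k => by
    have hc := (convexOn_rpow hτ).2 (Set.mem_Ici.2 (hL k))
      (Set.mem_Ici.2 (show 0 ≤ C / (1 - r) * b k from mul_nonneg (by positivity) (hb k)))
      hr0 h1r.le (by ring)
    simp only [smul_eq_mul] at hc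
    refine (Real.rpow_le_rpow (hL _) ((hrec k).trans (le_of_eq ?_)) (by linarith)).trans
      (hc.trans (le_of_eq ?_))
    · field_simp
    · rw [Real.mul_rpow (by positivity) (hb k), hB]; ring
  have key : ∀ N, (1 - r) * ∑ k ∈ Finset.range N, L (k + 1) ^ τ + r * L N ^ τ ≤
      r * L 0 ^ τ + B * ∑ k ∈ Finset.range N, b k ^ τ := fun N => by
    induction N with
    | zero => simp
    | succ N ih =>
      rw [Finset.sum_range_succ, Finset.sum_range_succ]
      linarith [step N]
  have hL0 : 0 ≤ L 0 ^ τ := Real.rpow_nonneg (hL 0) _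
  have hS : 0 ≤ ∑ k ∈ Finset.range N, b k ^ τ :=
    Finset.sum_nonneg fun k _ => Real.rpow_nonneg (hb k) _
  rw [div_mul_eq_mul_div, le_div_iff₀ h1r]
  nlinarith [key N, mul_nonneg hr0 (Real.rpow_nonneg (hL N) τ), mul_nonneg hr0 hS,
    mul_nonneg hB0 hL0]

lemma sum_le_of_add_le {E b : ℕ → ℝ} (h : ∀ k, E (k + 1) + b k ≤ E k) (hE : ∀ k, 0 ≤ E k) (N : ℕ) :
    ∑ k ∈ Finset.range N, b k ≤ E 0 := by
  have : ∀ N, ∑ k ∈ Finset.range N, b k + E N ≤ E 0 := fun N => by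
    induction N with
    | zero => simp
    | succ N ih => rw [Finset.sum_range_succ]; linarith [h N]
  linarith [this N, hE N]

lemma le_add_sum_of_le_add {E b : ℕ → ℝ} (h : ∀ k, E k ≤ E (k + 1) + b k) (N : ℕ) :
    E 0 ≤ E N + ∑ k ∈ Finset.range N, b k := by
  induction N with
  | zero => simp
  | succ N ih => rw [Finset.sum_range_succ]; linarith [h N]

section Best

variable {d : ℕ} {p α : ℝ} [Fact (1 ≤ ENNReal.ofReal p)]

/-- The combination with coefficients `c` over `s` is a best approximation to `F` among the
combinations of characters with frequencies of norm at most `n`. -/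
def IsBest (F : Lp ℂ (ENNReal.ofReal p) (torusMeasure d)) (n : ℝ) (s : Finset (Fin d → ℤ))
    (c : (Fin d → ℤ) → ℂ) : Prop :=
  (∀ k ∈ s, intNorm k ≤ n) ∧ ∀ (t : Finset (Fin d → ℤ)) (b : (Fin d → ℤ) → ℂ),
    (∀ k ∈ t, intNorm k ≤ n) → ‖F - comb (charLp p) s c‖ ≤ ‖F - comb (charLp p) t b‖

/-- The norm of the fractional Laplacian of a trigonometric polynomial. -/
noncomputable def lapNorm (p α : ℝ) [Fact (1 ≤ ENNReal.ofReal p)] (s : Finset (Fin d → ℤ))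
    (c : (Fin d → ℤ) → ℂ) : ℝ :=
  ‖comb (charLp p) s (fun k => ((intNorm k ^ α : ℝ) : ℂ) * c k)‖

lemma exists_comb_add {X : Type*} [NormedAddCommGroup X] [NormedSpace ℂ X] {e : (Fin d → ℤ) → X}
    {n : ℝ} {s t : Finset (Fin d → ℤ)} (hs : ∀ k ∈ s, intNorm k ≤ n) (ht : ∀ k ∈ t, intNorm k ≤ n)
    (c b : (Fin d → ℤ) → ℂ) (x y : ℂ) : ∃ (u : Finset (Fin d → ℤ)) (g : (Fin d → ℤ) → ℂ),
      (∀ k ∈ u, intNorm k ≤ n) ∧ ∀ m : (Fin d → ℤ) → ℂ, comb e u (fun k => m k * g k) =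
        x • comb e s (fun k => m k * c k) + y • comb e t (fun k => m k * b k) := by
  classical
  refine ⟨s ∪ t, fun k => x * (if k ∈ s then c k else 0) + y * (if k ∈ t then b k else 0),
    fun k hk => (Finset.mem_union.1 hk).elim (hs k) (ht k), fun m => ?_⟩
  rw [comb_subset (Finset.subset_union_left : s ⊆ s ∪ t) fun k => m k * c k,
    comb_subset (Finset.subset_union_right : t ⊆ s ∪ t) fun k => m k * b k,
    ← comb_smul, ← comb_smul, ← comb_add]
  refine comb_congr fun k _ => ?_
  dsimp only
  split_ifs <;> ring

lemma exists_comb_add' {X : Type*} [NormedAddCommGroup X] [NormedSpace ℂ X] {e : (Fin d → ℤ) → X}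
    {n : ℝ} {s t : Finset (Fin d → ℤ)} (hs : ∀ k ∈ s, intNorm k ≤ n) (ht : ∀ k ∈ t, intNorm k ≤ n)
    (c b : (Fin d → ℤ) → ℂ) (x y : ℂ) : ∃ (u : Finset (Fin d → ℤ)) (g : (Fin d → ℤ) → ℂ),
      (∀ k ∈ u, intNorm k ≤ n) ∧ comb e u g = x • comb e s c + y • comb e t b := by
  obtain ⟨u, g, hu, h⟩ := exists_comb_add (e := e) hs ht c b x y
  exact ⟨u, g, hu, by simpa using h 1⟩

lemma exists_best_rpow_add_le (hp : 1 < p) : ∃ κ : ℝ, 0 < κ ∧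
    ∀ (F : Lp ℂ (ENNReal.ofReal p) (torusMeasure d)) (n : ℝ) s c t b, IsBest F n s c →
      (∀ k ∈ t, intNorm k ≤ n) →
      ‖F - comb (charLp p) s c‖ ^ max 2 p +
        κ * ‖comb (charLp p) s c - comb (charLp p) t b‖ ^ max 2 p ≤
      ‖F - comb (charLp p) t b‖ ^ max 2 p := by
  obtain ⟨κ, hκ, h⟩ := exists_le_norm_add_rpow (μ := torusMeasure d) hp
  refine ⟨κ * (1 / 2) ^ max 2 p, by positivity, fun F n s c t b hbest ht => ?_⟩
  obtain ⟨u, g, hu, hg⟩ := exists_comb_add' (e := charLp p) hbest.1 ht c b (1 / 2) (1 / 2)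
  set S := comb (charLp p) s c
  set T := comb (charLp p) t b
  have h1 := h (F - comb (charLp p) u g) ((1 / 2 : ℂ) • (S - T))
  have h2 := hbest.2 u g hu
  have e1 : F - comb (charLp p) u g + (1 / 2 : ℂ) • (S - T) = F - T := by
    rw [hg]; module
  have e2 : F - comb (charLp p) u g - (1 / 2 : ℂ) • (S - T) = F - S := by
    rw [hg]; module
  rw [e1, e2, norm_smul, Real.mul_rpow (norm_nonneg _) (norm_nonneg _)] at h1
  have h3 : ‖F - S‖ ^ max 2 p ≤ ‖F - comb (charLp p) u g‖ ^ max 2 p :=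
    Real.rpow_le_rpow (norm_nonneg _) h2 (by positivity)
  have h4 : ‖(1 / 2 : ℂ)‖ = 1 / 2 := by norm_num
  rw [h4] at h1
  nlinarith

lemma exists_rpow_le_best_rpow_add (hp : 1 < p) : ∃ K : ℝ, 0 ≤ K ∧
    ∀ (F : Lp ℂ (ENNReal.ofReal p) (torusMeasure d)) (n : ℝ) s c t b, IsBest F n s c →
      (∀ k ∈ t, intNorm k ≤ n) →
      ‖F - comb (charLp p) s c + comb (charLp p) t b‖ ^ min 2 p ≤
      ‖F - comb (charLp p) s c‖ ^ min 2 p + K * ‖comb (charLp p) t b‖ ^ min 2 p := by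
  obtain ⟨K, hK, h⟩ := exists_norm_add_rpow_le (μ := torusMeasure d) hp
  refine ⟨K, hK, fun F n s c t b hbest ht => ?_⟩
  obtain ⟨u, g, hu, hg⟩ := exists_comb_add' (e := charLp p) hbest.1 ht c b 1 1
  have h1 := h (F - comb (charLp p) s c) (comb (charLp p) t b)
  have h2 := hbest.2 u g hu
  rw [hg, one_smul, one_smul, ← sub_sub] at h2
  have h3 := Real.rpow_le_rpow (norm_nonneg _) h2 (show 0 ≤ min 2 p by positivity)
  linarith

open Classical in
lemma exists_best_le_modulus (hd : 0 < d) (hp : 0 < p) {K : ℝ} (hK : RieszBound d p K)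
    (hα : 0 < α) : ∃ C, 0 ≤ C ∧ ∀ (F : Lp ℂ (ENNReal.ofReal p) (torusMeasure d)) (N : ℝ), 0 < N →
      (∀ ε > 0, ∃ s c, ‖F - comb (charLp p) s c‖ ≤ ε) → ∀ s c, IsBest F N s c →
      ∀ W, (∀ h, euclNorm h ≤ 1 / N → ∀ s c,
        ‖comb (charLp p) s (fun k => diffSymbol α (dot k h) * c k)‖ ≤
          W + binomMass α * ‖F - comb (charLp p) s c‖) →
      ‖F - comb (charLp p) s c‖ ≤ C * W := by
  obtain ⟨C, hC, h⟩ := exists_norm_outside_le_of_diff hd hp hK hα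
  refine ⟨C, hC, fun F N hN hdense s c hbest W hW => ?_⟩
  refine le_of_forall_pos_le_add fun ε hε => ?_
  have hM := binomMass_nonneg (α := α)
  have hden : 0 < 1 + C * binomMass α := by positivity
  obtain ⟨t, b, htb⟩ := hdense (ε / (1 + C * binomMass α)) (by positivity)
  have h1 := h N t hN b (W + binomMass α * ‖F - comb (charLp p) t b‖) fun y hy => hW y hy t b
  have h2 := hbest.2 (t.filter (InBox N)) b fun k hk =>
    intNorm_le_of_inBox hN.le (Finset.mem_filter.1 hk).2
  have h3 : F - comb (charLp p) (t.filter (InBox N)) b =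
      (F - comb (charLp p) t b) + comb (charLp p) t (fun k => if InBox N k then 0 else b k) := by
    rw [sub_add, ← comb_sub, comb, comb, Finset.sum_filter]
    congr 1
    refine Finset.sum_congr rfl fun k _ => ?_
    split_ifs <;> simp
  rw [h3] at h2
  rw [le_div_iff₀ hden] at htb
  calc _ ≤ _ := h2
    _ ≤ _ := norm_add_le _ _
    _ ≤ _ := by linarith

end Best

variable {d : ℕ} {p α : ℝ} [Fact (1 ≤ ENNReal.ofReal p)]

lemma two_pow_rpow_neg_mul (m : ℕ) : ((2 : ℝ) ^ m) ^ (-α) * ((2 : ℝ) ^ m) ^ α = 1 := by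
  rw [← Real.rpow_add (by positivity), neg_add_cancel, Real.rpow_zero]

lemma two_pow_succ_rpow_neg (m : ℕ) :
    ((2 : ℝ) ^ (m + 1)) ^ (-α) = 2 ^ (-α) * ((2 : ℝ) ^ m) ^ (-α) := by
  rw [pow_succ', Real.mul_rpow (by positivity) (by positivity)]

lemma exists_lapNorm_succ_le (hd : 0 < d) {K : ℝ} (hK : RieszBound d p K) (hα : 0 < α) :
    ∃ C : ℝ, 0 ≤ C ∧ ∀ (m : ℕ) (s t : Finset (Fin d → ℤ)) (c b : (Fin d → ℤ) → ℂ),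
      (∀ k ∈ s, intNorm k ≤ 2 ^ m) → (∀ k ∈ t, intNorm k ≤ 2 ^ (m + 1)) →
      ((2 : ℝ) ^ (m + 1)) ^ (-α) * lapNorm p α t b ≤
        2 ^ (-α) * (((2 : ℝ) ^ m) ^ (-α) * lapNorm p α s c) +
          C * ‖comb (charLp p) t b - comb (charLp p) s c‖ := by
  obtain ⟨C, hC, h⟩ := exists_isMult_rpow_intNorm hd hK hα
  refine ⟨C, hC, fun m s t c b hs ht => ?_⟩
  obtain ⟨u, g, hu, hg⟩ := exists_comb_add (e := charLp p) ht
    (fun k hk => (hs k hk).trans (pow_le_pow_right₀ one_le_two m.le_succ)) b c 1 (-1)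
  have h0 : comb (charLp p) u g = comb (charLp p) t b - comb (charLp p) s c := by
    have := hg 1
    simpa [sub_eq_add_neg] using this
  have h1 := h (2 ^ (m + 1)) u (by positivity) hu g
  rw [hg, h0, one_smul, neg_one_smul, ← sub_eq_add_neg] at h1
  have h2 : lapNorm p α t b ≤ lapNorm p α s c +
      C * (2 ^ (m + 1)) ^ α * ‖comb (charLp p) t b - comb (charLp p) s c‖ := by
    have := (norm_sub_norm_le _ _).trans h1
    simp only [lapNorm]
    linarith
  have hpos : 0 < ((2 : ℝ) ^ (m + 1)) ^ (-α) := by positivity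
  refine (mul_le_mul_of_nonneg_left h2 hpos.le).trans (le_of_eq ?_)
  have e := two_pow_rpow_neg_mul (α := α) (m + 1)
  rw [mul_add, ← mul_assoc _ _ (lapNorm p α s c), ← two_pow_succ_rpow_neg]
  linear_combination (C * ‖comb (charLp p) t b - comb (charLp p) s c‖) * e

theorem exists_sum_lapNorm_le (hd : 0 < d) (hp : 1 < p) (hα : 0 < α) :
    ∃ C : ℝ, 0 ≤ C ∧ ∀ F : Lp ℂ (ENNReal.ofReal p) (torusMeasure d),
      (∀ ε > 0, ∃ s c, ‖F - comb (charLp p) s c‖ ≤ ε) →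
      ∀ (s : ℕ → Finset (Fin d → ℤ)) (c : ℕ → (Fin d → ℤ) → ℂ), (∀ k : ℕ, IsBest F (2 ^ k) (s k) (c k)) → ∀ (n : ℕ) (W : ℝ), 0 ≤ W →
      (∀ h, euclNorm h ≤ 1 / 2 ^ n → ∀ s c,
        ‖comb (charLp p) s (fun k => diffSymbol α (dot k h) * c k)‖ ≤
          W + binomMass α * ‖F - comb (charLp p) s c‖) → ∀ N : ℕ,
      ∑ k ∈ Finset.range N, (((2 : ℝ) ^ (n + 1 + k)) ^ (-α) *
        lapNorm p α (s (n + 1 + k)) (c (n + 1 + k))) ^ max 2 p ≤ C * W ^ max 2 p := by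
  have hp0 : 0 < p := by linarith
  obtain ⟨K, hK⟩ := exists_rieszBound hp d
  obtain ⟨C₁, hC₁, h₁⟩ := exists_lapNorm_succ_le hd hK hα
  obtain ⟨κ, hκ, h₂⟩ := exists_best_rpow_add_le (d := d) hp
  obtain ⟨C₃, hC₃, h₃⟩ := exists_best_le_modulus hd hp0 hK hα
  obtain ⟨C₄, hC₄, h₄⟩ := exists_norm_rpow_intNorm_le hd hp0 hK hα
  have hτ : 1 ≤ max 2 p := le_max_of_le_right hp.le
  have hτ0 : 0 ≤ max 2 p := by linarith
  have hr1 : (2 : ℝ) ^ (-α) < 1 := Real.rpow_lt_one_of_one_lt_of_neg one_lt_two (by linarith)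
  obtain ⟨D, hD, h₅⟩ := sum_rpow_le_of_recursion hτ (by positivity) hr1 hC₁
  have hM := binomMass_nonneg (α := α)
  refine ⟨D * ((C₄ * (1 + binomMass α * C₃)) ^ max 2 p + κ⁻¹ * C₃ ^ max 2 p), by positivity,
    fun F hF s c hbest n W hW hWh N => ?_⟩
  have hE := h₃ F (2 ^ n) (by positivity) hF _ _ (hbest n) W hWh
  have hL := h₄ (2 ^ n) (s n) (by positivity) (hbest n).1 (c n) ((1 + binomMass α * C₃) * W)
    fun h hh => (hWh h hh (s n) (c n)).trans (by nlinarith [mul_le_mul_of_nonneg_left hE hM])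
  have hsum := sum_le_of_add_le
    (E := fun j => ‖F - comb (charLp p) (s (n + j)) (c (n + j))‖ ^ max 2 p)
    (b := fun j => κ * ‖comb (charLp p) (s (n + (j + 1))) (c (n + (j + 1))) -
      comb (charLp p) (s (n + j)) (c (n + j))‖ ^ max 2 p)
    (fun j => h₂ F _ _ _ _ _ (hbest (n + (j + 1))) fun k hk =>
      ((hbest (n + j)).1 k hk).trans (pow_le_pow_right₀ one_le_two (by omega)))
    (fun j => by positivity) N
  rw [← Finset.mul_sum] at hsum
  have hrec := h₅ (fun j => ((2 : ℝ) ^ (n + j)) ^ (-α) * lapNorm p α (s (n + j)) (c (n + j)))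
    (fun j => ‖comb (charLp p) (s (n + (j + 1))) (c (n + (j + 1))) -
      comb (charLp p) (s (n + j)) (c (n + j))‖)
    (fun j => mul_nonneg (by positivity) (norm_nonneg _)) (fun j => norm_nonneg _)
    (fun j => h₁ (n + j) _ _ _ _ (hbest (n + j)).1 (hbest (n + (j + 1))).1) N
  simp only [add_zero] at hrec hsum
  have e1 : (((2 : ℝ) ^ n) ^ (-α) * lapNorm p α (s n) (c n)) ^ max 2 p ≤
      (C₄ * (1 + binomMass α * C₃)) ^ max 2 p * W ^ max 2 p := by
    rw [← Real.mul_rpow (by positivity) hW]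
    exact Real.rpow_le_rpow (mul_nonneg (by positivity) (norm_nonneg _))
      (hL.trans (le_of_eq (by ring))) hτ0
  have e2 := hsum.trans (Real.rpow_le_rpow (norm_nonneg _) hE hτ0)
  rw [Real.mul_rpow hC₃ hW, ← le_div_iff₀' hκ] at e2
  have e3 : ∀ k, n + 1 + k = n + (k + 1) := fun k => by ring
  simp only [e3]
  refine hrec.trans ?_
  rw [mul_assoc]
  refine mul_le_mul_of_nonneg_left ?_ hD
  refine (add_le_add e1 e2).trans (le_of_eq ?_)
  rw [div_eq_inv_mul]; ring

open Classical in
lemma exists_best_rpow_le_succ (hp : 1 < p) (hα : 0 < α) :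
    ∃ C : ℝ, 0 ≤ C ∧ ∀ (F : Lp ℂ (ENNReal.ofReal p) (torusMeasure d)) (m : ℕ) s c t b,
      IsBest F (2 ^ m) s c → IsBest F (2 ^ (m + 1)) t b →
      ‖F - comb (charLp p) s c‖ ^ min 2 p ≤ ‖F - comb (charLp p) t b‖ ^ min 2 p +
        C * (((2 : ℝ) ^ (m + 1)) ^ (-α) * lapNorm p α t b) ^ min 2 p := by
  have hp0 : 0 < p := by linarith
  obtain ⟨K, hK⟩ := exists_rieszBound hp d
  obtain ⟨C₁, hC₁, h₁⟩ := exists_norm_outside_le_of_laplacian hK hα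
  obtain ⟨C₂, hC₂, h₂⟩ := exists_rpow_le_best_rpow_add (d := d) hp
  have hθ : 0 ≤ min 2 p := by positivity
  refine ⟨C₂ * (C₁ * 2 ^ α) ^ min 2 p, by positivity, fun F m s c t b hs ht => ?_⟩
  have hin := hs.2 (t.filter (InBox (2 ^ m))) b fun k hk =>
    intNorm_le_of_inBox (by positivity) (Finset.mem_filter.1 hk).2
  have hout := h₁ (2 ^ m) t (by positivity) b
  have e3 : F - comb (charLp p) (t.filter (InBox (2 ^ m))) b = (F - comb (charLp p) t b) +
      comb (charLp p) t (fun k => if InBox (2 ^ m) k then 0 else b k) := by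
    rw [sub_add, ← comb_sub, comb, comb, Finset.sum_filter]
    congr 1
    refine Finset.sum_congr rfl fun k _ => ?_
    split_ifs <;> simp
  rw [e3] at hin
  refine (Real.rpow_le_rpow (norm_nonneg _) hin hθ).trans
    ((h₂ F _ _ _ _ _ ht ht.1).trans (add_le_add le_rfl ?_))
  rw [mul_assoc]
  refine mul_le_mul_of_nonneg_left ?_ hC₂
  have hl : 0 ≤ ((2 : ℝ) ^ (m + 1)) ^ (-α) * lapNorm p α t b :=
    mul_nonneg (by positivity) (norm_nonneg _)
  rw [← Real.mul_rpow (by positivity) hl]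
  refine Real.rpow_le_rpow (norm_nonneg _) (hout.trans (le_of_eq ?_)) hθ
  rw [two_pow_succ_rpow_neg]
  have : (2 : ℝ) ^ α * 2 ^ (-α) = 1 := by
    rw [← Real.rpow_add two_pos, add_neg_cancel, Real.rpow_zero]
  simp only [lapNorm]
  linear_combination (-(C₁ * (((2 : ℝ) ^ m) ^ (-α) *
    ‖comb (charLp p) t fun k => ((intNorm k ^ α : ℝ) : ℂ) * b k‖))) * this

theorem exists_best_rpow_le_sum (hp : 1 < p) (hα : 0 < α) :
    ∃ C : ℝ, 0 ≤ C ∧ ∀ F : Lp ℂ (ENNReal.ofReal p) (torusMeasure d),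
      (∀ ε > 0, ∃ s c, ‖F - comb (charLp p) s c‖ ≤ ε) →
      ∀ (s : ℕ → Finset (Fin d → ℤ)) (c : ℕ → (Fin d → ℤ) → ℂ), (∀ k : ℕ, IsBest F (2 ^ k) (s k) (c k)) → ∀ (n : ℕ) (S : ℝ),
      (∀ N : ℕ, ∑ k ∈ Finset.range N, (((2 : ℝ) ^ (n + 1 + k)) ^ (-α) *
        lapNorm p α (s (n + 1 + k)) (c (n + 1 + k))) ^ min 2 p ≤ S) →
      ‖F - comb (charLp p) (s n) (c n)‖ ^ min 2 p ≤ C * S := by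
  obtain ⟨C, hC, h⟩ := exists_best_rpow_le_succ (d := d) hp hα
  refine ⟨C, hC, fun F hF s c hbest n S hS => ?_⟩
  have hθ : 0 < min 2 p := by have : 0 < p := by linarith
                              positivity
  refine le_of_forall_pos_le_add fun ε hε => ?_
  obtain ⟨t, b, htb⟩ := hF (ε ^ (1 / min 2 p)) (by positivity)
  obtain ⟨A, hA⟩ := (t.image fun k => intNorm k).bddAbove
  obtain ⟨M, hM⟩ := pow_unbounded_of_one_lt A (one_lt_two (α := ℝ))
  have h1 := (hbest (n + M)).2 t b fun k hk =>
    (hA (Finset.mem_coe.2 (Finset.mem_image_of_mem _ hk))).trans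
      (hM.le.trans (pow_le_pow_right₀ one_le_two (by omega)))
  have h2 : ‖F - comb (charLp p) (s (n + M)) (c (n + M))‖ ^ min 2 p ≤ ε := by
    refine (Real.rpow_le_rpow (norm_nonneg _) (h1.trans htb) hθ.le).trans (le_of_eq ?_)
    rw [← Real.rpow_mul hε.le, one_div_mul_cancel hθ.ne', Real.rpow_one]
  have h3 := le_add_sum_of_le_add
    (E := fun j => ‖F - comb (charLp p) (s (n + j)) (c (n + j))‖ ^ min 2 p)
    (fun j => h F (n + j) _ _ _ _ (hbest _) (hbest _)) M
  simp only [add_zero, ← add_assoc] at h3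
  rw [← Finset.mul_sum] at h3
  have h4 := mul_le_mul_of_nonneg_left (hS M) hC
  have e3 : ∀ k, n + 1 + k = n + k + 1 := fun k => by ring
  simp only [e3] at h4
  linarith

theorem exists_norm_diff_add_le_sum (hp : 1 < p) (hα : 0 < α) :
    ∃ C : ℝ, 0 ≤ C ∧ ∀ F : Lp ℂ (ENNReal.ofReal p) (torusMeasure d),
      (∀ ε > 0, ∃ s c, ‖F - comb (charLp p) s c‖ ≤ ε) →
      ∀ (s : ℕ → Finset (Fin d → ℤ)) (c : ℕ → (Fin d → ℤ) → ℂ),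
      (∀ k : ℕ, IsBest F (2 ^ k) (s k) (c k)) → ∀ (n : ℕ) (S : ℝ),
      (∀ N : ℕ, ∑ k ∈ Finset.range N, (((2 : ℝ) ^ (n + 1 + k)) ^ (-α) *
        lapNorm p α (s (n + 1 + k)) (c (n + 1 + k))) ^ min 2 p ≤ S) →
      ∀ h, euclNorm h ≤ 1 / 2 ^ n →
      ‖comb (charLp p) (s (n + 1)) (fun k => diffSymbol α (dot k h) * c (n + 1) k)‖ +
        binomMass α * ‖F - comb (charLp p) (s (n + 1)) (c (n + 1))‖ ≤ C * S ^ (1 / min 2 p) := by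
  have hp0 : 0 < p := by linarith
  have hθ : 0 < min 2 p := by positivity
  obtain ⟨K, hK⟩ := exists_rieszBound hp d
  obtain ⟨C₁, hC₁, h₁⟩ := exists_best_rpow_le_sum (d := d) hp hα
  obtain ⟨C₂, hC₂, h₂⟩ := exists_norm_diffSymbol_le hp0 hK hα
  have hM := binomMass_nonneg (α := α)
  have root : ∀ {x y : ℝ}, 0 ≤ x → x ^ min 2 p ≤ y → x ≤ y ^ (1 / min 2 p) := fun {x y} hx hxy => by
    have := Real.rpow_le_rpow (by positivity) hxy (one_div_pos.2 hθ).le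
    rwa [← Real.rpow_mul hx, mul_one_div_cancel hθ.ne', Real.rpow_one] at this
  refine ⟨C₂ * 2 ^ α + binomMass α * C₁ ^ (1 / min 2 p), by positivity,
    fun F hF s c hbest n S hS h hh => ?_⟩
  have hS0 : 0 ≤ S := by simpa using hS 0
  have hE : ‖F - comb (charLp p) (s (n + 1)) (c (n + 1))‖ ≤
      C₁ ^ (1 / min 2 p) * S ^ (1 / min 2 p) := by
    rw [← Real.mul_rpow hC₁ hS0]
    refine ((hbest (n + 1)).2 (s n) (c n) fun k hk => ((hbest n).1 k hk).trans
      (pow_le_pow_right₀ one_le_two n.le_succ)).trans ?_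
    exact root (norm_nonneg _) (h₁ F hF s c hbest n S hS)
  have hL : ((2 : ℝ) ^ (n + 1)) ^ (-α) * lapNorm p α (s (n + 1)) (c (n + 1)) ≤
      S ^ (1 / min 2 p) :=
    root (mul_nonneg (by positivity) (norm_nonneg _)) (by simpa using hS 1)
  have hD := h₂ (2 ^ n) (s (n + 1)) (by positivity)
    (fun k hk => ((hbest (n + 1)).1 k hk).trans_eq (pow_succ' _ _)) h hh (c (n + 1))
  have e : (2 : ℝ) ^ α * 2 ^ (-α) = 1 := by
    rw [← Real.rpow_add two_pos, add_neg_cancel, Real.rpow_zero]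
  have hD' := hD.trans_eq (b := C₂ * (((2 : ℝ) ^ n) ^ (-α) * lapNorm p α (s (n + 1)) (c (n + 1)))) rfl
  rw [two_pow_succ_rpow_neg] at hL
  have e2 : C₂ * (((2 : ℝ) ^ n) ^ (-α) * lapNorm p α (s (n + 1)) (c (n + 1))) =
      C₂ * 2 ^ α * (2 ^ (-α) * ((2 : ℝ) ^ n) ^ (-α) * lapNorm p α (s (n + 1)) (c (n + 1))) := by
    linear_combination (-(C₂ * (((2 : ℝ) ^ n) ^ (-α) *
      lapNorm p α (s (n + 1)) (c (n + 1))))) * e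
  rw [e2] at hD'
  have h5 := mul_le_mul_of_nonneg_left hL (show 0 ≤ C₂ * 2 ^ α by positivity)
  have h6 := mul_le_mul_of_nonneg_left hE hM
  linarith

end FracSmooth

namespace FracSmooth

variable {d : ℕ} {p α : ℝ} [Fact (1 ≤ ENNReal.ofReal p)]

lemma memLp_trig (s : Finset (Fin d → ℤ)) (c : (Fin d → ℤ) → ℂ) (q : ℝ≥0∞) :
    MemLp (trig s c) q (torusMeasure d) := memLp_of_continuous (continuous_trig s c) q

lemma norm_toLp_sub_comb {f : (Fin d → ℝ) → ℂ}
    (hf : MemLp f (ENNReal.ofReal p) (torusMeasure d)) (s : Finset (Fin d → ℤ))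
    (c : (Fin d → ℤ) → ℂ) : ‖hf.toLp f - comb (charLp p) s c‖ =
      (eLpNorm (f - trig s c) (ENNReal.ofReal p) (torusMeasure d)).toReal := by
  rw [comb_charLp, ← MemLp.toLp_sub, Lp.norm_toLp]

lemma ofReal_norm_toLp_sub_comb {f : (Fin d → ℝ) → ℂ}
    (hf : MemLp f (ENNReal.ofReal p) (torusMeasure d)) (s : Finset (Fin d → ℤ))
    (c : (Fin d → ℤ) → ℂ) : ENNReal.ofReal ‖hf.toLp f - comb (charLp p) s c‖ =
      eLpNorm (f - trig s c) (ENNReal.ofReal p) (torusMeasure d) := by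
  rw [norm_toLp_sub_comb, ENNReal.ofReal_toReal (hf.sub (memLp_trig s c _)).eLpNorm_ne_top]

lemma ofReal_norm_comb (s : Finset (Fin d → ℤ)) (c : (Fin d → ℤ) → ℂ) :
    ENNReal.ofReal ‖comb (charLp p) s c‖ =
      eLpNorm (trig s c) (ENNReal.ofReal p) (torusMeasure d) := by
  rw [norm_comb_charLp, ENNReal.ofReal_toReal (memLp_trig s c _).eLpNorm_ne_top]

lemma eLpNorm_fracDiff_le_add (hα : 0 < α) (hp : 0 < p) {f g : (Fin d → ℝ) → ℂ}
    (hfp : Periodic2Pi f) (hgp : Periodic2Pi g)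
    (hf : MemLp f (ENNReal.ofReal p) (torusMeasure d))
    (hg : MemLp g (ENNReal.ofReal p) (torusMeasure d)) (h : Fin d → ℝ) :
    eLpNorm (fracDiff α h f) (ENNReal.ofReal p) (torusMeasure d) ≤
      eLpNorm (fracDiff α h g) (ENNReal.ofReal p) (torusMeasure d) + ENNReal.ofReal (binomMass α) *
        eLpNorm (f - g) (ENNReal.ofReal p) (torusMeasure d) := by
  have hfgp : Periodic2Pi (f - g) := fun x i => by simp [hfp x i, hgp x i]
  have h1 := memLp_fracDiff hα hp hfgp (hf.sub hg) h
  have h2 := memLp_fracDiff hα hp hgp hg h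
  have e : fracDiff α h f =ᵐ[torusMeasure d] fracDiff α h g + fracDiff α h (f - g) := by
    filter_upwards [fracDiff_sub_ae hα hp hfp hgp hf hg h] with x hx
    simp [hx]
  rw [eLpNorm_congr_ae e]
  exact (eLpNorm_add_le h2.1.1 h1.1.1 Fact.out).trans (add_le_add le_rfl h1.2)

lemma fracModSmooth_ne_top (hα : 0 < α) (hp : 0 < p) {f : (Fin d → ℝ) → ℂ}
    (hfp : Periodic2Pi f) (hf : MemLp f (ENNReal.ofReal p) (torusMeasure d)) (δ : ℝ) :
    fracModSmooth d α (ENNReal.ofReal p) f δ ≠ ∞ :=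
  ne_top_of_le_ne_top (ENNReal.mul_ne_top ENNReal.ofReal_ne_top hf.eLpNorm_ne_top)
    (iSup_le fun h => (memLp_fracDiff hα hp hfp hf h.1).2)

lemma norm_comb_diff_le (hα : 0 < α) (hp : 0 < p) {f : (Fin d → ℝ) → ℂ}
    (hfp : Periodic2Pi f) (hf : MemLp f (ENNReal.ofReal p) (torusMeasure d)) {δ : ℝ}
    {h : Fin d → ℝ} (hh : euclNorm h ≤ δ) (s : Finset (Fin d → ℤ)) (c : (Fin d → ℤ) → ℂ) :
    ‖comb (charLp p) s (fun k => diffSymbol α (dot k h) * c k)‖ ≤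
      (fracModSmooth d α (ENNReal.ofReal p) f δ).toReal +
        binomMass α * ‖hf.toLp f - comb (charLp p) s c‖ := by
  have hM := binomMass_nonneg (α := α)
  have h1 := eLpNorm_fracDiff_le_add hα hp (periodic_trig s c) hfp (memLp_trig s c _) hf h
  have h2 : eLpNorm (fracDiff α h f) (ENNReal.ofReal p) (torusMeasure d) ≤
      fracModSmooth d α (ENNReal.ofReal p) f δ :=
    le_iSup (fun h : {h : Fin d → ℝ // euclNorm h ≤ δ} =>
      eLpNorm (fracDiff α h.1 f) (ENNReal.ofReal p) (torusMeasure d)) ⟨h, hh⟩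
  have h3 := h1.trans (add_le_add_left h2 _)
  rw [fracDiff_trig hα, ← ofReal_norm_comb, eLpNorm_sub_comm, ← ofReal_norm_toLp_sub_comb hf,
    ← ENNReal.ofReal_mul hM, ← ENNReal.ofReal_toReal (fracModSmooth_ne_top hα hp hfp hf δ),
    ← ENNReal.ofReal_add ENNReal.toReal_nonneg (by positivity)] at h3
  exact (ENNReal.ofReal_le_ofReal_iff (by positivity)).1 h3

lemma exists_norm_toLp_sub_comb_le {f : (Fin d → ℝ) → ℂ}
    (hf : MemLp f (ENNReal.ofReal p) (torusMeasure d)) :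
    ∀ ε > 0, ∃ s c, ‖hf.toLp f - comb (charLp p) s c‖ ≤ ε := fun ε hε => by
  obtain ⟨s, c, h⟩ := exists_trig_eLpNorm_sub_lt hf hε
  refine ⟨s, c, (ENNReal.ofReal_le_ofReal_iff hε.le).1 ?_⟩
  rwa [ofReal_norm_toLp_sub_comb]

lemma isBest_of_eLpNorm_eq_iInf {f : (Fin d → ℝ) → ℂ}
    (hf : MemLp f (ENNReal.ofReal p) (torusMeasure d)) {n : ℝ} {s : Finset (Fin d → ℤ)}
    {c : (Fin d → ℤ) → ℂ} (hs : ∀ k ∈ s, intNorm k ≤ n)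
    (h : eLpNorm (fun x => f x - trig s c x) (ENNReal.ofReal p) (torusMeasure d) =
      ⨅ T ∈ TrigPoly d n, eLpNorm (fun x => f x - T x) (ENNReal.ofReal p) (torusMeasure d)) :
    IsBest (hf.toLp f) n s c := by
  refine ⟨hs, fun t b ht => (ENNReal.ofReal_le_ofReal_iff (norm_nonneg _)).1 ?_⟩
  rw [ofReal_norm_toLp_sub_comb, ofReal_norm_toLp_sub_comb]
  exact h.le.trans (iInf₂_le (trig t b) (mem_trigPoly ht))

lemma two_rpow_mul_eLpNorm_fracLaplacian (s : Finset (Fin d → ℤ)) (c : (Fin d → ℤ) → ℂ) (m : ℕ) :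
    (2 : ℝ≥0∞) ^ (-(m : ℝ) * α) * eLpNorm (fracLaplacian d α (trig s c)) (ENNReal.ofReal p)
      (torusMeasure d) = ENNReal.ofReal (((2 : ℝ) ^ m) ^ (-α) * lapNorm p α s c) := by
  rw [ENNReal.ofReal_mul (by positivity), lapNorm, ofReal_norm_comb, fracLaplacian_trig,
    ← ENNReal.ofReal_rpow_of_pos (by positivity), ENNReal.ofReal_pow two_pos.le,
    ← ENNReal.rpow_natCast, ← ENNReal.rpow_mul, ENNReal.ofReal_ofNat]
  ring_nf

lemma sum_range_ofReal_rpow {a : ℕ → ℝ} (ha : ∀ k, 0 ≤ a k) {q : ℝ} (hq : 0 ≤ q) (N : ℕ) :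
    ∑ k ∈ Finset.range N, ENNReal.ofReal (a k) ^ q =
      ENNReal.ofReal (∑ k ∈ Finset.range N, a k ^ q) := by
  rw [ENNReal.ofReal_sum_of_nonneg fun k _ => Real.rpow_nonneg (ha k) q]
  exact Finset.sum_congr rfl fun k _ => ENNReal.ofReal_rpow_of_nonneg (ha k) hq

end FracSmooth

/-- For `f ∈ L_p(𝕋^d)`, `1 < p < ∞`, `α > 0`, `τ = max(2,p)`,
`θ = min(2,p)`, and best trigonometric approximants `P_{2^k}(f)`,
`(∑_{k>n} 2^{-kατ} ‖(−Δ)^{α/2}P_{2^k}(f)‖_p^τ)^{1/τ} ≲ ω_α(f,2^{-n})_p ≲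
  (∑_{k>n} 2^{-kαθ} ‖(−Δ)^{α/2}P_{2^k}(f)‖_p^θ)^{1/θ}`. -/
theorem stmt10 (d : ℕ) (hd : 0 < d) (p : ℝ) (hp1 : 1 < p) (α : ℝ)
    (hα : 0 < α) :
    ∃ C : ℝ≥0∞, 0 < C ∧ C ≠ ∞ ∧
      ∀ f : (Fin d → ℝ) → ℂ, Periodic2Pi f →
        AEStronglyMeasurable f (torusMeasure d) →
        eLpNorm f (ENNReal.ofReal p) (torusMeasure d) ≠ ∞ →
        ∀ P : ℕ → (Fin d → ℝ) → ℂ,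
          (∀ m : ℕ, P m ∈ TrigPoly d m ∧
            eLpNorm (fun x => f x - P m x) (ENNReal.ofReal p) (torusMeasure d) =
              ⨅ T ∈ TrigPoly d (m : ℝ),
                eLpNorm (fun x => f x - T x) (ENNReal.ofReal p) (torusMeasure d)) →
          ∀ n : ℕ, 1 ≤ n →
            (∑' k : ℕ,
                ((2 : ℝ≥0∞) ^ (-((n + 1 + k : ℕ) : ℝ) * α) *
                  eLpNorm (fracLaplacian d α (P (2 ^ (n + 1 + k))))
                    (ENNReal.ofReal p) (torusMeasure d)) ^ max 2 p) ^ (1 / max 2 p)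
              ≤ C * fracModSmooth d α (ENNReal.ofReal p) f (1 / 2 ^ n) ∧
            fracModSmooth d α (ENNReal.ofReal p) f (1 / 2 ^ n)
              ≤ C * (∑' k : ℕ,
                  ((2 : ℝ≥0∞) ^ (-((n + 1 + k : ℕ) : ℝ) * α) *
                    eLpNorm (fracLaplacian d α (P (2 ^ (n + 1 + k))))
                      (ENNReal.ofReal p) (torusMeasure d)) ^ min 2 p) ^ (1 / min 2 p) := by
  have hp0 : 0 < p := by linarith
  have : Fact (1 ≤ ENNReal.ofReal p) := ⟨by simpa using ENNReal.ofReal_le_ofReal hp1.le⟩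
  have hτ : 0 < max 2 p := by positivity
  have hθ : 0 < min 2 p := by positivity
  have hM := FracSmooth.binomMass_nonneg (α := α)
  obtain ⟨C₁, hC₁, h₁⟩ := FracSmooth.exists_sum_lapNorm_le hd hp1 hα
  obtain ⟨C₂, hC₂, h₂⟩ := FracSmooth.exists_norm_diff_add_le_sum (d := d) hp1 hα
  have hle₁ : ENNReal.ofReal (C₁ ^ (1 / max 2 p)) ≤ ENNReal.ofReal (1 + C₁ ^ (1 / max 2 p) + C₂) :=
    ENNReal.ofReal_le_ofReal (by linarith)
  have hle₂ : ENNReal.ofReal C₂ ≤ ENNReal.ofReal (1 + C₁ ^ (1 / max 2 p) + C₂) :=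
    ENNReal.ofReal_le_ofReal (by linarith [Real.rpow_nonneg hC₁ (1 / max 2 p)])
  refine ⟨ENNReal.ofReal (1 + C₁ ^ (1 / max 2 p) + C₂), by positivity, ENNReal.ofReal_ne_top,
    fun f hfp hfm hft P hP n _ => ?_⟩
  have hf : MemLp f (ENNReal.ofReal p) (torusMeasure d) := ⟨hfm, hft.lt_top⟩
  choose s c hs hPc using fun k => (hP (2 ^ k)).1
  have hPt : ∀ k, P (2 ^ k) = FracSmooth.trig (s k) (c k) := fun k => funext (hPc k)
  have hbest : ∀ k : ℕ, FracSmooth.IsBest (hf.toLp f) (2 ^ k) (s k) (c k) := fun k => by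
    have h := (hP (2 ^ k)).2
    have hsk := hs k
    rw [hPt k] at h
    push_cast at h hsk
    exact FracSmooth.isBest_of_eLpNorm_eq_iInf hf hsk h
  have hdense := FracSmooth.exists_norm_toLp_sub_comb_le hf
  simp only [hPt, FracSmooth.two_rpow_mul_eLpNorm_fracLaplacian]
  set a : ℕ → ℝ := fun k => ((2 : ℝ) ^ (n + 1 + k)) ^ (-α) *
    FracSmooth.lapNorm p α (s (n + 1 + k)) (c (n + 1 + k)) with ha
  have ha0 : ∀ k, 0 ≤ a k := fun k => mul_nonneg (by positivity) (norm_nonneg _)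
  constructor
  · set W := (fracModSmooth d α (ENNReal.ofReal p) f (1 / 2 ^ n)).toReal with hW
    have h := h₁ (hf.toLp f) hdense s c hbest n W ENNReal.toReal_nonneg fun h hh s c =>
      FracSmooth.norm_comb_diff_le hα hp0 hfp hf hh s c
    have h' : ∑' k, ENNReal.ofReal (a k) ^ max 2 p ≤ ENNReal.ofReal (C₁ * W ^ max 2 p) :=
      ENNReal.tsum_le_of_sum_range_le fun N => by
        rw [FracSmooth.sum_range_ofReal_rpow ha0 hτ.le]
        exact ENNReal.ofReal_le_ofReal (h N)
    have hW0 : 0 ≤ W := ENNReal.toReal_nonneg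
    refine (ENNReal.rpow_le_rpow h' (by positivity)).trans ?_
    rw [ENNReal.ofReal_rpow_of_nonneg (by positivity) (by positivity),
      Real.mul_rpow hC₁ (by positivity), ← Real.rpow_mul hW0, mul_one_div_cancel hτ.ne',
      Real.rpow_one, ENNReal.ofReal_mul (by positivity), hW,
      ENNReal.ofReal_toReal (FracSmooth.fracModSmooth_ne_top hα hp0 hfp hf _)]
    exact mul_le_mul_left hle₁ _
  · by_cases htop : ∑' k, ENNReal.ofReal (a k) ^ min 2 p = ∞
    · rw [htop, ENNReal.top_rpow_of_pos (by positivity), ENNReal.mul_top (by positivity)]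
      exact le_top
    set S := (∑' k, ENNReal.ofReal (a k) ^ min 2 p).toReal
    have hSN : ∀ N, ∑ k ∈ Finset.range N, a k ^ min 2 p ≤ S := fun N => by
      refine (ENNReal.ofReal_le_iff_le_toReal htop).1 ?_
      rw [← FracSmooth.sum_range_ofReal_rpow ha0 hθ.le]
      exact ENNReal.sum_le_tsum _
    have h := h₂ (hf.toLp f) hdense s c hbest n S hSN
    refine le_trans (b := ENNReal.ofReal (C₂ * S ^ (1 / min 2 p))) (iSup_le fun y => ?_) ?_
    · refine (FracSmooth.eLpNorm_fracDiff_le_add hα hp0 hfp (FracSmooth.periodic_trig _ _) hf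
        (FracSmooth.memLp_trig (s (n + 1)) (c (n + 1)) _) y.1).trans ?_
      rw [FracSmooth.fracDiff_trig hα, ← FracSmooth.ofReal_norm_comb,
        ← FracSmooth.ofReal_norm_toLp_sub_comb hf, ← ENNReal.ofReal_mul hM,
        ← ENNReal.ofReal_add (norm_nonneg _) (by positivity)]
      exact ENNReal.ofReal_le_ofReal (h y.1 y.2)
    · rw [ENNReal.ofReal_mul hC₂, ← ENNReal.ofReal_rpow_of_nonneg ENNReal.toReal_nonneg
        (by positivity), ENNReal.ofReal_toReal htop]
      exact mul_le_mul_left hle₂ _
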